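/- Let $X$ be a smooth closed subvariety of dimension $d$ in $\mathbb{C}^n$, let $l:\mathbb{C}^n\to\mathbb{C}$ be a general linear function, and let $H_c = \{l = c\}$ for a general $c\in\mathbb{C}$. Then: (1) $X$ is homotopy equivalent to $X\cap H_c$ with finitely many $d$-cells attached; (2) the number of these $d$-cells equals the number of critical points of $l|_X$; (3) the number of critical points of $l|_X$ equals $(-1)^d\,\chi(X\setminus H_c)$. -/

import Mathlib

open scoped Manifold Topology
open Filter

noncomputable section

namespace PaperED

/-! Affine algebraic geometry over ℂ: algebraic subsets of ℂⁿ, genericity,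
Zariski tangent spaces, smoothness, and the Euclidean distance degree. -/

/-- "P holds for a general point": P holds on a nonempty Zariski-open subset. -/
def Generically {K : Type} [CommSemiring K] {σ : Type} (P : (σ → K) → Prop) : Prop :=
  ∃ q : MvPolynomial σ K, q ≠ 0 ∧ ∀ a : σ → K, MvPolynomial.eval a q ≠ 0 → P a

/-- Affine algebraic subsets of ℂⁿ (common zero loci of polynomials). -/
def IsAlgSet {n : ℕ} (X : Set (Fin n → ℂ)) : Prop :=
  ∃ S : Set (MvPolynomial (Fin n) ℂ),
    X = {x | ∀ p ∈ S, MvPolynomial.eval x p = 0}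

/-- The differential of a polynomial at a point, as a linear functional. -/
def diffAt {n : ℕ} (p : MvPolynomial (Fin n) ℂ) (x : Fin n → ℂ) : (Fin n → ℂ) →ₗ[ℂ] ℂ :=
  ∑ i, MvPolynomial.eval x (MvPolynomial.pderiv i p) • LinearMap.proj i

/-- The Zariski tangent space of `X ⊆ ℂⁿ` at `x`. -/
def zTangent {n : ℕ} (X : Set (Fin n → ℂ)) (x : Fin n → ℂ) : Submodule ℂ (Fin n → ℂ) :=
  ⨅ p ∈ {p : MvPolynomial (Fin n) ℂ | ∀ y ∈ X, MvPolynomial.eval y p = 0},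
    LinearMap.ker (diffAt p x)

/-- `ψ` is a local holomorphic parametrization of `S` around `x`, with `d` parameters. -/
def IsParamAt {E : Type} [NormedAddCommGroup E] [NormedSpace ℂ E]
    (S : Set E) (x : E) (d : ℕ) (ψ : (Fin d → ℂ) → E) (U : Set (Fin d → ℂ)) : Prop :=
  IsOpen U ∧ (0 : Fin d → ℂ) ∈ U ∧ ψ 0 = x ∧ DifferentiableOn ℂ ψ U ∧
    Set.InjOn ψ U ∧ Function.Injective (fderiv ℂ ψ 0) ∧
    ∃ V ∈ 𝓝 x, ψ '' U = S ∩ V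

/-- `S` is, near `x`, a `d`-dimensional complex submanifold. -/
def IsSmoothGermAt {E : Type} [NormedAddCommGroup E] [NormedSpace ℂ E]
    (S : Set E) (x : E) (d : ℕ) : Prop :=
  ∃ ψ U, IsParamAt S x d ψ U

/-- `X` is a (nonempty) smooth closed subvariety of ℂⁿ of pure dimension `d`. -/
def IsSmoothClosedOfDim {n : ℕ} (X : Set (Fin n → ℂ)) (d : ℕ) : Prop :=
  IsAlgSet X ∧ X.Nonempty ∧
    ∀ x ∈ X, IsSmoothGermAt X x d ∧ Module.finrank ℂ ↥(zTangent X x) = d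

/-- Critical points of the squared distance function `f_α` on the locus of `X` where
the tangent space has dimension `d` (the smooth locus, when `dim X = d`):
the vector `x - α` is orthogonal to the tangent space w.r.t. `∑ zᵢwᵢ`. -/
def edCritSet {n : ℕ} (X : Set (Fin n → ℂ)) (d : ℕ) (α : Fin n → ℂ) : Set (Fin n → ℂ) :=
  {x | x ∈ X ∧ Module.finrank ℂ ↥(zTangent X x) = d ∧
    ∀ v ∈ zTangent X x, (∑ i, (x i - α i) * v i) = 0}

/-- The Euclidean distance degree of `X` (of dimension `d`) equals `k`: for a general
data point `α`, the squared distance function `f_α` has exactly `k` critical points on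
the smooth locus of `X`. -/
def HasEDDeg {n : ℕ} (X : Set (Fin n → ℂ)) (d : ℕ) (k : ℕ) : Prop :=
  Generically (K := ℂ) (σ := Fin n) fun α =>
    (edCritSet X d α).Finite ∧ (edCritSet X d α).ncard = k

/-- `U_β`: the complement in ℂⁿ of the hypersurface `∑ (zᵢ - βᵢ)² + β₀ = 0`. -/
def quadCompl {n : ℕ} (β : Fin (n + 1) → ℂ) : Set (Fin n → ℂ) :=
  {z | (∑ i : Fin n, (z i - β i.succ) ^ 2) + β 0 ≠ 0}

/-! Topological Euler characteristic, via homotopy equivalence with a space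
built from finitely many cells. -/

def cellSphere (d : ℕ) : Set (EuclideanSpace ℝ (Fin d)) := Metric.sphere 0 1
def cellBall (d : ℕ) : Set (EuclideanSpace ℝ (Fin d)) := Metric.closedBall 0 1

def attachRel {d : ℕ} {A : Type} [TopologicalSpace A] (φ : C(↥(cellSphere d), A)) :
    (A ⊕ ↥(cellBall d)) → (A ⊕ ↥(cellBall d)) → Prop := fun p q =>
  ∃ x : ↥(cellSphere d),
    p = Sum.inl (φ x) ∧ q = Sum.inr ⟨x.1, Metric.sphere_subset_closedBall x.2⟩

/-- The space obtained from `A` by attaching a `d`-cell along `φ`. -/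
def attachSp {d : ℕ} {A : Type} [TopologicalSpace A] (φ : C(↥(cellSphere d), A)) : Type :=
  Quot (attachRel φ)

instance {d : ℕ} {A : Type} [TopologicalSpace A] (φ : C(↥(cellSphere d), A)) :
    TopologicalSpace (attachSp φ) := inferInstanceAs (TopologicalSpace (Quot _))

/-- `B` is (homeomorphic to) the result of attaching one `d`-cell to `A`. -/
def AttachOneCell (A B : TopCat.{0}) (d : ℕ) : Prop :=
  ∃ φ : C(↥(cellSphere d), ↑A), Nonempty (↑B ≃ₜ attachSp φ)

/-- `Z` is obtained from `A` by attaching cells whose dimensions are listed in `L`. -/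
def AttachedCells : TopCat.{0} → TopCat.{0} → List ℕ → Prop
  | A, Z, [] => Nonempty (↑A ≃ₜ ↑Z)
  | A, Z, d :: L => ∃ B : TopCat.{0}, AttachOneCell A B d ∧ AttachedCells B Z L

/-- `X` has (topological) Euler characteristic `c`: `X` is homotopy equivalent to a
space built from finitely many cells, and `c` is the alternating sum of the
numbers of cells. -/
def HasEulerChar (X : Type) [TopologicalSpace X] (c : ℤ) : Prop :=
  ∃ (Z : TopCat.{0}) (L : List ℕ),
    AttachedCells (TopCat.of Empty) Z L ∧
    Nonempty (ContinuousMap.HomotopyEquiv X ↑Z) ∧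
    c = (L.map fun d => (-1 : ℤ) ^ d).sum

open scoped IntermediateField.algebraAdjoinAdjoin TensorProduct in
lemma exists_derivation_of_algebraicIndependent {k K ι : Type} [Field k] [CharZero k] [Field K]
    [Algebra k K] [DecidableEq ι] (x : ι → K) (hx : AlgebraicIndependent k x) (j : ι) :
    ∃ D : Derivation k K K, ∀ i, D (x i) = if i = j then 1 else 0 := by
  classical
  obtain ⟨s, hs, hsb⟩ := exists_isTranscendenceBasis_superset hx.to_subtype_range
  have hb := hsb.1
  let v : s → K := Subtype.val
  let P := MvPolynomial s k
  let A := Algebra.adjoin k (Set.range v)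
  let F := IntermediateField.adjoin k (Set.range v)
  let : Algebra P A := hb.aevalEquiv.toRingHom.toAlgebra
  let : Algebra P K := (MvPolynomial.aeval (R := k) v).toRingHom.toAlgebra
  have : IsScalarTower P A K := IsScalarTower.of_algebraMap_eq fun p => by
    exact (hb.algebraMap_aevalEquiv p).symm
  have : IsScalarTower k P K := IsScalarTower.of_algebraMap_eq fun p => by
    exact ((MvPolynomial.aeval (R := k) v).commutes p).symm
  have : Algebra.FormallyEtale P A :=
    Algebra.FormallyEtale.of_equiv (A := P) (AlgEquiv.ofBijective (Algebra.ofId P A)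
      hb.aevalEquiv.bijective)
  have : Algebra.FormallyEtale A F := .of_isLocalization (nonZeroDivisors A)
  have : Algebra.IsAlgebraic F K := hsb.isAlgebraic_field
  have : Algebra.FormallyEtale F K := .of_isSeparable F K
  have : Algebra.FormallyEtale A K := .comp A F K
  have : Algebra.FormallyEtale P K := .comp P A K
  have hinj : Function.Injective x := hx.injective
  let e := KaehlerDifferential.tensorKaehlerEquivOfFormallyEtale k P K
  let d0 : Derivation k P K := MvPolynomial.mkDerivation k
    (fun a : s => if (a : K) = x j then (1 : K) else 0)
  let L : K ⊗[P] Ω[P⁄k] →ₗ[K] K := d0.liftKaehlerDifferential.liftBaseChange K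
  let M : Ω[K⁄k] →ₗ[K] K := L ∘ₗ e.symm.toLinearMap
  refine ⟨M.compDer (KaehlerDifferential.D k K), fun i => ?_⟩
  have hxi : x i = algebraMap P K (MvPolynomial.X ⟨x i, hs ⟨i, rfl⟩⟩) :=
    (MvPolynomial.aeval_X v ⟨x i, hs ⟨i, rfl⟩⟩).symm
  have h1 : e.symm (KaehlerDifferential.D k K (x i)) =
      1 ⊗ₜ KaehlerDifferential.D k P (MvPolynomial.X ⟨x i, hs ⟨i, rfl⟩⟩) := by
    refine (congrArg (fun t => e.symm (KaehlerDifferential.D k K t)) hxi).trans ?_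
    exact KaehlerDifferential.tensorKaehlerEquivOfFormallyEtale_symm_D_algebraMap k P K _
  change L (e.symm (KaehlerDifferential.D k K (x i))) = _
  rw [h1, LinearMap.liftBaseChange_tmul, Derivation.liftKaehlerDifferential_comp_D,
    MvPolynomial.mkDerivation_X]
  simp [hinj.eq_iff]

lemma eval_aeval_eq {σ ι : Type} (φ : ι → MvPolynomial σ ℂ) (y : σ → ℂ) (q : MvPolynomial ι ℂ) :
    MvPolynomial.eval y (MvPolynomial.aeval φ q) =
      MvPolynomial.eval (fun i => MvPolynomial.eval y (φ i)) q := by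
  induction q using MvPolynomial.induction_on with
  | C a => simp
  | add p q hp hq => rw [map_add, map_add, map_add, hp, hq]
  | mul_X p i hp => rw [map_mul, map_mul, map_mul, hp, MvPolynomial.aeval_X, MvPolynomial.eval_X]

open MvPolynomial in
lemma derivation_eq_sum_pderiv {k σ K : Type} [Fintype σ] [Field k] [Field K] [Algebra k K]
    (D : Derivation k K K) (θ : MvPolynomial σ k →ₐ[k] K) (p : MvPolynomial σ k) :
    D (θ p) = ∑ s, θ (pderiv s p) * D (θ (X s)) := by
  classical
  induction p using MvPolynomial.induction_on with
  | C a =>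
    rw [← MvPolynomial.algebraMap_eq, AlgHom.commutes]
    simp
  | add p q hp hq => simp [hp, hq, add_mul, Finset.sum_add_distrib]
  | mul_X p i hp =>
    simp only [map_mul, Derivation.leibniz, hp, smul_eq_mul, pderiv_X, map_add, add_mul,
      Finset.sum_add_distrib, Finset.mul_sum]
    congr 1
    · rw [Finset.sum_eq_single i]
      · simp
      · intro b _ hb
        simp [Pi.single_apply, hb.symm]
      · simp
    · exact Finset.sum_congr rfl fun s _ => by ring

open MvPolynomial in
/-- The generic submersivity theorem for the restriction of a polynomial map to an affine
variety. -/
theorem exists_generic_submersion {σ ι : Type} [Fintype σ] [Fintype ι]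
    (φ : ι → MvPolynomial σ ℂ) (I : Ideal (MvPolynomial σ ℂ)) :
    ∃ q : MvPolynomial ι ℂ, q ≠ 0 ∧ ∀ y : σ → ℂ, (∀ p ∈ I, eval y p = 0) →
      eval (fun i => eval y (φ i)) q ≠ 0 → ∀ b : ι → ℂ, ∃ v : σ → ℂ,
        (∀ p ∈ I, ∑ s, eval y (pderiv s p) * v s = 0) ∧
        ∀ i, ∑ s, eval y (pderiv s (φ i)) * v s = b i := by
  classical
  induction I using WellFoundedGT.induction with
  | ind I ih =>
  by_cases htop : I = ⊤
  · refine ⟨1, one_ne_zero, fun y hy => ?_⟩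
    have := hy 1 (htop ▸ Submodule.mem_top)
    simp at this
  by_cases hprime : I.IsPrime
  swap
  · obtain ⟨f, hf, g, hg, hfg⟩ : ∃ f, f ∉ I ∧ ∃ g, g ∉ I ∧ f * g ∈ I := by
      by_contra! h
      refine hprime ⟨htop, fun {x y} hxy => ?_⟩
      by_contra! h'
      exact h x h'.1 y h'.2 hxy
    have key : ∀ f ∉ I, I < I ⊔ Ideal.span {f} := fun f hf =>
      lt_of_le_of_ne le_sup_left fun h => hf (h ▸ Ideal.mem_sup_right
        (Ideal.subset_span rfl))
    obtain ⟨q1, hq1, h1⟩ := ih _ (key f hf)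
    obtain ⟨q2, hq2, h2⟩ := ih _ (key g hg)
    have key2 : ∀ f, ∀ y : σ → ℂ, (∀ p ∈ I, eval y p = 0) → eval y f = 0 →
        ∀ p ∈ I ⊔ Ideal.span {f}, eval y p = 0 := by
      intro f y hy hf p hp
      obtain ⟨a, ha, b, hb, rfl⟩ := Submodule.mem_sup.1 hp
      obtain ⟨r, rfl⟩ := Ideal.mem_span_singleton'.1 hb
      simp [hy a ha, hf]
    refine ⟨q1 * q2, mul_ne_zero hq1 hq2, fun y hy hq b => ?_⟩
    rw [map_mul] at hq
    have : eval y f * eval y g = 0 := by rw [← map_mul]; exact hy _ hfg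
    rcases mul_eq_zero.1 this with h0 | h0
    · obtain ⟨v, hv, hv'⟩ := h1 y (key2 f y hy h0) (left_ne_zero_of_mul hq) b
      exact ⟨v, fun p hp => hv p (Ideal.mem_sup_left hp), hv'⟩
    · obtain ⟨v, hv, hv'⟩ := h2 y (key2 g y hy h0) (right_ne_zero_of_mul hq) b
      exact ⟨v, fun p hp => hv p (Ideal.mem_sup_left hp), hv'⟩
  let B := MvPolynomial σ ℂ ⧸ I
  let K := FractionRing B
  let θ : MvPolynomial σ ℂ →ₐ[ℂ] K := (Algebra.ofId B K |>.restrictScalars ℂ).comp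
    (Ideal.Quotient.mkₐ ℂ I)
  have hθ0 : ∀ p, θ p = 0 ↔ p ∈ I := by
    intro p
    change algebraMap B K (Ideal.Quotient.mk I p) = 0 ↔ _
    rw [map_eq_zero_iff _ (IsFractionRing.injective B K), Ideal.Quotient.eq_zero_iff_mem]
  by_cases hind : AlgebraicIndependent ℂ (fun i => θ (φ i))
  swap
  · obtain ⟨q, hq, hq0⟩ : ∃ q : MvPolynomial ι ℂ, aeval (fun i => θ (φ i)) q = 0 ∧ q ≠ 0 := by
      by_contra! h
      exact hind (algebraicIndependent_iff.2 h)
    refine ⟨q, hq0, fun y hy hne => (hne ?_).elim⟩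
    have h1 : θ (aeval φ q) = 0 := by
      rw [← hq, ← AlgHom.comp_apply, comp_aeval]
    have h2 := hy _ ((hθ0 _).1 h1)
    rw [← h2, eval_aeval_eq]
  choose D hD using fun j => exists_derivation_of_algebraicIndependent _ hind j
  obtain ⟨g, hg⟩ := IsLocalization.exist_integer_multiples_of_finite (nonZeroDivisors B)
    (fun js : ι × σ => D js.1 (θ (X js.2)))
  obtain ⟨G, hG⟩ := Ideal.Quotient.mk_surjective (I := I) (g : B)
  have hN : ∀ j s, ∃ N : MvPolynomial σ ℂ, θ N = θ G * D j (θ (X s)) := by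
    intro j s
    obtain ⟨b, hb⟩ := hg (j, s)
    obtain ⟨N, hN⟩ := Ideal.Quotient.mk_surjective (I := I) b
    refine ⟨N, ?_⟩
    change algebraMap B K (Ideal.Quotient.mk I N) = algebraMap B K (Ideal.Quotient.mk I G) * _
    rw [hN, hG, hb]
    exact Algebra.smul_def _ _
  choose N hN using hN
  have hGI : G ∉ I := by
    intro h
    rw [← Ideal.Quotient.eq_zero_iff_mem, hG] at h
    exact nonZeroDivisors.coe_ne_zero g h
  have hsum : ∀ j p, θ (∑ s, pderiv s p * N j s) = θ G * D j (θ p) := by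
    intro j p
    rw [derivation_eq_sum_pderiv, map_sum, Finset.mul_sum]
    exact Finset.sum_congr rfl fun s _ => by rw [map_mul, hN]; ring
  have hI : ∀ j, ∀ p ∈ I, ∑ s, pderiv s p * N j s ∈ I := by
    intro j p hp
    rw [← hθ0, hsum, (hθ0 p).2 hp]
    simp
  have hφ : ∀ j i, (∑ s, pderiv s (φ i) * N j s) - (if i = j then G else 0) ∈ I := by
    intro j i
    rw [← hθ0, map_sub, hsum, hD]
    split_ifs <;> simp
  have hlt : I < I ⊔ Ideal.span {G} := lt_of_le_of_ne le_sup_left fun h =>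
    hGI (h ▸ Ideal.mem_sup_right (Ideal.subset_span rfl))
  obtain ⟨q, hq0, hq⟩ := ih _ hlt
  refine ⟨q, hq0, fun y hy hqy b => ?_⟩
  by_cases hGy : eval y G = 0
  · obtain ⟨v, hv, hv'⟩ := hq y (by
      intro p hp
      obtain ⟨a, ha, b, hb, rfl⟩ := Submodule.mem_sup.1 hp
      obtain ⟨r, rfl⟩ := Ideal.mem_span_singleton'.1 hb
      simp [hy a ha, hGy]) hqy b
    exact ⟨v, fun p hp => hv p (Ideal.mem_sup_left hp), hv'⟩
  have hrew : ∀ p, ∑ s, eval y (pderiv s p) * (∑ j, b j * eval y (N j s) / eval y G) =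
      ∑ j, b j / eval y G * eval y (∑ s, pderiv s p * N j s) := by
    intro p
    simp only [map_sum, map_mul, Finset.mul_sum]
    rw [Finset.sum_comm]
    exact Finset.sum_congr rfl fun _ _ => Finset.sum_congr rfl fun _ _ => by ring
  refine ⟨fun s => ∑ j, b j * eval y (N j s) / eval y G, fun p hp => ?_, fun i => ?_⟩
  · rw [hrew]
    exact Finset.sum_eq_zero fun j _ => by rw [hy _ (hI j p hp), mul_zero]
  · rw [hrew, Finset.sum_eq_single i]
    · have := hy _ (hφ i i)
      rw [map_sub, sub_eq_zero, if_pos rfl] at this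
      rw [this]
      field_simp
    · intro j _ hj
      have := hy _ (hφ j i)
      rw [map_sub, sub_eq_zero, if_neg hj.symm, map_zero] at this
      rw [this, mul_zero]
    · simp

/-- The derivative of a polynomial at `y` in the direction `v`. -/
def polyDer {σ : Type} [Fintype σ] (y v : σ → ℂ) : MvPolynomial σ ℂ →ₗ[ℂ] ℂ where
  toFun p := ∑ s, MvPolynomial.eval y (MvPolynomial.pderiv s p) * v s
  map_add' p q := by simp [add_mul, Finset.sum_add_distrib]
  map_smul' c p := by simp [Finset.mul_sum, mul_assoc]

lemma polyDer_apply {σ : Type} [Fintype σ] (y v : σ → ℂ) (p : MvPolynomial σ ℂ) :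
    polyDer y v p = ∑ s, MvPolynomial.eval y (MvPolynomial.pderiv s p) * v s := rfl

lemma polyDer_mul {σ : Type} [Fintype σ] (y v : σ → ℂ) (p q : MvPolynomial σ ℂ) :
    polyDer y v (p * q) = MvPolynomial.eval y p * polyDer y v q +
      MvPolynomial.eval y q * polyDer y v p := by
  simp only [polyDer_apply, Derivation.leibniz, smul_eq_mul, map_add, map_mul, add_mul,
    Finset.sum_add_distrib, Finset.mul_sum, mul_assoc]

lemma polyDer_X {σ : Type} [Fintype σ] (y v : σ → ℂ) (s : σ) :
    polyDer y v (MvPolynomial.X s) = v s := by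
  classical
  rw [polyDer_apply, Finset.sum_eq_single s]
  · simp
  · intro b _ hb
    simp [MvPolynomial.pderiv_X, hb.symm]
  · simp

lemma polyDer_C {σ : Type} [Fintype σ] (y v : σ → ℂ) (c : ℂ) :
    polyDer y v (MvPolynomial.C c) = 0 := by
  simp [polyDer_apply]

lemma polyDer_rename {σ τ : Type} [Fintype σ] [Fintype τ] (f : τ → σ) (y v : σ → ℂ)
    (p : MvPolynomial τ ℂ) :
    polyDer y v (MvPolynomial.rename f p) = polyDer (y ∘ f) (v ∘ f) p := by
  induction p using MvPolynomial.induction_on with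
  | C a => simp [polyDer_C]
  | add p q hp hq => simp [hp, hq]
  | mul_X p i hp =>
    simp [polyDer_mul, hp, polyDer_X, MvPolynomial.eval_rename]

lemma diffAt_apply {n : ℕ} (p : MvPolynomial (Fin n) ℂ) (x v : Fin n → ℂ) :
    diffAt p x v = polyDer x v p := by
  simp [diffAt, polyDer_apply]

lemma mem_zTangent_iff {n : ℕ} {X : Set (Fin n → ℂ)} {x v : Fin n → ℂ} :
    v ∈ zTangent X x ↔ ∀ p : MvPolynomial (Fin n) ℂ,
      (∀ y ∈ X, MvPolynomial.eval y p = 0) → polyDer x v p = 0 := by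
  simp [zTangent, Submodule.mem_iInf, diffAt_apply]

/-- Finitely many generators of the vanishing ideal. -/
lemma exists_generators {n : ℕ} (X : Set (Fin n → ℂ)) :
    ∃ (m : ℕ) (p : Fin m → MvPolynomial (Fin n) ℂ),
      (∀ i, ∀ y ∈ X, MvPolynomial.eval y (p i) = 0) ∧
      ∀ x ∈ X, ∀ v, v ∈ zTangent X x ↔ ∀ i, polyDer x v (p i) = 0 := by
  let J : Ideal (MvPolynomial (Fin n) ℂ) :=
    { carrier := {p | ∀ y ∈ X, MvPolynomial.eval y p = 0}
      add_mem' := fun ha hb y hy => by rw [map_add, ha y hy, hb y hy, add_zero]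
      zero_mem' := fun y _ => map_zero _
      smul_mem' := fun c p hp y hy => by rw [smul_eq_mul, map_mul, hp y hy, mul_zero] }
  obtain ⟨m, p, hp⟩ := Submodule.fg_iff_exists_fin_generating_family.1
    ((isNoetherianRing_iff_ideal_fg _).1 inferInstance J)
  have hpJ : ∀ i, p i ∈ J := fun i => hp ▸ Submodule.subset_span ⟨i, rfl⟩
  refine ⟨m, p, hpJ, fun x hx v => ?_⟩
  rw [mem_zTangent_iff]
  refine ⟨fun h i => h _ (hpJ i), fun h q hq => ?_⟩
  have hq' : q ∈ Submodule.span (MvPolynomial (Fin n) ℂ) (Set.range p) := hp ▸ hq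
  have hsub : ∀ q ∈ Submodule.span (MvPolynomial (Fin n) ℂ) (Set.range p),
      MvPolynomial.eval x q = 0 := fun q hq => (show q ∈ J from hp ▸ hq) x hx
  clear hq
  induction hq' using Submodule.span_induction with
  | mem q hq =>
    obtain ⟨i, rfl⟩ := hq
    exact h i
  | zero => simp
  | add a b ha hb h1 h2 =>
    rw [map_add, h1, h2, add_zero]
  | smul c a ha h1 =>
    rw [smul_eq_mul, polyDer_mul, h1, hsub a ha, zero_mul, mul_zero, add_zero]

lemma exists_multipliers {n m : ℕ} {T : Submodule ℂ (Fin n → ℂ)} {x : Fin n → ℂ}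
    {p : Fin m → MvPolynomial (Fin n) ℂ} (hT : ∀ v, v ∈ T ↔ ∀ i, polyDer x v (p i) = 0)
    {a : Fin n → ℂ} (ha : ∀ v ∈ T, ∑ k, a k * v k = 0) :
    ∃ μ : Fin m → ℂ, ∀ k, a k = ∑ i, μ i * MvPolynomial.eval x (MvPolynomial.pderiv k (p i)) := by
  classical
  let A : (Fin n → ℂ) →ₗ[ℂ] ℂ := ∑ k, a k • LinearMap.proj k
  have hA : ∀ v, A v = ∑ k, a k * v k := fun v => by simp [A]
  have hmem : A ∈ Submodule.span ℂ (Set.range fun i => diffAt (p i) x) := by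
    refine mem_span_of_iInf_ker_le_ker fun v hv => ?_
    simp only [Submodule.mem_iInf, LinearMap.mem_ker, diffAt_apply] at hv ⊢
    rw [hA]
    exact ha v ((hT v).2 hv)
  obtain ⟨μ, hμ⟩ := (Submodule.mem_span_range_iff_exists_fun ℂ).1 hmem
  refine ⟨μ, fun k => ?_⟩
  have h1 := hA (Pi.single k 1)
  rw [← hμ] at h1
  simp only [LinearMap.sum_apply, LinearMap.smul_apply, diffAt_apply, smul_eq_mul, polyDer_apply,
    Pi.single_apply, mul_ite, mul_one, mul_zero, Finset.sum_ite_eq', Finset.mem_univ, if_true] at h1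
  exact h1.symm

/-- The conormal coordinate functions on `X × ℂᵐ`. -/
def conormal {n m : ℕ} (p : Fin m → MvPolynomial (Fin n) ℂ) (k : Fin n) :
    MvPolynomial (Fin n ⊕ Fin m) ℂ :=
  ∑ i, MvPolynomial.X (Sum.inr i) * MvPolynomial.rename Sum.inl (MvPolynomial.pderiv k (p i))

lemma eval_conormal {n m : ℕ} (p : Fin m → MvPolynomial (Fin n) ℂ) (k : Fin n)
    (x : Fin n → ℂ) (μ : Fin m → ℂ) :
    MvPolynomial.eval (Sum.elim x μ) (conormal p k) =
      ∑ i, μ i * MvPolynomial.eval x (MvPolynomial.pderiv k (p i)) := by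
  simp [conormal, MvPolynomial.eval_rename]

lemma polyDer_conormal {n m : ℕ} (p : Fin m → MvPolynomial (Fin n) ℂ) (k : Fin n)
    (x : Fin n → ℂ) (μ : Fin m → ℂ) (v : Fin n ⊕ Fin m → ℂ) :
    polyDer (Sum.elim x μ) v (conormal p k) =
      ∑ i, (μ i * polyDer x (v ∘ Sum.inl) (MvPolynomial.pderiv k (p i)) +
        MvPolynomial.eval x (MvPolynomial.pderiv k (p i)) * v (Sum.inr i)) := by
  simp [conormal, polyDer_mul, polyDer_rename, polyDer_X, MvPolynomial.eval_rename]

/-- The generic submersivity theorem on the conormal variety. -/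
lemma exists_generic_conormal {n m : ℕ} {ι : Type} [Fintype ι] (X : Set (Fin n → ℂ))
    (φ : ι → MvPolynomial (Fin n ⊕ Fin m) ℂ) :
    ∃ q : MvPolynomial ι ℂ, q ≠ 0 ∧ ∀ x ∈ X, ∀ μ : Fin m → ℂ,
      MvPolynomial.eval (fun i => MvPolynomial.eval (Sum.elim x μ) (φ i)) q ≠ 0 →
      ∀ b : ι → ℂ, ∃ v : Fin n ⊕ Fin m → ℂ, v ∘ Sum.inl ∈ zTangent X x ∧
        ∀ i, polyDer (Sum.elim x μ) v (φ i) = b i := by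
  let S : Set (MvPolynomial (Fin n ⊕ Fin m) ℂ) :=
    {P | ∃ p : MvPolynomial (Fin n) ℂ, (∀ y ∈ X, MvPolynomial.eval y p = 0) ∧
      P = MvPolynomial.rename Sum.inl p}
  obtain ⟨q, hq0, hq⟩ := exists_generic_submersion φ (Ideal.span S)
  refine ⟨q, hq0, fun x hx μ hne b => ?_⟩
  obtain ⟨v, hv, hvb⟩ := hq (Sum.elim x μ) (fun P hP => by
    induction hP using Submodule.span_induction with
    | mem P hP =>
      obtain ⟨p, hp, rfl⟩ := hP
      rw [MvPolynomial.eval_rename]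
      exact hp x hx
    | zero => simp
    | add a b _ _ h1 h2 => simp [h1, h2]
    | smul c a _ h1 => simp [h1]) hne b
  refine ⟨v, mem_zTangent_iff.2 fun p hp => ?_, hvb⟩
  have := hv _ (Ideal.subset_span ⟨p, hp, rfl⟩)
  rw [← polyDer_apply, polyDer_rename] at this
  exact this

lemma pderiv_comm {σ : Type} (i j : σ) (L : MvPolynomial σ ℂ) :
    MvPolynomial.pderiv i (MvPolynomial.pderiv j L) =
      MvPolynomial.pderiv j (MvPolynomial.pderiv i L) := by
  classical
  have h : ⁅(MvPolynomial.pderiv i : Derivation ℂ (MvPolynomial σ ℂ) (MvPolynomial σ ℂ)),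
      (MvPolynomial.pderiv j : Derivation ℂ (MvPolynomial σ ℂ) (MvPolynomial σ ℂ))⁆ = 0 := by
    refine MvPolynomial.derivation_ext fun k => ?_
    simp only [Derivation.commutator_apply, MvPolynomial.pderiv_X, Derivation.zero_apply,
      Pi.single_apply]
    split_ifs <;> simp
  have := congrArg (fun D => D L) h
  simpa [Derivation.commutator_apply, sub_eq_zero] using this

/-- The Hessian form of a polynomial. -/
def polyHess {n : ℕ} (L : MvPolynomial (Fin n) ℂ) (x u v : Fin n → ℂ) : ℂ :=
  ∑ k, polyDer x u (MvPolynomial.pderiv k L) * v k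

lemma polyHess_comm {n : ℕ} (L : MvPolynomial (Fin n) ℂ) (x u v : Fin n → ℂ) :
    polyHess L x u v = polyHess L x v u := by
  simp only [polyHess, polyDer_apply, Finset.sum_mul]
  rw [Finset.sum_comm]
  refine Finset.sum_congr rfl fun i _ => Finset.sum_congr rfl fun j _ => ?_
  have : MvPolynomial.pderiv i (MvPolynomial.pderiv j L) =
      MvPolynomial.pderiv j (MvPolynomial.pderiv i L) := by
    exact pderiv_comm i j L
  rw [this]; ring

/-- The Lagrangian of the linear form `a` with multipliers `μ`. -/
def lagrangian {n m : ℕ} (p : Fin m → MvPolynomial (Fin n) ℂ) (a : Fin n → ℂ) (μ : Fin m → ℂ) :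
    MvPolynomial (Fin n) ℂ :=
  ∑ k, MvPolynomial.C (a k) * MvPolynomial.X k - ∑ i, MvPolynomial.C (μ i) * p i

lemma pderiv_lagrangian {n m : ℕ} (p : Fin m → MvPolynomial (Fin n) ℂ) (a : Fin n → ℂ)
    (μ : Fin m → ℂ) (k : Fin n) :
    MvPolynomial.pderiv k (lagrangian p a μ) =
      MvPolynomial.C (a k) - ∑ i, MvPolynomial.C (μ i) * MvPolynomial.pderiv k (p i) := by
  classical
  simp [lagrangian, MvPolynomial.pderiv_X, Pi.single_apply, Derivation.leibniz]

lemma polyDer_pderiv_lagrangian {n m : ℕ} (p : Fin m → MvPolynomial (Fin n) ℂ) (a : Fin n → ℂ)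
    (μ : Fin m → ℂ) (k : Fin n) (x u : Fin n → ℂ) :
    polyDer x u (MvPolynomial.pderiv k (lagrangian p a μ)) =
      - ∑ i, μ i * polyDer x u (MvPolynomial.pderiv k (p i)) := by
  simp [pderiv_lagrangian, polyDer_C, polyDer_mul]

lemma sum_polyDer_conormal {n m : ℕ} {T : Submodule ℂ (Fin n → ℂ)} {x : Fin n → ℂ}
    {p : Fin m → MvPolynomial (Fin n) ℂ} (hT : ∀ v, v ∈ T ↔ ∀ i, polyDer x v (p i) = 0)
    (a : Fin n → ℂ) (μ : Fin m → ℂ) (v : Fin n ⊕ Fin m → ℂ) {h0 : Fin n → ℂ} (h0T : h0 ∈ T) :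
    ∑ k, polyDer (Sum.elim x μ) v (conormal p k) * h0 k =
      - polyHess (lagrangian p a μ) x h0 (v ∘ Sum.inl) := by
  rw [polyHess_comm]
  have h1 : ∑ k, (∑ i, MvPolynomial.eval x (MvPolynomial.pderiv k (p i)) * v (Sum.inr i)) * h0 k
      = 0 := by
    simp only [Finset.sum_mul]
    rw [Finset.sum_comm]
    refine Finset.sum_eq_zero fun i _ => ?_
    have := (hT h0).1 h0T i
    rw [polyDer_apply] at this
    calc _ = v (Sum.inr i) * ∑ k, MvPolynomial.eval x (MvPolynomial.pderiv k (p i)) * h0 k := by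
          rw [Finset.mul_sum]
          exact Finset.sum_congr rfl fun _ _ => by ring
      _ = 0 := by rw [this, mul_zero]
  simp only [polyDer_conormal, Finset.sum_add_distrib, add_mul, h1, add_zero, polyHess,
    polyDer_pderiv_lagrangian, neg_mul, Finset.sum_neg_distrib, neg_neg]

lemma lagrangian_nondegenerate {n m : ℕ} {T : Submodule ℂ (Fin n → ℂ)} {x : Fin n → ℂ}
    {p : Fin m → MvPolynomial (Fin n) ℂ} (hT : ∀ v, v ∈ T ↔ ∀ i, polyDer x v (p i) = 0)
    (a : Fin n → ℂ) (μ : Fin m → ℂ)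
    (hs : ∀ b : Fin n → ℂ, ∃ v : Fin n ⊕ Fin m → ℂ, v ∘ Sum.inl ∈ T ∧
      ∀ k, polyDer (Sum.elim x μ) v (conormal p k) = b k)
    {h0 : Fin n → ℂ} (h0T : h0 ∈ T)
    (h0p : ∀ h ∈ T, polyHess (lagrangian p a μ) x h0 h = 0) : h0 = 0 := by
  classical
  funext k
  obtain ⟨v, hv, hvb⟩ := hs (Pi.single k 1)
  have := sum_polyDer_conormal hT a μ v h0T
  rw [h0p _ hv] at this
  simpa [hvb, Pi.single_apply] using this

/-- The leading coefficient in the first variable controls the roots near a point. -/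
lemma exists_root_bound {n : ℕ} (Q : MvPolynomial (Fin (n + 1)) ℂ) (a : Fin n → ℂ)
    (ha : MvPolynomial.eval a (MvPolynomial.finSuccEquiv ℂ n Q).leadingCoeff ≠ 0) :
    ∃ R : ℝ, ∀ᶠ b in 𝓝 a, ∀ t : ℂ, MvPolynomial.eval (Fin.cons t b) Q = 0 → ‖t‖ ≤ R := by
  set P := MvPolynomial.finSuccEquiv ℂ n Q with hP
  let N := P.natDegree
  let c : (Fin n → ℂ) → ℕ → ℂ := fun b i => MvPolynomial.eval b (P.coeff i)
  have hc : ∀ i, Continuous fun b => c b i := fun i => MvPolynomial.continuous_eval _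
  have heval : ∀ b t, MvPolynomial.eval (Fin.cons t b) Q = ∑ i ∈ Finset.range (N + 1),
      c b i * t ^ i := by
    intro b t
    rw [MvPolynomial.eval_eq_eval_mv_eval', ← hP, Polynomial.eval_map,
      Polynomial.eval₂_eq_sum_range]
  let m := ‖c a N‖ / 2
  have hm : 0 < m := half_pos (norm_pos_iff.2 ha)
  let S := (∑ i ∈ Finset.range N, ‖c a i‖) + 1
  have h1 : ∀ᶠ b in 𝓝 a, m < ‖c b N‖ :=
    ((hc N).norm.continuousAt).eventually_const_lt (half_lt_self (norm_pos_iff.2 ha))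
  have h2 : ∀ᶠ b in 𝓝 a, ∑ i ∈ Finset.range N, ‖c b i‖ < S :=
    (continuous_finsetSum _ fun i _ => (hc i).norm).continuousAt.eventually_lt_const
      (by simp [S])
  refine ⟨max 1 (S / m), ?_⟩
  filter_upwards [h1, h2] with b hb1 hb2 t ht
  by_contra! hlt
  have ht1 : 1 < ‖t‖ := (le_max_left _ _).trans_lt hlt
  have ht2 : S < ‖t‖ * m := by
    rw [← div_lt_iff₀ hm]; exact (le_max_right _ _).trans_lt hlt
  rw [heval, Finset.sum_range_succ, add_comm] at ht
  have h3 : ‖c b N‖ * ‖t‖ ^ N ≤ ∑ i ∈ Finset.range N, ‖c b i‖ * ‖t‖ ^ i := by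
    rw [← norm_pow, ← norm_mul, eq_neg_of_add_eq_zero_left ht, norm_neg]
    refine (norm_sum_le _ _).trans (le_of_eq ?_)
    simp
  have h4 : ‖t‖ * ∑ i ∈ Finset.range N, ‖c b i‖ * ‖t‖ ^ i ≤
      (∑ i ∈ Finset.range N, ‖c b i‖) * ‖t‖ ^ N := by
    rw [Finset.mul_sum, Finset.sum_mul]
    refine Finset.sum_le_sum fun i hi => ?_
    have : ‖t‖ ^ (i + 1) ≤ ‖t‖ ^ N := pow_le_pow_right₀ ht1.le (Finset.mem_range.1 hi)
    calc ‖t‖ * (‖c b i‖ * ‖t‖ ^ i) = ‖c b i‖ * ‖t‖ ^ (i + 1) := by ring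
      _ ≤ _ := by gcongr
  have htp : 0 < ‖t‖ ^ N := pow_pos (by linarith) _
  have h5 : ‖t‖ * (m * ‖t‖ ^ N) ≤ S * ‖t‖ ^ N := by
    calc ‖t‖ * (m * ‖t‖ ^ N) ≤ ‖t‖ * (‖c b N‖ * ‖t‖ ^ N) := by gcongr
      _ ≤ ‖t‖ * ∑ i ∈ Finset.range N, ‖c b i‖ * ‖t‖ ^ i := by gcongr
      _ ≤ _ := h4
      _ ≤ _ := by gcongr
  nlinarith

lemma exists_tangent_of_norm_sub_ge {n : ℕ} (T : Submodule ℂ (Fin n → ℂ)) (a : Fin n → ℂ)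
    {ε : ℝ} (hε : 0 < ε)
    (h : ∀ b : Fin n → ℂ, (∀ v ∈ T, ∑ k, b k * v k = 0) → ε ≤ ‖b - a‖) :
    ∃ u ∈ T, ∑ k, a k * u k = 1 ∧ ‖u‖ ≤ 2 / ε := by
  classical
  let A : (Fin n → ℂ) →L[ℂ] ℂ := ∑ k, a k • ContinuousLinearMap.proj k
  have hA : ∀ v, A v = ∑ k, a k * v k := fun v => by
    simp [A, sum_apply]
  by_cases hu : ∃ u : T, ε / 2 * ‖u‖ < ‖A u‖
  · obtain ⟨u, hu⟩ := hu
    have hpos : 0 < ‖A u‖ := lt_of_le_of_lt (by positivity) hu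
    have hne : A u ≠ 0 := norm_pos_iff.1 hpos
    refine ⟨(A u)⁻¹ • (u : Fin n → ℂ), T.smul_mem _ u.2, ?_, ?_⟩
    · rw [← hA, map_smul, smul_eq_mul, inv_mul_cancel₀ hne]
    · rw [norm_smul, norm_inv, inv_mul_le_iff₀ hpos]
      have : ‖(u : Fin n → ℂ)‖ = ‖u‖ := rfl
      rw [this, mul_div_assoc', le_div_iff₀ hε]
      linarith
  · push Not at hu
    exfalso
    let g : T →L[ℂ] ℂ := A.comp T.subtypeL
    have hg : ‖g‖ ≤ ε / 2 := ContinuousLinearMap.opNorm_le_bound _ (by positivity) fun u => hu u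
    obtain ⟨B, hB, hBn⟩ := exists_extension_norm_eq T g
    let b : Fin n → ℂ := fun k => a k - B (Pi.single k 1)
    have hBv : ∀ v, B v = ∑ k, B (Pi.single k 1) * v k := by
      intro v
      conv_lhs => rw [pi_eq_sum_univ' v]
      simp [map_sum, mul_comm]
    have h1 := h b fun v hv => by
      have := hB ⟨v, hv⟩
      simp only [b, sub_mul, Finset.sum_sub_distrib, ← hBv, ← hA]
      rw [this]
      exact sub_self _
    have h2 : ‖b - a‖ ≤ ε / 2 := by
      refine (pi_norm_le_iff_of_nonneg (by positivity)).2 fun k => ?_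
      have : (b - a) k = - B (Pi.single k 1) := by simp [b]
      rw [this, norm_neg]
      refine (B.le_opNorm _).trans ?_
      rw [hBn]
      have : ‖(Pi.single k 1 : Fin n → ℂ)‖ ≤ 1 := by
        refine (pi_norm_le_iff_of_nonneg zero_le_one).2 fun j => ?_
        by_cases hj : j = k <;> simp [Pi.single_apply, hj]
      nlinarith [norm_nonneg g]
    linarith

/-- A linear functional with nondegenerate critical points on `X` and no critical points at
infinity, together with a noncritical value. -/
structure GoodPencil {n : ℕ} (X : Set (Fin n → ℂ)) (a : Fin n → ℂ) (c : ℂ) : Prop where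
  noncritical : ∀ x ∈ X, (∀ v ∈ zTangent X x, ∑ k, a k * v k = 0) → ∑ k, a k * x k ≠ c
  nondegenerate : ∀ x ∈ X, (∀ v ∈ zTangent X x, ∑ k, a k * v k = 0) →
    ∃ L : MvPolynomial (Fin n) ℂ, (∀ y ∈ X, MvPolynomial.eval y L = ∑ k, a k * y k) ∧
      (∀ k, MvPolynomial.eval x (MvPolynomial.pderiv k L) = 0) ∧
      ∀ u ∈ zTangent X x, (∀ v ∈ zTangent X x, polyHess L x u v = 0) → u = 0
  atInfinity : ∃ R C : ℝ, ∀ x ∈ X, R ≤ ‖x‖ →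
    ∃ u ∈ zTangent X x, ∑ k, a k * u k = 1 ∧ ‖u‖ ≤ C

lemma exists_noncritical_poly {n : ℕ} (X : Set (Fin n → ℂ)) :
    ∃ q : MvPolynomial (Fin (n + 1)) ℂ, q ≠ 0 ∧ ∀ (a : Fin n → ℂ) (c : ℂ),
      MvPolynomial.eval (Fin.snoc a c : Fin (n + 1) → ℂ) q ≠ 0 →
      ∀ x ∈ X, (∀ v ∈ zTangent X x, ∑ k, a k * v k = 0) → ∑ k, a k * x k ≠ c := by
  classical
  obtain ⟨m, p, hp, hT⟩ := exists_generators X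
  obtain ⟨q, hq0, hq⟩ := exists_generic_conormal (ι := Fin (n + 1)) X
    (Fin.snoc (conormal p) (∑ k, conormal p k * MvPolynomial.X (Sum.inl k)))
  refine ⟨q, hq0, fun a c hne x hx ha hc => ?_⟩
  obtain ⟨μ, hμ⟩ := exists_multipliers (hT x hx) ha
  have hval : (fun i => MvPolynomial.eval (Sum.elim x μ)
      ((Fin.snoc (conormal p) (∑ k, conormal p k * MvPolynomial.X (Sum.inl k)) :
        Fin (n + 1) → MvPolynomial (Fin n ⊕ Fin m) ℂ) i)) = (Fin.snoc a c : Fin (n + 1) → ℂ) := by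
    funext i
    refine Fin.lastCases ?_ (fun k => ?_) i
    · simp [eval_conormal, ← hμ, hc]
    · simp [eval_conormal, ← hμ]
  obtain ⟨v, hv, hvb⟩ := hq x hx μ (by rw [hval]; exact hne) (Fin.snoc 0 1)
  have h1 : ∀ k, polyDer (Sum.elim x μ) v (conormal p k) = 0 := fun k => by
    simpa using hvb k.castSucc
  have h2 := hvb (Fin.last n)
  simp only [Fin.snoc_last, map_sum, polyDer_mul, h1, mul_zero, add_zero, eval_conormal, ← hμ,
    polyDer_X] at h2
  exact zero_ne_one ((ha _ hv).symm.trans h2)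

lemma exists_nondegenerate_poly {n : ℕ} (X : Set (Fin n → ℂ)) :
    ∃ q : MvPolynomial (Fin n) ℂ, q ≠ 0 ∧ ∀ (a : Fin n → ℂ), MvPolynomial.eval a q ≠ 0 →
      ∀ x ∈ X, (∀ v ∈ zTangent X x, ∑ k, a k * v k = 0) →
    ∃ L : MvPolynomial (Fin n) ℂ, (∀ y ∈ X, MvPolynomial.eval y L = ∑ k, a k * y k) ∧
      (∀ k, MvPolynomial.eval x (MvPolynomial.pderiv k L) = 0) ∧
      ∀ u ∈ zTangent X x, (∀ v ∈ zTangent X x, polyHess L x u v = 0) → u = 0 := by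
  obtain ⟨m, p, hp, hT⟩ := exists_generators X
  obtain ⟨q, hq0, hq⟩ := exists_generic_conormal X (conormal p)
  refine ⟨q, hq0, fun a hne x hx ha => ?_⟩
  obtain ⟨μ, hμ⟩ := exists_multipliers (hT x hx) ha
  refine ⟨lagrangian p a μ, fun y hy => ?_, fun k => ?_, fun u hu hu' => ?_⟩
  · simp [lagrangian, fun i => hp i y hy]
  · simp [pderiv_lagrangian, hμ k]
  · refine lagrangian_nondegenerate (hT x hx) a μ (hq x hx μ ?_) hu hu'
    simpa only [eval_conormal, ← hμ] using hne

lemma exists_proper_poly {n : ℕ} (X : Set (Fin n → ℂ)) (j : Fin n) :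
    ∃ q : MvPolynomial (Fin n) ℂ, q ≠ 0 ∧ ∀ (a : Fin n → ℂ), MvPolynomial.eval a q ≠ 0 →
      ∃ R : ℝ, ∀ᶠ b in 𝓝 a, ∀ x ∈ X, (∀ v ∈ zTangent X x, ∑ k, b k * v k = 0) → ‖x j‖ ≤ R := by
  classical
  obtain ⟨m, p, hp, hT⟩ := exists_generators X
  obtain ⟨Q, hQ0, hQ⟩ := exists_generic_conormal (ι := Fin (n + 1)) X
    (Fin.cons (MvPolynomial.X (Sum.inl j)) (conormal p))
  refine ⟨(MvPolynomial.finSuccEquiv ℂ n Q).leadingCoeff, ?_, fun a ha => ?_⟩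
  · simpa using hQ0
  obtain ⟨R, hR⟩ := exists_root_bound Q a ha
  refine ⟨R, hR.mono fun b hb x hx hxb => hb (x j) ?_⟩
  obtain ⟨μ, hμ⟩ := exists_multipliers (hT x hx) hxb
  by_contra hne
  have hval : (fun i => MvPolynomial.eval (Sum.elim x μ)
      ((Fin.cons (MvPolynomial.X (Sum.inl j)) (conormal p) :
        Fin (n + 1) → MvPolynomial (Fin n ⊕ Fin m) ℂ) i)) = (Fin.cons (x j) b) := by
    funext i
    refine Fin.cases ?_ (fun k => ?_) i
    · simp
    · simp [eval_conormal, ← hμ]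
  have hs := hQ x hx μ (by rw [hval]; exact hne)
  obtain ⟨v, hv, hvb⟩ := hs (Fin.cons 1 0)
  have h0 : v ∘ Sum.inl = 0 := by
    refine lagrangian_nondegenerate (hT x hx) b μ (fun b' => ?_) hv fun h hh => ?_
    · obtain ⟨w, hw, hwb⟩ := hs (Fin.cons 0 b')
      exact ⟨w, hw, fun k => by simpa using hwb k.succ⟩
    · have := sum_polyDer_conormal (hT x hx) b μ v hh
      have h1 : ∀ k, polyDer (Sum.elim x μ) v (conormal p k) = 0 := fun k => by
        simpa using hvb k.succ
      simp only [h1, zero_mul, Finset.sum_const_zero] at this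
      rw [polyHess_comm]
      exact neg_eq_zero.1 this.symm
  have h2 := hvb 0
  rw [Fin.cons_zero, Fin.cons_zero, polyDer_X] at h2
  have h3 := congrFun h0 j
  simp only [Function.comp_apply, Pi.zero_apply] at h3
  exact zero_ne_one (h3.symm.trans h2)

theorem exists_goodPencil_poly {n : ℕ} (X : Set (Fin n → ℂ)) :
    ∃ q : MvPolynomial (Fin (n + 1)) ℂ, q ≠ 0 ∧ ∀ w : Fin (n + 1) → ℂ,
      MvPolynomial.eval w q ≠ 0 → GoodPencil X (fun k => w k.castSucc) (w (Fin.last n)) := by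
  classical
  obtain ⟨q1, hq1, h1⟩ := exists_noncritical_poly X
  obtain ⟨q2, hq2, h2⟩ := exists_nondegenerate_poly X
  choose q3 hq3 h3 using exists_proper_poly X
  refine ⟨q1 * MvPolynomial.rename Fin.castSucc (q2 * ∏ j, q3 j), mul_ne_zero hq1 ?_,
    fun w hw => ?_⟩
  · rw [Ne, map_eq_zero_iff _ (MvPolynomial.rename_injective _ (Fin.castSucc_injective n))]
    exact mul_ne_zero hq2 (Finset.prod_ne_zero_iff.2 fun j _ => hq3 j)
  rw [map_mul, MvPolynomial.eval_rename, map_mul, map_prod] at hw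
  have hw1 := left_ne_zero_of_mul hw
  have hw2 := left_ne_zero_of_mul (right_ne_zero_of_mul hw)
  have hw3 := Finset.prod_ne_zero_iff.1 (right_ne_zero_of_mul (right_ne_zero_of_mul hw))
  refine ⟨h1 _ _ ?_, h2 _ hw2, ?_⟩
  · have : (Fin.snoc (fun k : Fin n => w k.castSucc) (w (Fin.last n)) : Fin (n + 1) → ℂ) = w :=
      Fin.snoc_init_self w
    rwa [this]
  choose R hR using fun j => h3 j _ (hw3 j (Finset.mem_univ j))
  obtain ⟨ε, hε, hball⟩ := Metric.eventually_nhds_iff.1 (eventually_all.2 hR)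
  refine ⟨(∑ j, |R j|) + 1, 2 / ε, fun x hx hxR => ?_⟩
  refine exists_tangent_of_norm_sub_ge _ _ hε fun b hb => ?_
  by_contra! hlt
  have h4 := hball (by rwa [dist_eq_norm] : dist b _ < ε)
  have h5 : ‖x‖ ≤ ∑ j, |R j| := (pi_norm_le_iff_of_nonneg (by positivity)).2 fun j =>
    (h4 j x hx hb).trans ((le_abs_self _).trans
      (Finset.single_le_sum (f := fun j => |R j|) (fun _ _ => abs_nonneg _) (Finset.mem_univ j)))
  linarith

lemma hasStrictFDerivAt_of_differentiableOn {E F : Type} [NormedAddCommGroup E] [NormedSpace ℂ E]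
    [NormedAddCommGroup F] [NormedSpace ℂ F] {f : E → F} {U : Set E} {x : E} (hU : U ∈ 𝓝 x)
    (hf : DifferentiableOn ℂ f U) : HasStrictFDerivAt f (fderiv ℂ f x) x := by
  rw [hasStrictFDerivAt_iff_isLittleO, Asymptotics.isLittleO_iff]
  intro c hc
  have hfx : HasFDerivAt f (fderiv ℂ f x) x := (hf.differentiableAt hU).hasFDerivAt
  have h1 := (Asymptotics.isLittleO_iff.1 (hasFDerivAt_iff_isLittleO.1 hfx)) (c := c / 4)
    (by positivity)
  obtain ⟨R, hR, hball⟩ := Metric.mem_nhds_iff.1 (Filter.inter_mem hU h1)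
  have hR4 : Metric.ball x (R / 4) ∈ 𝓝 x := Metric.ball_mem_nhds _ (by positivity)
  rw [nhds_prod_eq]
  filter_upwards [prod_mem_prod hR4 hR4] with ⟨y, z⟩ ⟨hy, hz⟩
  simp only at hy hz ⊢
  let g : E → F := fun w => f w - fderiv ℂ f x w
  have hsub : Metric.ball z (R / 2) ⊆ Metric.ball x R := by
    refine Metric.ball_subset_ball' ?_
    have := Metric.mem_ball.1 hz
    linarith
  have hg : ∀ w ∈ Metric.ball x R, ‖g w - g x‖ ≤ c / 4 * R := by
    intro w hw
    have h2 : ‖f w - f x - fderiv ℂ f x (w - x)‖ ≤ c / 4 * ‖w - x‖ := (hball hw).2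
    have h3 : g w - g x = f w - f x - fderiv ℂ f x (w - x) := by
      simp only [g, map_sub]; abel
    rw [h3]
    refine h2.trans ?_
    have := (mem_ball_iff_norm.1 hw).le
    gcongr
  have hd : DifferentiableOn ℂ g (Metric.ball z (R / 2)) := by
    refine DifferentiableOn.sub (hf.mono fun w hw => (hball (hsub hw)).1) ?_
    exact (fderiv ℂ f x).differentiable.differentiableOn
  have hm : Set.MapsTo g (Metric.ball z (R / 2)) (Metric.closedBall (g z) (c / 2 * R)) := by
    intro w hw
    have h2 := hg w (hsub hw)
    have h3 := hg z (hsub (Metric.mem_ball_self (by positivity)))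
    rw [mem_closedBall_iff_norm]
    calc ‖g w - g z‖ = ‖(g w - g x) - (g z - g x)‖ := by congr 1; abel
      _ ≤ ‖g w - g x‖ + ‖g z - g x‖ := norm_sub_le _ _
      _ ≤ _ := by linarith
  have hyz : y ∈ Metric.ball z (R / 2) := by
    rw [Metric.mem_ball] at *
    have := dist_triangle_right y z x
    linarith
  have h4 := Complex.dist_le_div_mul_dist_of_mapsTo_ball hd hm hyz
  rw [dist_eq_norm, dist_eq_norm] at h4
  have h5 : g y - g z = f y - f z - fderiv ℂ f x (y - z) := by
    simp only [g, map_sub]; abel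
  have h6 : c / 2 * R / (R / 2) = c := by field_simp
  rwa [h5, h6] at h4

/-- A closed set which is locally a complete intersection of `r` polynomials with independent
differentials. -/
structure IsLCI {n : ℕ} (X : Set (Fin n → ℂ)) (r : ℕ) : Prop where
  isClosed : IsClosed X
  exists_equations : ∀ x ∈ X, ∃ P : Fin r → MvPolynomial (Fin n) ℂ,
    (∀ i, ∀ y ∈ X, MvPolynomial.eval y (P i) = 0) ∧
    (∀ b : Fin r → ℂ, ∃ v, ∀ i, polyDer x v (P i) = b i) ∧
    ∀ᶠ y in 𝓝 x, (∀ i, MvPolynomial.eval y (P i) = 0) → y ∈ X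

lemma IsAlgSet.isClosed {n : ℕ} {X : Set (Fin n → ℂ)} (hX : IsAlgSet X) : IsClosed X := by
  obtain ⟨S, rfl⟩ := hX
  simp only [Set.ofPred_forall]
  exact isClosed_iInter fun p => isClosed_iInter fun _ =>
    isClosed_eq (MvPolynomial.continuous_eval p) continuous_const

/-- The differential of a polynomial. -/
def polyDiff {n : ℕ} (p : MvPolynomial (Fin n) ℂ) (x : Fin n → ℂ) : (Fin n → ℂ) →L[ℂ] ℂ :=
  ∑ i, MvPolynomial.eval x (MvPolynomial.pderiv i p) • ContinuousLinearMap.proj i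

lemma polyDiff_apply {n : ℕ} (p : MvPolynomial (Fin n) ℂ) (x v : Fin n → ℂ) :
    polyDiff p x v = polyDer x v p := by
  simp [polyDiff, polyDer_apply, sum_apply]

lemma contDiff_eval {n : ℕ} (p : MvPolynomial (Fin n) ℂ) {k : WithTop ℕ∞} :
    ContDiff ℂ k (fun x : Fin n → ℂ => MvPolynomial.eval x p) := by
  induction p using MvPolynomial.induction_on with
  | C a => simpa using contDiff_const
  | add p q hp hq => simpa using hp.add hq
  | mul_X p i hp => simpa using hp.mul (contDiff_apply ℂ ℂ i)

lemma hasFDerivAt_eval {n : ℕ} (p : MvPolynomial (Fin n) ℂ) (x : Fin n → ℂ) :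
    HasFDerivAt (fun x : Fin n → ℂ => MvPolynomial.eval x p) (polyDiff p x) x := by
  have key : ∀ v, fderiv ℂ (fun x : Fin n → ℂ => MvPolynomial.eval x p) x v = polyDer x v p := by
    intro v
    have hd : ∀ q : MvPolynomial (Fin n) ℂ, DifferentiableAt ℂ
        (fun x : Fin n → ℂ => MvPolynomial.eval x q) x := fun q =>
      (contDiff_eval q (k := 1)).differentiable one_ne_zero x
    induction p using MvPolynomial.induction_on with
    | C a => simp [polyDer_C]
    | add p q hp hq =>
      simp only [map_add]
      rw [fderiv_fun_add (hd p) (hd q), add_apply, hp, hq]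
    | mul_X p i hp =>
      have h1 : (fun x : Fin n → ℂ => MvPolynomial.eval x (p * MvPolynomial.X i)) =
          fun x => MvPolynomial.eval x p * x i := by
        funext x; simp
      have h2 : HasFDerivAt (fun x : Fin n → ℂ => x i)
        (ContinuousLinearMap.proj (R := ℂ) i) x := hasFDerivAt_apply i x
      rw [h1, ((hd p).hasFDerivAt.fun_mul h2).fderiv, polyDer_mul, polyDer_X]
      simp [hp]
  have := ((contDiff_eval p (k := 1)).differentiable one_ne_zero x).hasFDerivAt
  have h2 : fderiv ℂ (fun x : Fin n → ℂ => MvPolynomial.eval x p) x = polyDiff p x :=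
    ContinuousLinearMap.ext fun v => by rw [polyDiff_apply, key]
  rwa [h2] at this

lemma exists_polyChart {n r d : ℕ} (hrd : r + d = n) (P : Fin r → MvPolynomial (Fin n) ℂ)
    (π : (Fin n → ℂ) →L[ℂ] (Fin d → ℂ)) (x0 : Fin n → ℂ)
    (hinj : ∀ v, (∀ i, polyDer x0 v (P i) = 0) → π v = 0 → v = 0) (V : Set (Fin n → ℂ))
    (hV : V ∈ 𝓝 x0) :
    ∃ e : OpenPartialHomeomorph (Fin n → ℂ) ((Fin r → ℂ) × (Fin d → ℂ)),
      (∀ y, e y = (fun i => MvPolynomial.eval y (P i), π (y - x0))) ∧ x0 ∈ e.source ∧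
      e.source ⊆ V ∧ ContDiffOn ℂ ⊤ e.symm e.target := by
  let f : (Fin n → ℂ) → (Fin r → ℂ) × (Fin d → ℂ) :=
    fun y => (fun i => MvPolynomial.eval y (P i), π (y - x0))
  have hf : ContDiff ℂ ⊤ f := by
    refine ContDiff.prodMk (contDiff_pi.2 fun i => contDiff_eval (P i)) ?_
    exact π.contDiff.comp (contDiff_id.sub contDiff_const)
  let f' : (Fin n → ℂ) →L[ℂ] (Fin r → ℂ) × (Fin d → ℂ) :=
    (ContinuousLinearMap.pi fun i => polyDiff (P i) x0).prod π
  have hf' : HasFDerivAt f f' x0 := by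
    refine HasFDerivAt.prodMk (hasFDerivAt_pi.2 fun i => hasFDerivAt_eval (P i) x0) ?_
    have := π.hasFDerivAt.comp x0 ((hasFDerivAt_id x0).sub_const x0)
    simpa using this
  have hf'inj : Function.Injective f' := by
    rw [injective_iff_map_eq_zero]
    intro v hv
    rw [Prod.ext_iff] at hv
    refine hinj v (fun i => ?_) hv.2
    rw [← polyDiff_apply]
    exact congrFun hv.1 i
  have hfin : Module.finrank ℂ (Fin n → ℂ) = Module.finrank ℂ ((Fin r → ℂ) × (Fin d → ℂ)) := by
    simp [hrd]
  let A : (Fin n → ℂ) ≃L[ℂ] (Fin r → ℂ) × (Fin d → ℂ) :=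
    (LinearEquiv.ofInjectiveOfFinrankEq (f' : (Fin n → ℂ) →ₗ[ℂ] _) hf'inj
      hfin).toContinuousLinearEquiv
  have hA : (A : (Fin n → ℂ) →L[ℂ] _) = f' := by ext1 v; rfl
  have hstrict : HasStrictFDerivAt f (A : (Fin n → ℂ) →L[ℂ] _) x0 := by
    rw [hA]
    exact hf.contDiffAt.hasStrictFDerivAt' hf' (by simp)
  let e0 := hstrict.toOpenPartialHomeomorph
  have he0 : (e0 : (Fin n → ℂ) → _) = f := hstrict.toOpenPartialHomeomorph_coe
  have hx0 : x0 ∈ e0.source := hstrict.mem_toOpenPartialHomeomorph_source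
  have hsymm : ContDiffAt ℂ ⊤ e0.symm (e0 x0) := by
    refine e0.contDiffAt_symm (f₀' := A) (e0.map_source hx0) ?_ ?_
    · rw [e0.left_inv hx0, hA, he0]; exact hf'
    · rw [he0]; exact hf.contDiffAt
  obtain ⟨W, hW, hWo, hxW⟩ := eventually_nhds_iff.1 (hsymm.eventually (by simp))
  obtain ⟨V', hV', hV'o, hxV⟩ := mem_nhds_iff.1 hV
  refine ⟨e0.restrOpen (V' ∩ (e0.source ∩ e0 ⁻¹' W)) (hV'o.inter (e0.isOpen_inter_preimage hWo)),
    fun y => ?_, ⟨hx0, hxV, hx0, hxW⟩, fun y hy => hV' hy.2.1, ?_⟩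
  · exact congrFun he0 y
  · intro z hz
    have h1 : (e0.restrOpen (V' ∩ (e0.source ∩ e0 ⁻¹' W))
      (hV'o.inter (e0.isOpen_inter_preimage hWo))).symm z ∈ _ := OpenPartialHomeomorph.map_target _ hz
    have hz0 : z ∈ e0.target := hz.1
    have h2 : e0 (e0.symm z) ∈ W := h1.2.2.2
    rw [e0.right_inv hz0] at h2
    exact (hW z h2).contDiffWithinAt

/-- An adapted holomorphic chart of the ambient space. -/
structure LCIChart {n : ℕ} (X : Set (Fin n → ℂ)) (r d : ℕ) (x0 : Fin n → ℂ) where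
  e : OpenPartialHomeomorph (Fin n → ℂ) ((Fin r → ℂ) × (Fin d → ℂ))
  mem_source : x0 ∈ e.source
  map_center : e x0 = 0
  contDiff : ContDiff ℂ ⊤ e
  contDiffOn_symm : ContDiffOn ℂ ⊤ e.symm e.target
  mem_iff : ∀ y ∈ e.source, (y ∈ X ↔ (e y).1 = 0)
  fst_eq_zero : ∀ y ∈ e.source, y ∈ X → ∀ v ∈ zTangent X y, (fderiv ℂ e y v).1 = 0

lemma LCIChart.hasFDerivAt {n r d : ℕ} {X : Set (Fin n → ℂ)} {x0 : Fin n → ℂ}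
    (C : LCIChart X r d x0) (y : Fin n → ℂ) : HasFDerivAt C.e (fderiv ℂ C.e y) y :=
  (C.contDiff.differentiable (by simp) y).hasFDerivAt

lemma LCIChart.hasFDerivAt_symm {n r d : ℕ} {X : Set (Fin n → ℂ)} {x0 : Fin n → ℂ}
    (C : LCIChart X r d x0) {z : (Fin r → ℂ) × (Fin d → ℂ)} (hz : z ∈ C.e.target) :
    HasFDerivAt C.e.symm (fderiv ℂ C.e.symm z) z :=
  ((C.contDiffOn_symm.contDiffAt (C.e.open_target.mem_nhds hz)).differentiableAt
    (by simp)).hasFDerivAt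

lemma LCIChart.fderiv_fderiv_symm {n r d : ℕ} {X : Set (Fin n → ℂ)} {x0 : Fin n → ℂ}
    (C : LCIChart X r d x0) {z : (Fin r → ℂ) × (Fin d → ℂ)} (hz : z ∈ C.e.target) (w) :
    fderiv ℂ C.e (C.e.symm z) (fderiv ℂ C.e.symm z w) = w := by
  have h1 := (C.hasFDerivAt (C.e.symm z)).comp z (C.hasFDerivAt_symm hz)
  have h2 : HasFDerivAt (C.e ∘ C.e.symm) (ContinuousLinearMap.id ℂ _) z :=
    (hasFDerivAt_id z).congr_of_eventuallyEq (by
      filter_upwards [C.e.open_target.mem_nhds hz] with y hy using C.e.right_inv hy)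
  exact congrArg (fun L => L w) (h1.unique h2)

lemma LCIChart.fderiv_symm_fderiv {n r d : ℕ} {X : Set (Fin n → ℂ)} {x0 : Fin n → ℂ}
    (C : LCIChart X r d x0) {y : Fin n → ℂ} (hy : y ∈ C.e.source) (v) :
    fderiv ℂ C.e.symm (C.e y) (fderiv ℂ C.e y v) = v := by
  have h1 := (C.hasFDerivAt_symm (C.e.map_source hy)).comp y (C.hasFDerivAt y)
  have h2 : HasFDerivAt (C.e.symm ∘ C.e) (ContinuousLinearMap.id ℂ _) y :=
    (hasFDerivAt_id y).congr_of_eventuallyEq (by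
      filter_upwards [C.e.open_source.mem_nhds hy] with y hy using C.e.left_inv hy)
  exact congrArg (fun L => L v) (h1.unique h2)

/-- The Zariski tangent space in a chart. -/
lemma LCIChart.mem_zTangent_of_fst_eq_zero {n r d : ℕ} {X : Set (Fin n → ℂ)} {x0 : Fin n → ℂ}
    (C : LCIChart X r d x0) {y : Fin n → ℂ} (hy : y ∈ C.e.source) (hyX : y ∈ X) {v : Fin n → ℂ}
    (hv : (fderiv ℂ C.e y v).1 = 0) : v ∈ zTangent X y := by
  rw [mem_zTangent_iff]
  intro p hp
  let t := (fderiv ℂ C.e y v).2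
  have ht : fderiv ℂ C.e y v = (0, t) := Prod.ext hv rfl
  let γ : ℂ → (Fin r → ℂ) × (Fin d → ℂ) := fun s => C.e y + s • ((0 : Fin r → ℂ), t)
  have hγ : HasDerivAt γ ((0 : Fin r → ℂ), t) 0 := by
    have := ((hasDerivAt_id (0 : ℂ)).smul_const ((0 : Fin r → ℂ), t)).const_add (C.e y)
    simp only [one_smul, id] at this
    exact this
  have hγ0 : γ 0 = C.e y := by simp [γ]
  have h1 : HasDerivAt (C.e.symm ∘ γ) v 0 := by
    have h := C.hasFDerivAt_symm (C.e.map_source hy)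
    rw [← hγ0] at h
    have h2 := h.comp_hasDerivAt 0 hγ
    rw [hγ0, ← ht, C.fderiv_symm_fderiv hy] at h2
    exact h2
  have h3 : HasDerivAt (fun s => MvPolynomial.eval ((C.e.symm ∘ γ) s) p) (polyDer y v p) 0 := by
    have h := hasFDerivAt_eval p ((C.e.symm ∘ γ) 0)
    have h4 := h.comp_hasDerivAt 0 h1
    rw [polyDiff_apply] at h4
    have : (C.e.symm ∘ γ) 0 = y := by
      rw [Function.comp_apply, hγ0, C.e.left_inv hy]
    rw [this] at h4
    exact h4
  have hmem : ∀ᶠ s in 𝓝 (0 : ℂ), γ s ∈ C.e.target := by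
    refine hγ.continuousAt.eventually_mem ?_
    rw [hγ0]
    exact C.e.open_target.mem_nhds (C.e.map_source hy)
  have h5 : (fun s => MvPolynomial.eval ((C.e.symm ∘ γ) s) p) =ᶠ[𝓝 0] fun _ => 0 := by
    filter_upwards [hmem] with s hs
    refine hp _ ((C.mem_iff _ (C.e.map_target hs)).2 ?_)
    rw [C.e.right_inv hs]
    simp [γ, (C.mem_iff y hy).1 hyX]
  exact h3.unique ((hasDerivAt_const (0 : ℂ) (0 : ℂ)).congr_of_eventuallyEq h5)

lemma exists_chart_of_equations {n r d : ℕ} (hrd : r + d = n) {X : Set (Fin n → ℂ)}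
    {x0 : Fin n → ℂ} (hx0 : x0 ∈ X) (P : Fin r → MvPolynomial (Fin n) ℂ)
    (hP : ∀ i, ∀ y ∈ X, MvPolynomial.eval y (P i) = 0)
    (hloc : ∀ᶠ y in 𝓝 x0, (∀ i, MvPolynomial.eval y (P i) = 0) → y ∈ X)
    (π : (Fin n → ℂ) →L[ℂ] (Fin d → ℂ))
    (hinj : ∀ v, (∀ i, polyDer x0 v (P i) = 0) → π v = 0 → v = 0) :
    ∃ C : LCIChart X r d x0,
      ∀ y, C.e y = (fun i => MvPolynomial.eval y (P i), π (y - x0)) := by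
  obtain ⟨e, he, hxe, hsub, hsymm⟩ := exists_polyChart hrd P π x0 hinj _ hloc
  have hfun : (e : (Fin n → ℂ) → _) = fun y => (fun i => MvPolynomial.eval y (P i), π (y - x0)) :=
    funext he
  refine ⟨⟨e, hxe, ?_, ?_, hsymm, fun y hy => ?_, fun y hy hyX v hv => ?_⟩, he⟩
  · rw [he]; ext i <;> simp [hP _ x0 hx0]
  · rw [hfun]
    refine ContDiff.prodMk (contDiff_pi.2 fun i => contDiff_eval (P i)) ?_
    exact π.contDiff.comp (contDiff_id.sub contDiff_const)
  · rw [he]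
    exact ⟨fun h => funext fun i => hP i y h, fun h => hsub hy fun i => congrFun h i⟩
  · have h1 : HasFDerivAt e ((ContinuousLinearMap.pi fun i => polyDiff (P i) y).prod π) y := by
      rw [hfun]
      refine HasFDerivAt.prodMk (hasFDerivAt_pi.2 fun i => hasFDerivAt_eval (P i) y) ?_
      have := π.hasFDerivAt.comp y ((hasFDerivAt_id y).sub_const x0)
      simpa using this
    rw [h1.fderiv]
    funext i
    exact (polyDiff_apply _ _ _).trans ((mem_zTangent_iff.1 hv) _ (hP i))

lemma exists_continuous_extend {n d : ℕ} {T : Submodule ℂ (Fin n → ℂ)}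
    (f : T →ₗ[ℂ] (Fin d → ℂ)) :
    ∃ π : (Fin n → ℂ) →L[ℂ] (Fin d → ℂ), ∀ v : T, π v = f v := by
  obtain ⟨g, hg⟩ := f.exists_extend
  exact ⟨LinearMap.toContinuousLinearMap g, fun v => congrArg (fun L => L v) hg⟩

lemma exists_proj_injOn {n d : ℕ} {T : Submodule ℂ (Fin n → ℂ)} (hT : Module.finrank ℂ T = d) :
    ∃ π : (Fin n → ℂ) →L[ℂ] (Fin d → ℂ), ∀ v ∈ T, π v = 0 → v = 0 := by
  let b := Module.finBasisOfFinrankEq ℂ T hT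
  obtain ⟨π, hπ⟩ := exists_continuous_extend (b.equivFun : T →ₗ[ℂ] (Fin d → ℂ))
  refine ⟨π, fun v hv h => ?_⟩
  rw [hπ ⟨v, hv⟩] at h
  exact congrArg Subtype.val (b.equivFun.map_eq_zero_iff.1 h)

lemma IsLCI.zTangent_eq {n r d : ℕ} (hrd : r + d = n) {X : Set (Fin n → ℂ)}
    {x0 : Fin n → ℂ} (hx0 : x0 ∈ X) (P : Fin r → MvPolynomial (Fin n) ℂ)
    (hP : ∀ i, ∀ y ∈ X, MvPolynomial.eval y (P i) = 0)
    (hsurj : ∀ b : Fin r → ℂ, ∃ v, ∀ i, polyDer x0 v (P i) = b i)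
    (hloc : ∀ᶠ y in 𝓝 x0, (∀ i, MvPolynomial.eval y (P i) = 0) → y ∈ X) :
    (∀ v, v ∈ zTangent X x0 ↔ ∀ i, polyDer x0 v (P i) = 0) ∧
      Module.finrank ℂ (zTangent X x0) = d := by
  let D : (Fin n → ℂ) →ₗ[ℂ] (Fin r → ℂ) :=
    LinearMap.pi fun i => (polyDiff (P i) x0 : (Fin n → ℂ) →ₗ[ℂ] ℂ)
  have hD : ∀ v, v ∈ LinearMap.ker D ↔ ∀ i, polyDer x0 v (P i) = 0 := by
    intro v
    rw [LinearMap.mem_ker, funext_iff]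
    refine forall_congr' fun i => ?_
    rw [← polyDiff_apply]
    rfl
  have hDs : LinearMap.range D = ⊤ := by
    rw [LinearMap.range_eq_top]
    intro b
    obtain ⟨v, hv⟩ := hsurj b
    exact ⟨v, funext fun i => (polyDiff_apply _ _ _).trans (hv i)⟩
  have hfr : Module.finrank ℂ (LinearMap.ker D) = d := by
    have := D.finrank_range_add_finrank_ker
    rw [hDs] at this
    simp at this
    omega
  obtain ⟨π, hπ⟩ := exists_proj_injOn hfr
  obtain ⟨C, hC⟩ := exists_chart_of_equations hrd hx0 P hP hloc π
    fun v hv h => hπ v ((hD v).2 hv) h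
  have key : ∀ v, v ∈ zTangent X x0 ↔ ∀ i, polyDer x0 v (P i) = 0 := by
    refine fun v => ⟨fun hv i => mem_zTangent_iff.1 hv _ (hP i), fun hv => ?_⟩
    refine C.mem_zTangent_of_fst_eq_zero C.mem_source hx0 ?_
    have h1 : HasFDerivAt C.e ((ContinuousLinearMap.pi fun i => polyDiff (P i) x0).prod π) x0 := by
      rw [show (C.e : (Fin n → ℂ) → _) = _ from funext hC]
      refine HasFDerivAt.prodMk (hasFDerivAt_pi.2 fun i => hasFDerivAt_eval (P i) x0) ?_
      have := π.hasFDerivAt.comp x0 ((hasFDerivAt_id x0).sub_const x0)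
      simpa using this
    rw [h1.fderiv]
    exact funext fun i => (polyDiff_apply _ _ _).trans (hv i)
  refine ⟨key, ?_⟩
  have : zTangent X x0 = LinearMap.ker D := Submodule.ext fun v => (key v).trans (hD v).symm
  rw [this, hfr]

lemma IsLCI.finrank_zTangent {n r d : ℕ} {X : Set (Fin n → ℂ)} (h : IsLCI X r) (hrd : r + d = n)
    {x : Fin n → ℂ} (hx : x ∈ X) : Module.finrank ℂ (zTangent X x) = d := by
  obtain ⟨P, hP, hsurj, hloc⟩ := h.exists_equations x hx
  exact (IsLCI.zTangent_eq hrd hx P hP hsurj hloc).2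

lemma IsLCI.exists_chart {n r d : ℕ} {X : Set (Fin n → ℂ)} (h : IsLCI X r) (hrd : r + d = n)
    {x0 : Fin n → ℂ} (hx0 : x0 ∈ X) (π : (Fin n → ℂ) →L[ℂ] (Fin d → ℂ))
    (hinj : ∀ v ∈ zTangent X x0, π v = 0 → v = 0) :
    ∃ C : LCIChart X r d x0, ∀ y, (C.e y).2 = π (y - x0) := by
  obtain ⟨P, hP, hsurj, hloc⟩ := h.exists_equations x0 hx0
  obtain ⟨C, hC⟩ := exists_chart_of_equations hrd hx0 P hP hloc π fun v hv hv' =>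
    hinj v (((IsLCI.zTangent_eq hrd hx0 P hP hsurj hloc).1 v).2 hv) hv'
  exact ⟨C, fun y => by rw [hC]⟩

lemma IsLCI.inter_hyperplane {n r : ℕ} {X : Set (Fin n → ℂ)} (h : IsLCI X r) (a : Fin n → ℂ)
    (c : ℂ) {d : ℕ} (hrd : r + d = n)
    (hac : ∀ x ∈ X, (∀ v ∈ zTangent X x, ∑ k, a k * v k = 0) → ∑ k, a k * x k ≠ c) :
    IsLCI (X ∩ {z | ∑ k, a k * z k = c}) (r + 1) := by
  refine ⟨h.isClosed.inter (isClosed_eq (by fun_prop) continuous_const), ?_⟩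
  rintro x ⟨hx, hxc⟩
  obtain ⟨P, hP, hsurj, hloc⟩ := h.exists_equations x hx
  let L : MvPolynomial (Fin n) ℂ := ∑ k, MvPolynomial.C (a k) * MvPolynomial.X k - MvPolynomial.C c
  have hL : ∀ y, MvPolynomial.eval y L = ∑ k, a k * y k - c := fun y => by simp [L]
  have hDL : ∀ v, polyDer x v L = ∑ k, a k * v k := fun v => by
    simp [L, polyDer_C, polyDer_mul, polyDer_X]
  refine ⟨Fin.snoc P L, ?_, ?_, ?_⟩
  · intro i y hy
    induction i using Fin.lastCases with
    | last => rw [Fin.snoc_last, hL, sub_eq_zero]; exact hy.2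
    | cast i => rw [Fin.snoc_castSucc]; exact hP i y hy.1
  · intro b
    obtain ⟨v, hv⟩ := hsurj fun i => b i.castSucc
    have h1 : ∃ u ∈ zTangent X x, ∑ k, a k * u k ≠ 0 := by
      by_contra hcon
      push Not at hcon
      exact hac x hx hcon hxc
    obtain ⟨u, hu, hau⟩ := h1
    refine ⟨v + ((b (Fin.last r) - ∑ k, a k * v k) / ∑ k, a k * u k) • u, fun i => ?_⟩
    induction i using Fin.lastCases with
    | last =>
      rw [Fin.snoc_last, hDL]
      simp only [Pi.add_apply, Pi.smul_apply, smul_eq_mul, mul_add, Finset.sum_add_distrib,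
        mul_left_comm (a _), ← Finset.mul_sum]
      rw [div_mul_cancel₀ _ hau]
      ring
    | cast i =>
      rw [Fin.snoc_castSucc, ← polyDiff_apply, map_add, map_smul, polyDiff_apply, polyDiff_apply,
        hv, mem_zTangent_iff.1 hu _ (hP i)]
      simp
  · filter_upwards [hloc] with y hy hyP
    refine ⟨hy fun i => ?_, ?_⟩
    · have := hyP i.castSucc
      rwa [Fin.snoc_castSucc] at this
    · have := hyP (Fin.last r)
      rw [Fin.snoc_last, hL, sub_eq_zero] at this
      exact this

lemma exists_equations_of_finrank {n r d : ℕ} (hrd : r + d = n) {X : Set (Fin n → ℂ)}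
    {x : Fin n → ℂ} (hd : Module.finrank ℂ (zTangent X x) = d) :
    ∃ P : Fin r → MvPolynomial (Fin n) ℂ, (∀ i, ∀ y ∈ X, MvPolynomial.eval y (P i) = 0) ∧
      (∀ v, v ∈ zTangent X x ↔ ∀ i, polyDer x v (P i) = 0) ∧
      ∀ b : Fin r → ℂ, ∃ v, ∀ i, polyDer x v (P i) = b i := by
  let s : Set (Module.Dual ℂ (Fin n → ℂ)) :=
    (fun p => diffAt p x) '' {p | ∀ y ∈ X, MvPolynomial.eval y p = 0}
  have hco : (Submodule.span ℂ s).dualCoannihilator = zTangent X x := by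
    ext v
    rw [Submodule.mem_dualCoannihilator, mem_zTangent_iff]
    constructor
    · intro h p hp
      rw [← diffAt_apply]
      exact h _ (Submodule.subset_span ⟨p, hp, rfl⟩)
    · intro h φ hφ
      induction hφ using Submodule.span_induction with
      | mem q hq =>
        obtain ⟨p, hp, rfl⟩ := hq
        exact (diffAt_apply _ _ _).trans (h p hp)
      | zero => simp
      | add a b ha hb h1 h2 => rw [LinearMap.add_apply, h1, h2, add_zero]
      | smul c a ha h1 => rw [LinearMap.smul_apply, h1, smul_zero]
  have hr : Module.finrank ℂ (Submodule.span ℂ s) = r := by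
    have := Subspace.finrank_add_finrank_dualCoannihilator_eq (Submodule.span ℂ s)
    rw [hco, hd] at this
    simp at this
    omega
  obtain ⟨f, hfs, hspan⟩ : ∃ f : Fin r → Module.Dual ℂ (Fin n → ℂ), (∀ i, f i ∈ s) ∧
      Submodule.span ℂ (Set.range f) = Submodule.span ℂ s := by
    obtain ⟨f, hfs, hspan, -⟩ := Submodule.exists_fun_fin_finrank_span_eq ℂ s
    subst hr
    exact ⟨f, hfs, hspan⟩
  choose P hP hPf using hfs
  have hfP : ∀ i v, f i v = polyDer x v (P i) := fun i v => by rw [← hPf]; exact diffAt_apply _ _ _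
  have hT : ∀ v, v ∈ zTangent X x ↔ ∀ i, polyDer x v (P i) = 0 := by
    intro v
    refine ⟨fun h i => mem_zTangent_iff.1 h _ (hP i), fun h => ?_⟩
    rw [← hco, ← hspan, Submodule.mem_dualCoannihilator]
    intro φ hφ
    induction hφ using Submodule.span_induction with
    | mem q hq =>
      obtain ⟨i, rfl⟩ := hq
      rw [hfP, h]
    | zero => simp
    | add a b ha hb h1 h2 => rw [LinearMap.add_apply, h1, h2, add_zero]
    | smul c a ha h1 => rw [LinearMap.smul_apply, h1, smul_zero]
  refine ⟨P, hP, hT, fun b => ?_⟩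
  let D : (Fin n → ℂ) →ₗ[ℂ] (Fin r → ℂ) := LinearMap.pi f
  have hker : LinearMap.ker D = zTangent X x := by
    ext v
    rw [LinearMap.mem_ker, funext_iff, hT]
    exact forall_congr' fun i => by rw [← hfP]; rfl
  have hrange : LinearMap.range D = ⊤ := by
    refine Submodule.eq_top_of_finrank_eq ?_
    have := D.finrank_range_add_finrank_ker
    rw [hker, hd] at this
    simp at this ⊢
    omega
  obtain ⟨v, hv⟩ := LinearMap.range_eq_top.1 hrange b
  exact ⟨v, fun i => by rw [← hfP, ← hv]; rfl⟩

lemma IsSmoothClosedOfDim.isLCI {n d : ℕ} {X : Set (Fin n → ℂ)} (hX : IsSmoothClosedOfDim X d) :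
    ∃ r, r + d = n ∧ IsLCI X r := by
  obtain ⟨halg, ⟨x0, hx0⟩, hsm⟩ := hX
  have hdn : d ≤ n := by
    rw [← (hsm x0 hx0).2]
    simpa using (zTangent X x0).finrank_le
  refine ⟨n - d, by omega, halg.isClosed, fun x hx => ?_⟩
  obtain ⟨⟨ψ, U, hUo, h0U, hψ0, hψd, -, hinj, V, hV, hVU⟩, hd⟩ := hsm x hx
  have hrd : n - d + d = n := by omega
  obtain ⟨P, hP, hPT, hsurj⟩ := exists_equations_of_finrank hrd hd
  refine ⟨P, hP, hsurj, ?_⟩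
  obtain ⟨π, hπ⟩ := exists_proj_injOn hd
  obtain ⟨e, he, hxe, -, -⟩ := exists_polyChart hrd P π x
    (fun v hv h => hπ v ((hPT v).2 hv) h) Set.univ univ_mem
  have hUn : U ∈ 𝓝 (0 : Fin d → ℂ) := hUo.mem_nhds h0U
  have hψs := hasStrictFDerivAt_of_differentiableOn hUn hψd
  have hψX : ∀ t ∈ U, ψ t ∈ X := fun t ht => by
    have : ψ t ∈ ψ '' U := ⟨t, ht, rfl⟩
    rw [hVU] at this
    exact this.1
  have himg : ∀ v, fderiv ℂ ψ 0 v ∈ zTangent X x := by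
    intro v
    rw [mem_zTangent_iff]
    intro p hp
    have h1 : HasFDerivAt (fun y => MvPolynomial.eval (ψ y) p)
        ((polyDiff p x).comp (fderiv ℂ ψ 0)) 0 := by
      have := hasFDerivAt_eval p (ψ 0)
      rw [hψ0] at this
      rw [← hψ0] at this
      have h := this.comp (0 : Fin d → ℂ) hψs.hasFDerivAt
      rw [hψ0] at h
      exact h
    have h2 : (fun y => MvPolynomial.eval (ψ y) p) =ᶠ[𝓝 0] fun _ => 0 := by
      filter_upwards [hUn] with t ht using hp _ (hψX t ht)
    have h3 := h1.unique ((hasFDerivAt_const (0 : ℂ) (0 : Fin d → ℂ)).congr_of_eventuallyEq h2)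
    rw [← polyDiff_apply]
    exact congrArg (fun L => L v) h3
  let g' : (Fin d → ℂ) →L[ℂ] (Fin d → ℂ) := π.comp (fderiv ℂ ψ 0)
  have hg'inj : Function.Injective g' := by
    rw [injective_iff_map_eq_zero]
    intro v hv
    exact (injective_iff_map_eq_zero _).1 hinj v (hπ _ (himg v) hv)
  let A : (Fin d → ℂ) ≃L[ℂ] (Fin d → ℂ) :=
    (LinearEquiv.ofInjectiveEndo (g' : (Fin d → ℂ) →ₗ[ℂ] _) hg'inj).toContinuousLinearEquiv
  have hA : (A : (Fin d → ℂ) →L[ℂ] _) = g' := by ext1 v; rfl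
  have hg : HasStrictFDerivAt (fun t => π (ψ t - x)) (A : (Fin d → ℂ) →L[ℂ] _) 0 := by
    rw [hA]
    exact π.hasStrictFDerivAt.comp (0 : Fin d → ℂ) (hψs.sub_const x)
  have hmap := hg.map_nhds_eq_of_equiv
  have hS : U ∩ ψ ⁻¹' e.source ∈ 𝓝 (0 : Fin d → ℂ) := by
    refine inter_mem hUn (hψs.hasFDerivAt.continuousAt.preimage_mem_nhds ?_)
    rw [hψ0]
    exact e.open_source.mem_nhds hxe
  have h1 := image_mem_map (m := fun t => π (ψ t - x)) hS
  rw [hmap, hψ0, sub_self, map_zero] at h1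
  have hcont : Tendsto (fun y => π (y - x)) (𝓝 x) (𝓝 0) := by
    have : Continuous fun y => π (y - x) := by fun_prop
    simpa using this.tendsto x
  filter_upwards [hcont h1, e.open_source.mem_nhds hxe] with y hy hye hyP
  obtain ⟨t, ⟨htU, hte⟩, ht⟩ := hy
  have : y = ψ t := by
    refine e.injOn hye hte ?_
    rw [he, he]
    refine Prod.ext (funext fun i => ?_) ht.symm
    exact (hyP i).trans (hP i _ (hψX t htU)).symm
  rw [this]
  exact hψX t htU

lemma exists_lipschitzOn_closedBall {E : Type} [NormedAddCommGroup E] [NormedSpace ℝ E]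
    [FiniteDimensional ℝ E] {V : E → E} (hV : ContDiff ℝ 1 V) (x : E) (R : ℝ) :
    ∃ K, LipschitzOnWith K V (Metric.closedBall x R) := by
  have hp : ProperSpace E := FiniteDimensional.proper ℝ E
  obtain ⟨C, hC⟩ := (isCompact_closedBall x R).exists_bound_of_continuousOn
    (hV.continuous_fderiv one_ne_zero).continuousOn
  refine ⟨C.toNNReal, (convex_closedBall x R).lipschitzOnWith_of_nnnorm_fderiv_le
    (𝕜 := ℝ) (fun y _ => hV.differentiable one_ne_zero y) fun y hy => ?_⟩
  rw [← NNReal.coe_le_coe, coe_nnnorm]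
  exact (hC y hy).trans (Real.le_coe_toNNReal C)

lemma ode_unique {E : Type} [NormedAddCommGroup E] [NormedSpace ℝ E]
    [FiniteDimensional ℝ E] {V : E → E} (hV : ContDiff ℝ 1 V) {f g : ℝ → E} {a b t₀ : ℝ}
    (h0 : t₀ ∈ Set.Ioo a b) (hf : ∀ t ∈ Set.Icc a b, HasDerivWithinAt f (V (f t)) (Set.Icc a b) t)
    (hg : ∀ t ∈ Set.Icc a b, HasDerivWithinAt g (V (g t)) (Set.Icc a b) t) (h : f t₀ = g t₀) :
    Set.EqOn f g (Set.Icc a b) := by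
  have hfc : ContinuousOn f (Set.Icc a b) := fun t ht => (hf t ht).continuousWithinAt
  have hgc : ContinuousOn g (Set.Icc a b) := fun t ht => (hg t ht).continuousWithinAt
  obtain ⟨C, hC⟩ := isCompact_Icc.exists_bound_of_continuousOn hfc
  obtain ⟨C', hC'⟩ := isCompact_Icc.exists_bound_of_continuousOn hgc
  obtain ⟨K, hK⟩ := exists_lipschitzOn_closedBall hV 0 (max C C')
  refine ODE_solution_unique_of_mem_Icc (v := fun _ => V)
    (s := fun _ => Metric.closedBall 0 (max C C')) (fun t _ => hK) h0 hfc
    (fun t ht => (hf t (Set.Ioo_subset_Icc_self ht)).hasDerivAt (Icc_mem_nhds ht.1 ht.2))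
    (fun t ht => ?_) hgc
    (fun t ht => (hg t (Set.Ioo_subset_Icc_self ht)).hasDerivAt (Icc_mem_nhds ht.1 ht.2))
    (fun t ht => ?_) h
  · rw [mem_closedBall_zero_iff]
    exact (hC t (Set.Ioo_subset_Icc_self ht)).trans (le_max_left _ _)
  · rw [mem_closedBall_zero_iff]
    exact (hC' t (Set.Ioo_subset_Icc_self ht)).trans (le_max_right _ _)

lemma ode_unique_right {E : Type} [NormedAddCommGroup E] [NormedSpace ℝ E]
    [FiniteDimensional ℝ E] {V : E → E} (hV : ContDiff ℝ 1 V) {f g : ℝ → E} {a b : ℝ}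
    (hf : ∀ t ∈ Set.Icc a b, HasDerivAt f (V (f t)) t)
    (hg : ∀ t ∈ Set.Icc a b, HasDerivAt g (V (g t)) t) (h : f a = g a) :
    Set.EqOn f g (Set.Icc a b) := by
  have hfc : ContinuousOn f (Set.Icc a b) := fun t ht => (hf t ht).continuousAt.continuousWithinAt
  have hgc : ContinuousOn g (Set.Icc a b) := fun t ht => (hg t ht).continuousAt.continuousWithinAt
  obtain ⟨C, hC⟩ := isCompact_Icc.exists_bound_of_continuousOn hfc
  obtain ⟨C', hC'⟩ := isCompact_Icc.exists_bound_of_continuousOn hgc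
  obtain ⟨K, hK⟩ := exists_lipschitzOn_closedBall hV 0 (max C C')
  refine ODE_solution_unique_of_mem_Icc_right (v := fun _ => V)
    (s := fun _ => Metric.closedBall 0 (max C C')) (fun t _ => hK) hfc
    (fun t ht => (hf t (Set.Ico_subset_Icc_self ht)).hasDerivWithinAt)
    (fun t ht => ?_) hgc
    (fun t ht => (hg t (Set.Ico_subset_Icc_self ht)).hasDerivWithinAt)
    (fun t ht => ?_) h
  · rw [mem_closedBall_zero_iff]
    exact (hC t (Set.Ico_subset_Icc_self ht)).trans (le_max_left _ _)
  · rw [mem_closedBall_zero_iff]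
    exact (hC' t (Set.Ico_subset_Icc_self ht)).trans (le_max_right _ _)

/-- `Φ` is the global flow of the vector field `V`. -/
structure IsFlow {E : Type} [NormedAddCommGroup E] [NormedSpace ℝ E] (V : E → E)
    (Φ : ℝ → E → E) : Prop where
  continuous : Continuous fun p : ℝ × E => Φ p.1 p.2
  zero : ∀ x, Φ 0 x = x
  hasDerivAt : ∀ x t, HasDerivAt (fun t => Φ t x) (V (Φ t x)) t

theorem exists_flow {E : Type} [NormedAddCommGroup E] [NormedSpace ℝ E]
    [FiniteDimensional ℝ E] {V : E → E} (hV : ContDiff ℝ 1 V) {C : ℝ} (hC : ∀ x, ‖V x‖ ≤ C) :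
    ∃ Φ, IsFlow V Φ := by
  have hcs : CompleteSpace E := FiniteDimensional.complete ℝ E
  have hC0 : 0 ≤ C := (norm_nonneg _).trans (hC 0)
  have key : ∀ (x0 : E) (N : ℕ), ∃ α : E × ℝ → E, (∀ x ∈ Metric.closedBall x0 1,
      α (x, 0) = x ∧ ∀ t ∈ Set.Icc (-((N : ℝ) + 1)) (N + 1),
        HasDerivWithinAt (fun t => α (x, t)) (V (α (x, t))) (Set.Icc (-((N : ℝ) + 1)) (N + 1)) t) ∧
      ContinuousOn α (Metric.closedBall x0 1 ×ˢ Set.Icc (-((N : ℝ) + 1)) (N + 1)) := by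
    intro x0 N
    obtain ⟨K, hK⟩ := exists_lipschitzOn_closedBall hV x0 (C * (N + 1) + 1)
    have hN : (0 : ℝ) ∈ Set.Icc (-((N : ℝ) + 1)) (N + 1) := ⟨by linarith [N.cast_nonneg (α := ℝ)],
      by positivity⟩
    have hpl : IsPicardLindelof (fun _ => V) (⟨0, hN⟩ : Set.Icc (-((N : ℝ) + 1)) (N + 1)) x0
        ⟨C * (N + 1) + 1, by positivity⟩ 1 ⟨C, hC0⟩ K := by
      refine IsPicardLindelof.of_time_independent (fun x _ => hC x) hK ?_
      simp only [sub_zero, zero_sub, neg_neg, max_self, NNReal.coe_one]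
      exact (add_sub_cancel_right _ _).ge
    exact hpl.exists_forall_mem_closedBall_eq_hasDerivWithinAt_continuousOn
  choose α hα hαc using key
  have hsub : ∀ {M N : ℕ}, M ≤ N → Set.Icc (-((M : ℝ) + 1)) (M + 1) ⊆
      Set.Icc (-((N : ℝ) + 1)) (N + 1) := by
    intro M N h
    have : (M : ℝ) ≤ N := by exact_mod_cast h
    exact Set.Icc_subset_Icc (by linarith) (by linarith)
  have agree0 : ∀ {x0 x1 y : E} {M N : ℕ}, M ≤ N → y ∈ Metric.closedBall x0 1 →
      y ∈ Metric.closedBall x1 1 → ∀ t ∈ Set.Icc (-((M : ℝ) + 1)) (M + 1),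
      α x0 M (y, t) = α x1 N (y, t) := by
    intro x0 x1 y M N hMN h0 h1
    refine ode_unique hV (t₀ := 0) ⟨by linarith [M.cast_nonneg (α := ℝ)], by positivity⟩
      (hα x0 M y h0).2 (fun t ht => ?_) ?_
    · exact ((hα x1 N y h1).2 t (hsub hMN ht)).mono (hsub hMN)
    · rw [(hα x0 M y h0).1, (hα x1 N y h1).1]
  let Φ : ℝ → E → E := fun t x => α x ⌈|t|⌉₊ (x, t)
  have hmem : ∀ t : ℝ, t ∈ Set.Icc (-((⌈|t|⌉₊ : ℝ) + 1)) (⌈|t|⌉₊ + 1) := by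
    intro t
    have := Nat.le_ceil |t|
    exact ⟨by linarith [neg_abs_le t], by linarith [le_abs_self t]⟩
  have agree : ∀ (x0 y : E) (N : ℕ) (t : ℝ), y ∈ Metric.closedBall x0 1 →
      t ∈ Set.Icc (-((N : ℝ) + 1)) (N + 1) → Φ t y = α x0 N (y, t) := by
    intro x0 y N t hy ht
    have hyy : y ∈ Metric.closedBall y 1 := Metric.mem_closedBall_self zero_le_one
    rcases le_total ⌈|t|⌉₊ N with h | h
    · exact agree0 h hyy hy t (hmem t)
    · exact (agree0 h hy hyy t ht).symm
  have hnear : ∀ t : ℝ, ∀ᶠ s in 𝓝 t, s ∈ Set.Icc (-((⌈|t|⌉₊ : ℝ) + 1)) (⌈|t|⌉₊ + 1) := by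
    intro t
    have := Nat.le_ceil |t|
    exact Icc_mem_nhds (by linarith [neg_abs_le t]) (by linarith [le_abs_self t])
  refine ⟨Φ, ?_, fun x => ?_, fun x t => ?_⟩
  · rw [continuous_iff_continuousAt]
    rintro ⟨t, x⟩
    have h1 : Metric.closedBall x 1 ×ˢ Set.Icc (-((⌈|t|⌉₊ : ℝ) + 1)) (⌈|t|⌉₊ + 1) ∈ 𝓝 (x, t) :=
      prod_mem_nhds (Metric.closedBall_mem_nhds _ one_pos) (hnear t)
    have h2 : ContinuousAt (fun p : ℝ × E => α x ⌈|t|⌉₊ (p.2, p.1)) (t, x) :=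
      ContinuousAt.comp (f := fun p : ℝ × E => (p.2, p.1)) (g := α x ⌈|t|⌉₊) (x := (t, x))
        ((hαc x ⌈|t|⌉₊).continuousAt h1) (by fun_prop)
    refine h2.congr ?_
    have h3 : Set.Icc (-((⌈|t|⌉₊ : ℝ) + 1)) (⌈|t|⌉₊ + 1) ×ˢ Metric.closedBall x 1 ∈ 𝓝 (t, x) :=
      prod_mem_nhds (hnear t) (Metric.closedBall_mem_nhds _ one_pos)
    filter_upwards [h3] with p hp
    exact (agree x p.2 _ p.1 hp.2 hp.1).symm
  · exact (hα x _ x (Metric.mem_closedBall_self zero_le_one)).1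
  · have hx : x ∈ Metric.closedBall x 1 := Metric.mem_closedBall_self zero_le_one
    have h1 := ((hα x ⌈|t|⌉₊ x hx).2 t (hmem t)).hasDerivAt (hnear t)
    refine h1.congr_of_eventuallyEq ?_
    filter_upwards [hnear t] with s hs using agree x x _ s hx hs

lemma IsFlow.add {E : Type} [NormedAddCommGroup E] [NormedSpace ℝ E]
    [FiniteDimensional ℝ E] {V : E → E} (hV : ContDiff ℝ 1 V) {Φ : ℝ → E → E} (h : IsFlow V Φ)
    (s t : ℝ) (x : E) : Φ (s + t) x = Φ s (Φ t x) := by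
  have h1 : ∀ u, HasDerivAt (fun u => Φ (u + t) x) (V (Φ (u + t) x)) u := fun u =>
    (h.hasDerivAt x (u + t)).comp_add_const u t
  refine ode_unique hV (f := fun u => Φ (u + t) x) (g := fun u => Φ u (Φ t x)) (a := - |s| - 1)
    (b := |s| + 1) (t₀ := 0) ⟨by linarith [abs_nonneg s], by positivity⟩
    (fun u _ => (h1 u).hasDerivWithinAt) (fun u _ => (h.hasDerivAt _ u).hasDerivWithinAt) ?_
    ⟨by linarith [neg_abs_le s], by linarith [le_abs_self s]⟩
  simp [h.zero]

lemma IsFlow.eq_of_curve {E : Type} [NormedAddCommGroup E] [NormedSpace ℝ E]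
    [FiniteDimensional ℝ E] {V : E → E} (hV : ContDiff ℝ 1 V) {Φ : ℝ → E → E} (h : IsFlow V Φ)
    {σ : ℝ → E} {T : ℝ} (hT : 0 ≤ T) (hσ : ∀ t ∈ Set.Icc 0 T, HasDerivAt σ (V (σ t)) t) :
    Φ T (σ 0) = σ T :=
  ode_unique_right hV (f := fun t => Φ t (σ 0)) (fun t _ => h.hasDerivAt _ t) hσ
    (h.zero _) ⟨hT, le_rfl⟩

lemma IsFlow.neg {E : Type} [NormedAddCommGroup E] [NormedSpace ℝ E]
    {V : E → E} {Φ : ℝ → E → E} (h : IsFlow V Φ) : IsFlow (fun x => -V x) fun t => Φ (-t) := by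
  refine ⟨?_, fun x => by simp [h.zero], fun x t => ?_⟩
  · exact h.continuous.comp (f := fun p : ℝ × E => (-p.1, p.2)) (by fun_prop)
  · have := HasDerivAt.scomp (h := fun t : ℝ => -t) t (h.hasDerivAt x (-t)) (hasDerivAt_neg t)
    simp only [neg_smul, one_smul] at this
    exact this

lemma ContDiffAt.clm_apply_complex {G E F : Type} [NormedAddCommGroup G] [NormedSpace ℝ G]
    [NormedAddCommGroup E] [NormedSpace ℂ E] [NormedAddCommGroup F] [NormedSpace ℂ F]
    {A : G → E →L[ℂ] F} {w : G → E} {x : G} {k : WithTop ℕ∞} (hA : ContDiffAt ℝ k A x)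
    (hw : ContDiffAt ℝ k w x) : ContDiffAt ℝ k (fun y => A y (w y)) x :=
  ContDiffAt.clm_apply (f := fun y => (A y).restrictScalars ℝ)
    ((ContinuousLinearMap.restrictScalarsL ℂ E F ℝ ℝ).contDiff.contDiffAt.comp x hA) hw

lemma IsFlow.mem_of_tangent {n r d : ℕ} {X : Set (Fin n → ℂ)} (hX : IsLCI X r) (hrd : r + d = n)
    {V : (Fin n → ℂ) → (Fin n → ℂ)} (hV : ContDiff ℝ 1 V) (hVX : ∀ x ∈ X, V x ∈ zTangent X x)
    {Φ : ℝ → (Fin n → ℂ) → (Fin n → ℂ)} (h : IsFlow V Φ) {x : Fin n → ℂ} (hx : x ∈ X) {T : ℝ}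
    (hT : 0 ≤ T) : Φ T x ∈ X := by
  have hΦc : Continuous fun t => Φ t x := h.continuous.comp (by fun_prop : Continuous fun t => (t, x))
  have hcl : IsClosed {t | Φ t x ∈ X} := hX.isClosed.preimage hΦc
  suffices hs : Set.Icc 0 T ⊆ {t | Φ t x ∈ X} from hs ⟨hT, le_rfl⟩
  refine (hcl.inter isClosed_Icc).Icc_subset_of_forall_exists_gt ?_ fun t0 ht0 y hy => ?_
  · simpa [h.zero] using hx
  obtain ⟨ht0X, ht0⟩ := ht0
  replace ht0X : Φ t0 x ∈ X := ht0X
  obtain ⟨π, hπ⟩ := exists_proj_injOn (hX.finrank_zTangent hrd ht0X)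
  obtain ⟨C, -⟩ := hX.exists_chart hrd ht0X π hπ
  set x0 := Φ t0 x with hx0
  let F : (Fin r → ℂ) × (Fin d → ℂ) → (Fin r → ℂ) := fun z =>
    (fderiv ℂ C.e (C.e.symm z) (V (C.e.symm z))).1
  have h0t : (0 : (Fin r → ℂ) × (Fin d → ℂ)) ∈ C.e.target := by
    rw [← C.map_center]; exact C.e.map_source C.mem_source
  have hF : ContDiffAt ℝ 1 F 0 := by
    have hs : ContDiffAt ℝ 1 C.e.symm 0 :=
      ((C.contDiffOn_symm.contDiffAt (C.e.open_target.mem_nhds h0t)).restrict_scalars ℝ).of_le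
        (by simp)
    have he : ContDiff ℝ 1 (fderiv ℂ C.e) :=
      ((C.contDiff.fderiv_right (m := 1) (by simp)).restrict_scalars ℝ)
    exact (ContDiffAt.clm_apply_complex (he.contDiffAt.comp _ hs)
      (hV.contDiffAt.comp _ hs)).fst
  obtain ⟨K, N, hN, hK⟩ := hF.exists_lipschitzOnWith
  obtain ⟨ε, hε, hball⟩ := Metric.mem_nhds_iff.1 (inter_mem hN (C.e.open_target.mem_nhds h0t))
  have hFb : ∀ z ∈ Metric.ball (0 : (Fin r → ℂ) × (Fin d → ℂ)) ε, ‖F z‖ ≤ K * ‖z.1‖ := by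
    intro z hz
    have hz' : ((0 : Fin r → ℂ), z.2) ∈ Metric.ball (0 : (Fin r → ℂ) × (Fin d → ℂ)) ε := by
      rw [mem_ball_zero_iff, Prod.norm_mk] at *
      rw [norm_zero]
      exact max_lt hε ((norm_snd_le z).trans_lt hz)
    have hF0 : F (0, z.2) = 0 := by
      have ht := (hball hz').2
      have hsX : C.e.symm (0, z.2) ∈ X := by
        rw [C.mem_iff _ (C.e.map_target ht), C.e.right_inv ht]
      exact C.fst_eq_zero _ (C.e.map_target ht) hsX _ (hVX _ hsX)
    have := hK.dist_le_mul z (hball hz).1 _ (hball hz').1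
    rw [hF0, dist_zero_right, dist_eq_norm, Prod.norm_def] at this
    simpa using this
  have hcont : ContinuousAt (fun t => C.e (Φ t x)) t0 :=
    (C.contDiff.continuous.comp hΦc).continuousAt
  have hev : ∀ᶠ t in 𝓝 t0, C.e (Φ t x) ∈ Metric.ball (0 : (Fin r → ℂ) × (Fin d → ℂ)) ε ∧
      Φ t x ∈ C.e.source := by
    refine (hcont.eventually_mem ?_).and
      (hΦc.continuousAt.eventually_mem (C.e.open_source.mem_nhds C.mem_source))
    rw [← hx0, C.map_center]
    exact Metric.ball_mem_nhds _ hε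
  obtain ⟨δ, hδ, hδb⟩ := Metric.eventually_nhds_iff.1 hev
  let t1 := min y (t0 + δ / 2)
  have ht1 : t0 < t1 := lt_min hy (by linarith)
  have hloc : ∀ t ∈ Set.Icc t0 t1, C.e (Φ t x) ∈ Metric.ball (0 : (Fin r → ℂ) × (Fin d → ℂ)) ε ∧
      Φ t x ∈ C.e.source := by
    intro t ht
    refine hδb ?_
    have := ht.2.trans (min_le_right _ _)
    rw [Real.dist_eq, abs_of_nonneg (by linarith [ht.1])]
    linarith
  have hder : ∀ t ∈ Set.Icc t0 t1, HasDerivAt (fun t => (C.e (Φ t x)).1) (F (C.e (Φ t x))) t := by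
    intro t ht
    have h1 := ((C.hasFDerivAt (Φ t x)).restrictScalars ℝ).comp_hasDerivAt t (h.hasDerivAt x t)
    have h2 := h1.hasFDerivAt.fst.hasDerivAt
    have h3 : F (C.e (Φ t x)) = (fderiv ℂ C.e (Φ t x) (V (Φ t x))).1 := by
      simp only [F, C.e.left_inv (hloc t ht).2]
    rw [h3]
    simpa [Function.comp_def] using h2
  have hz := eq_zero_of_abs_deriv_le_mul_abs_self_of_eq_zero_right (K := K) (a := t0) (b := t1)
    (f := fun t => (C.e (Φ t x)).1) (f' := fun t => F (C.e (Φ t x)))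
    (fun t ht => (hder t ht).continuousAt.continuousWithinAt)
    (fun t ht => (hder t (Set.Ico_subset_Icc_self ht)).hasDerivWithinAt)
    (by rw [← hx0, C.map_center]; rfl)
    (fun t ht => hFb _ (hloc t (Set.Ico_subset_Icc_self ht)).1) t1 ⟨ht1.le, le_rfl⟩
  refine ⟨t1, ?_, ht1, min_le_left _ _⟩
  exact (C.mem_iff _ (hloc t1 ⟨ht1.le, le_rfl⟩).2).2 hz

lemma IsFlow.mem_iff_of_tangent {n r d : ℕ} {X : Set (Fin n → ℂ)} (hX : IsLCI X r)
    (hrd : r + d = n) {V : (Fin n → ℂ) → (Fin n → ℂ)} (hV : ContDiff ℝ 1 V)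
    (hVX : ∀ x ∈ X, V x ∈ zTangent X x) {Φ : ℝ → (Fin n → ℂ) → (Fin n → ℂ)} (h : IsFlow V Φ)
    {x : Fin n → ℂ} (hx : x ∈ X) (t : ℝ) : Φ t x ∈ X := by
  rcases le_total 0 t with ht | ht
  · exact h.mem_of_tangent hX hrd hV hVX hx ht
  · have := h.neg.mem_of_tangent hX hrd hV.neg (fun x hx => neg_mem (hVX x hx)) hx
      (neg_nonneg.2 ht)
    simpa using this

lemma IsFlow.eq_add_of_nonneg {E : Type} [NormedAddCommGroup E] [NormedSpace ℝ E]
    {V : E → E} {Φ : ℝ → E → E} (h : IsFlow V Φ) {C : ℝ} (hC : ∀ x, ‖V x‖ ≤ C) (ℓ : E →L[ℝ] ℂ)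
    {X : Set E} {x : E} (hX : ∀ t, Φ t x ∈ X) {c α : ℂ} {r r' : ℝ} (hr : r' < r)
    (hV : ∀ y ∈ X, ‖ℓ y - c‖ < r → ℓ (V y) = α) {T : ℝ} (hT : 0 ≤ T)
    (hs : ∀ s ∈ Set.Icc 0 T, ‖ℓ x + s * α - c‖ ≤ r') : ℓ (Φ T x) = ℓ x + T * α := by
  have hder : ∀ t, HasDerivAt (fun t : ℝ => ℓ (Φ t x) - (ℓ x + t * α)) (ℓ (V (Φ t x)) - α) t := by
    intro t
    have h1 := ℓ.hasFDerivAt.comp_hasDerivAt t (h.hasDerivAt x t)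
    have h2 : HasDerivAt (fun t : ℝ => ℓ x + t * α) α t := by
      have := ((Complex.ofRealCLM.hasDerivAt (x := t)).mul_const α).const_add (ℓ x)
      simpa using this
    exact h1.sub h2
  have hz := eq_zero_of_abs_deriv_le_mul_abs_self_of_eq_zero_right
    (K := (‖ℓ‖ * C + ‖α‖) / (r - r')) (a := 0) (b := T)
    (f := fun t : ℝ => ℓ (Φ t x) - (ℓ x + t * α)) (f' := fun t => ℓ (V (Φ t x)) - α)
    (fun t _ => (hder t).continuousAt.continuousWithinAt)
    (fun t _ => (hder t).hasDerivWithinAt) (by simp [h.zero]) ?_ T ⟨hT, le_rfl⟩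
  · exact sub_eq_zero.1 hz
  intro t ht
  have hrr : 0 < r - r' := sub_pos.2 hr
  have hb : ‖ℓ (V (Φ t x)) - α‖ ≤ ‖ℓ‖ * C + ‖α‖ :=
    (norm_sub_le _ _).trans (add_le_add_left ((ℓ.le_opNorm _).trans
      (mul_le_mul_of_nonneg_left (hC _) (norm_nonneg _))) _)
  rcases lt_or_ge ‖ℓ (Φ t x) - (ℓ x + t * α)‖ (r - r') with hlt | hge
  · rw [hV _ (hX t), sub_self, norm_zero]
    · exact mul_nonneg (div_nonneg ((norm_nonneg _).trans hb) hrr.le) (norm_nonneg _)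
    · calc ‖ℓ (Φ t x) - c‖ = ‖(ℓ (Φ t x) - (ℓ x + t * α)) + (ℓ x + t * α - c)‖ := by ring_nf
        _ ≤ _ := norm_add_le _ _
        _ < r := by linarith [hs t (Set.Ico_subset_Icc_self ht)]
  · refine hb.trans ?_
    rw [div_mul_eq_mul_div, le_div_iff₀ hrr]
    exact mul_le_mul_of_nonneg_left hge ((norm_nonneg _).trans hb)

lemma IsFlow.eq_add {E : Type} [NormedAddCommGroup E] [NormedSpace ℝ E]
    {V : E → E} {Φ : ℝ → E → E} (h : IsFlow V Φ) {C : ℝ} (hC : ∀ x, ‖V x‖ ≤ C) (ℓ : E →L[ℝ] ℂ)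
    {X : Set E} {x : E} (hX : ∀ t, Φ t x ∈ X) {c α : ℂ} {r r' : ℝ} (hr : r' < r)
    (hV : ∀ y ∈ X, ‖ℓ y - c‖ < r → ℓ (V y) = α) {T : ℝ}
    (h0 : ‖ℓ x - c‖ ≤ r') (h1 : ‖ℓ x + T * α - c‖ ≤ r') : ℓ (Φ T x) = ℓ x + T * α := by
  have hs : ∀ u ∈ Set.Icc (0 : ℝ) 1, ‖ℓ x + (u * T : ℝ) * α - c‖ ≤ r' := by
    intro u hu
    have : ℓ x + (u * T : ℝ) * α - c = (1 - u) • (ℓ x - c) + u • (ℓ x + T * α - c) := by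
      simp only [Complex.real_smul]; push_cast; ring
    rw [this]
    have hm := (convex_closedBall (0 : ℂ) r') (mem_closedBall_zero_iff.2 h0)
      (mem_closedBall_zero_iff.2 h1) (sub_nonneg.2 hu.2) hu.1 (by ring)
    exact mem_closedBall_zero_iff.1 hm
  rcases eq_or_ne T 0 with rfl | hT0
  · simp [h.zero]
  rcases le_total 0 T with hT | hT
  · refine h.eq_add_of_nonneg hC ℓ hX hr hV hT fun s hsT => ?_
    have := hs (s / T) ⟨by have := hsT.1; positivity, div_le_one_of_le₀ hsT.2 hT⟩
    rwa [div_mul_cancel₀ _ hT0] at this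
  · have := h.neg.eq_add_of_nonneg (C := C) (by simpa using hC) ℓ (X := X) (x := x) (fun t => hX _)
      (c := c) (α := -α) hr (fun y hy hyr => by rw [map_neg, hV y hy hyr]) (neg_nonneg.2 hT)
      fun s hsT => by
        have := hs (-s / T) ⟨div_nonneg_of_nonpos (by linarith [hsT.1]) hT, by
          rw [div_le_one_of_neg (lt_of_le_of_ne hT hT0)]; linarith [hsT.2]⟩
        rw [div_mul_cancel₀ _ hT0] at this
        simpa using this
    simpa using this

lemma IsFlow.eq_self_of_eq_zero {E : Type} [NormedAddCommGroup E] [NormedSpace ℝ E]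
    [FiniteDimensional ℝ E] {V : E → E} (hV : ContDiff ℝ 1 V) {Φ : ℝ → E → E} (h : IsFlow V Φ)
    {x : E} (hx : V x = 0) (t : ℝ) : Φ t x = x := by
  rcases le_total 0 t with ht | ht
  · exact h.eq_of_curve hV (σ := fun _ => x) ht fun t _ => by
      rw [hx]; exact hasDerivAt_const _ _
  · have := h.neg.eq_of_curve hV.neg (σ := fun _ => x) (neg_nonneg.2 ht) fun t _ => by
      rw [hx, neg_zero]; exact hasDerivAt_const _ _
    simpa using this

/-! ### Attaching cells -/

section Attach

open unitInterval

variable {d : ℕ} {A A' B : Type} [TopologicalSpace A] [TopologicalSpace A'] [TopologicalSpace B]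

/-- The inclusion of the boundary sphere in the closed ball. -/
def sphereIncl (d : ℕ) : C(↥(cellSphere d), ↥(cellBall d)) :=
  ⟨fun x => ⟨x.1, Metric.sphere_subset_closedBall x.2⟩, by fun_prop⟩

def attachBase (φ : C(↥(cellSphere d), A)) : C(A, attachSp φ) :=
  ⟨fun a => Quot.mk _ (Sum.inl a), continuous_quot_mk.comp continuous_inl⟩

def attachCell (φ : C(↥(cellSphere d), A)) : C(↥(cellBall d), attachSp φ) :=
  ⟨fun a => Quot.mk _ (Sum.inr a), continuous_quot_mk.comp continuous_inr⟩

lemma attachCell_sphere (φ : C(↥(cellSphere d), A)) (x : ↥(cellSphere d)) :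
    attachCell φ (sphereIncl d x) = attachBase φ (φ x) :=
  (Quot.sound ⟨x, rfl, rfl⟩ : Quot.mk (attachRel φ) _ = Quot.mk _ _).symm

/-- The universal property of the attaching space. -/
def attachDesc (φ : C(↥(cellSphere d), A)) (f : C(A, B)) (g : C(↥(cellBall d), B))
    (h : ∀ x, f (φ x) = g (sphereIncl d x)) : C(attachSp φ, B) :=
  ⟨Quot.lift (Sum.elim f g) (by rintro _ _ ⟨x, rfl, rfl⟩; exact h x),
    continuous_quot_lift _ (by fun_prop)⟩

@[simp] lemma attachDesc_base (φ : C(↥(cellSphere d), A)) (f : C(A, B)) (g : C(↥(cellBall d), B))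
    (h : ∀ x, f (φ x) = g (sphereIncl d x)) (a : A) :
    attachDesc φ f g h (attachBase φ a) = f a := rfl

@[simp] lemma attachDesc_cell (φ : C(↥(cellSphere d), A)) (f : C(A, B)) (g : C(↥(cellBall d), B))
    (h : ∀ x, f (φ x) = g (sphereIncl d x)) (y : ↥(cellBall d)) :
    attachDesc φ f g h (attachCell φ y) = g y := rfl

lemma attach_ind (φ : C(↥(cellSphere d), A)) {P : attachSp φ → Prop}
    (h1 : ∀ a, P (attachBase φ a)) (h2 : ∀ y, P (attachCell φ y)) (z : attachSp φ) : P z := by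
  induction z using Quot.ind with
  | mk z =>
    cases z with
    | inl a => exact h1 a
    | inr y => exact h2 y

lemma attach_homotopic (φ : C(↥(cellSphere d), A)) (f g : C(attachSp φ, B))
    (F : C(I × A, B)) (G : C(I × ↥(cellBall d), B))
    (h : ∀ t x, F (t, φ x) = G (t, sphereIncl d x))
    (F0 : ∀ a, F (0, a) = f (attachBase φ a)) (F1 : ∀ a, F (1, a) = g (attachBase φ a))
    (G0 : ∀ y, G (0, y) = f (attachCell φ y)) (G1 : ∀ y, G (1, y) = g (attachCell φ y)) :
    f.Homotopic g := by
  let H : C(attachSp φ, C(I, B)) := attachDesc φ (F.comp ContinuousMap.prodSwap).curry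
    (G.comp ContinuousMap.prodSwap).curry (by
      intro x; ext t; exact h t x)
  refine ⟨⟨⟨fun p => H p.2 p.1, ?_⟩, ?_, ?_⟩⟩
  · have := H.uncurry.continuous
    exact this.comp continuous_swap
  · intro z
    refine attach_ind φ (P := fun z => H z 0 = f z) F0 G0 z
  · intro z
    refine attach_ind φ (P := fun z => H z 1 = g z) F1 G1 z

/-- Extension of a map of the ball over the whole space by a homotopy of its boundary values,
radially. -/
lemma exists_radial_ext (g : C(↥(cellBall d), B)) (k : C(I × ↥(cellSphere d), B))
    (h : ∀ x, k (0, x) = g (sphereIncl d x)) :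
    ∃ Λ : C(EuclideanSpace ℝ (Fin d), B), (∀ y : ↥(cellBall d), Λ y.1 = g y) ∧
      ∀ (t : I) (x : ↥(cellSphere d)), Λ ((1 + (t : ℝ)) • x.1) = k (t, x) := by
  classical
  let dir : {y : EuclideanSpace ℝ (Fin d) // 1 ≤ ‖y‖} → ↥(cellSphere d) := fun y =>
    ⟨‖y.1‖⁻¹ • y.1, by
      have : 0 < ‖y.1‖ := lt_of_lt_of_le one_pos y.2
      simp [cellSphere, norm_smul, this.ne']⟩
  have hdir : Continuous dir := by
    refine Continuous.subtype_mk (Continuous.smul (Continuous.inv₀ (continuous_subtype_val.norm) ?_)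
      continuous_subtype_val) _
    intro y
    exact (lt_of_lt_of_le one_pos y.2).ne'
  let outer : {y : EuclideanSpace ℝ (Fin d) // 1 ≤ ‖y‖} → B := fun y =>
    k (Set.projIcc 0 1 zero_le_one (‖y.1‖ - 1), dir y)
  have houter : Continuous outer := by
    refine k.continuous.comp (Continuous.prodMk ?_ hdir)
    exact continuous_projIcc.comp (by fun_prop)
  let Λ : EuclideanSpace ℝ (Fin d) → B := fun y =>
    if hy : ‖y‖ ≤ 1 then g ⟨y, by simpa [cellBall] using hy⟩ else outer ⟨y, (not_le.1 hy).le⟩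
  have hΛ1 : ∀ y (hy : ‖y‖ ≤ 1), Λ y = g ⟨y, by simpa [cellBall] using hy⟩ := fun y hy => by
    simp only [Λ, dif_pos hy]
  have hΛ2 : ∀ y (hy : 1 ≤ ‖y‖), Λ y = outer ⟨y, hy⟩ := fun y hy => by
    by_cases h1 : ‖y‖ ≤ 1
    · have h2 : ‖y‖ = 1 := le_antisymm h1 hy
      rw [hΛ1 y h1]
      have h3 : dir ⟨y, hy⟩ = ⟨y, by simpa [cellSphere] using h2⟩ := by
        apply Subtype.ext; simp [dir, h2]
      simp only [outer, h3, h2, sub_self, Set.projIcc_left]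
      exact (h ⟨y, by simpa [cellSphere] using h2⟩).symm
    · simp only [Λ, dif_neg h1]
  have hcont : Continuous Λ := by
    rw [← continuousOn_univ]
    have : (Set.univ : Set (EuclideanSpace ℝ (Fin d))) = {y | ‖y‖ ≤ 1} ∪ {y | 1 ≤ ‖y‖} := by
      ext y; simpa using le_total _ _
    rw [this]
    refine ContinuousOn.union_of_isClosed ?_ ?_ (isClosed_le (by fun_prop) (by fun_prop))
      (isClosed_le (by fun_prop) (by fun_prop))
    · rw [continuousOn_iff_continuous_domRestrict]
      have : Set.domRestrict {y | ‖y‖ ≤ 1} Λ = fun y : {y : EuclideanSpace ℝ (Fin d) | ‖y‖ ≤ 1} =>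
          g ⟨y.1, mem_closedBall_zero_iff.2 y.2⟩ := by
        ext y; exact hΛ1 y.1 y.2
      rw [this]; fun_prop
    · rw [continuousOn_iff_continuous_domRestrict]
      have : Set.domRestrict {y | 1 ≤ ‖y‖} Λ = outer := by
        ext y; exact hΛ2 y.1 y.2
      rw [this]; exact houter
  refine ⟨⟨Λ, hcont⟩, fun y => ?_, fun t x => ?_⟩
  · exact hΛ1 y.1 (by simpa [cellBall] using y.2)
  · have hx : ‖x.1‖ = 1 := by simpa [cellSphere] using x.2
    have ht : 0 ≤ (t : ℝ) := t.2.1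
    have hn : ‖(1 + (t : ℝ)) • x.1‖ = 1 + t := by
      rw [norm_smul, hx, mul_one, Real.norm_of_nonneg (by linarith)]
    have h1 : 1 ≤ ‖(1 + (t : ℝ)) • x.1‖ := by rw [hn]; linarith
    refine (hΛ2 _ h1).trans ?_
    have h3 : dir ⟨_, h1⟩ = x := by
      apply Subtype.ext
      simp only [dir, hn, smul_smul]
      rw [inv_mul_cancel₀ (by linarith), one_smul]
    simp only [outer, h3, hn, add_sub_cancel_left]
    congr 2
    exact Set.projIcc_of_mem _ t.2

/-- The map of attaching spaces induced by a map of the bases. -/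
def attachMap (u : C(A, A')) (φ : C(↥(cellSphere d), A)) : C(attachSp φ, attachSp (u.comp φ)) :=
  attachDesc φ ((attachBase _).comp u) (attachCell _) fun x =>
    (attachCell_sphere (u.comp φ) x).symm

lemma sphere_norm (x : ↥(cellSphere d)) : ‖x.1‖ = 1 := by simpa [cellSphere] using x.2

lemma ball_norm (x : ↥(cellBall d)) : ‖x.1‖ ≤ 1 := by simpa [cellBall] using x.2

lemma exists_attachExt (φ : C(↥(cellSphere d), A)) (k : C(I × ↥(cellSphere d), A))
    (h : ∀ x, k (0, x) = φ x) :
    ∃ Λ : C(EuclideanSpace ℝ (Fin d), attachSp φ), (∀ y : ↥(cellBall d), Λ y.1 = attachCell φ y) ∧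
      ∀ (t : I) (x : ↥(cellSphere d)), Λ ((1 + (t : ℝ)) • x.1) = attachBase φ (k (t, x)) :=
  exists_radial_ext (attachCell φ) ((attachBase φ).comp k) fun x => by
    simp [h, attachCell_sphere]

/-- Comparison of the attaching spaces of homotopic attaching maps. -/
lemma exists_attachCompare (φ₀ φ₁ : C(↥(cellSphere d), A)) (k : C(I × ↥(cellSphere d), A))
    (h0 : ∀ x, k (0, x) = φ₀ x) (h1 : ∀ x, k (1, x) = φ₁ x) :
    ∃ Λ : C(EuclideanSpace ℝ (Fin d), attachSp φ₀), ∃ J : C(attachSp φ₁, attachSp φ₀),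
      (∀ y : ↥(cellBall d), Λ y.1 = attachCell φ₀ y) ∧
      (∀ (t : I) (x : ↥(cellSphere d)), Λ ((1 + (t : ℝ)) • x.1) = attachBase φ₀ (k (t, x))) ∧
      (∀ a, J (attachBase φ₁ a) = attachBase φ₀ a) ∧
      (∀ y, J (attachCell φ₁ y) = Λ ((2 : ℝ) • y.1)) := by
  obtain ⟨Λ, hΛ1, hΛ2⟩ := exists_attachExt φ₀ k h0
  refine ⟨Λ, attachDesc φ₁ (attachBase φ₀) ⟨fun y => Λ ((2 : ℝ) • y.1), by fun_prop⟩ ?_,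
    hΛ1, hΛ2, fun a => rfl, fun y => rfl⟩
  intro x
  have := hΛ2 1 x
  rw [h1] at this
  rw [← this]
  simp only [ContinuousMap.coe_mk, sphereIncl]
  norm_num

lemma exists_polar (y : EuclideanSpace ℝ (Fin d)) (hy : y ≠ 0) :
    ∃ x : ↥(cellSphere d), y = ‖y‖ • x.1 := by
  have h : ‖y‖ ≠ 0 := norm_ne_zero_iff.2 hy
  refine ⟨⟨‖y‖⁻¹ • y, by simp [cellSphere, norm_smul, h]⟩, ?_⟩
  simp [smul_smul, h]

/-- Homotopic attaching maps give homotopy equivalent attaching spaces; one half. -/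
lemma attachCompare_left_inv {φ₀ φ₁ : C(↥(cellSphere d), A)} (k : C(I × ↥(cellSphere d), A))
    (Λ : C(EuclideanSpace ℝ (Fin d), attachSp φ₀)) (J : C(attachSp φ₁, attachSp φ₀))
    (hΛ1 : ∀ y : ↥(cellBall d), Λ y.1 = attachCell φ₀ y)
    (hΛ2 : ∀ (t : I) (x : ↥(cellSphere d)), Λ ((1 + (t : ℝ)) • x.1) = attachBase φ₀ (k (t, x)))
    (hJ1 : ∀ a, J (attachBase φ₁ a) = attachBase φ₀ a)
    (hJ2 : ∀ y, J (attachCell φ₁ y) = Λ ((2 : ℝ) • y.1))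
    (Λ' : C(EuclideanSpace ℝ (Fin d), attachSp φ₁)) (J' : C(attachSp φ₀, attachSp φ₁))
    (hΛ1' : ∀ y : ↥(cellBall d), Λ' y.1 = attachCell φ₁ y)
    (hΛ2' : ∀ (t : I) (x : ↥(cellSphere d)),
      Λ' ((1 + (t : ℝ)) • x.1) = attachBase φ₁ (k (σ t, x)))
    (hJ1' : ∀ a, J' (attachBase φ₀ a) = attachBase φ₁ a)
    (hJ2' : ∀ y, J' (attachCell φ₀ y) = Λ' ((2 : ℝ) • y.1)) :
    (J'.comp J).Homotopic (ContinuousMap.id _) := by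
  let m : ℝ → ℝ := fun r => (3 - 2 * max r (1 / 2)) / max r (1 / 2)
  have hm : Continuous m := by
    refine Continuous.div (by fun_prop) (by fun_prop) fun r => ?_
    have : (1 : ℝ) / 2 ≤ max r (1 / 2) := le_max_right _ _
    linarith
  refine attach_homotopic φ₁ _ _ ⟨fun p => attachBase φ₁ p.2, by fun_prop⟩
    ⟨fun p => Λ' (((1 - (p.1 : ℝ)) * m ‖p.2.1‖ + p.1) • p.2.1), by fun_prop⟩ ?_ ?_ ?_ ?_ ?_
  · intro t x
    have : m 1 = 1 := by norm_num [m]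
    simp only [ContinuousMap.coe_mk, sphereIncl, sphere_norm, this]
    rw [show (1 - (t : ℝ)) * 1 + t = 1 by ring, one_smul]
    rw [← attachCell_sphere, ← hΛ1']; rfl
  · intro a
    simp [hJ1, hJ1']
  · intro a
    simp
  · intro y
    simp only [ContinuousMap.coe_mk, ContinuousMap.comp_apply, hJ2, Set.Icc.coe_zero, sub_zero,
      one_mul, add_zero]
    by_cases hy : ‖y.1‖ ≤ 1 / 2
    · have hmem : (2 : ℝ) • y.1 ∈ cellBall d := by
        simp only [cellBall, mem_closedBall_zero_iff, norm_smul, Real.norm_ofNat]; linarith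
      have e1 := hΛ1 ⟨_, hmem⟩
      simp only at e1
      rw [e1, hJ2']
      simp only [m, max_eq_right hy, smul_smul]
      norm_num
    · have hy' : 1 / 2 ≤ ‖y.1‖ := (not_le.1 hy).le
      have hy0 : y.1 ≠ 0 := by
        intro h; rw [h, norm_zero] at hy'; norm_num at hy'
      obtain ⟨x, hx⟩ := exists_polar y.1 hy0
      have hb := ball_norm y
      have e1 := hΛ2 ⟨2 * ‖y.1‖ - 1, by linarith, by linarith⟩ x
      have e2 := hΛ2' ⟨2 - 2 * ‖y.1‖, by linarith, by linarith⟩ x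
      have e3 : (2 : ℝ) • y.1 = (1 + (2 * ‖y.1‖ - 1)) • x.1 := by
        conv_lhs => rw [hx]
        rw [smul_smul]; ring_nf
      have e4 : m ‖y.1‖ • y.1 = (1 + (2 - 2 * ‖y.1‖)) • x.1 := by
        simp only [m, max_eq_left hy']
        conv_lhs => rw [hx]
        rw [norm_smul, sphere_norm, norm_norm, mul_one, smul_smul, div_mul_cancel₀]
        · ring_nf
        · exact norm_ne_zero_iff.2 hy0
      simp only at e1 e2
      rw [e3, e4, e1, hJ1', e2]
      congr 3
      apply Subtype.ext
      simp; ring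
  · intro y
    simp [← hΛ1']

lemma attachMap_left_inv (φ : C(↥(cellSphere d), A)) (u : C(A, A')) (v : C(A', A))
    (k : C(I × A, A)) (k0 : ∀ a, k (0, a) = a) (k1 : ∀ a, k (1, a) = v (u a))
    (Λ : C(EuclideanSpace ℝ (Fin d), attachSp φ))
    (J : C(attachSp (v.comp (u.comp φ)), attachSp φ))
    (hΛ1 : ∀ y : ↥(cellBall d), Λ y.1 = attachCell φ y)
    (hΛ2 : ∀ (t : I) (x : ↥(cellSphere d)),
      Λ ((1 + (t : ℝ)) • x.1) = attachBase φ (k (t, φ x)))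
    (hJ1 : ∀ a, J (attachBase _ a) = attachBase φ a)
    (hJ2 : ∀ y, J (attachCell _ y) = Λ ((2 : ℝ) • y.1)) :
    ((J.comp (attachMap v (u.comp φ))).comp (attachMap u φ)).Homotopic (ContinuousMap.id _) := by
  refine attach_homotopic φ _ _ ⟨fun p => attachBase φ (k (σ p.1, p.2)), by fun_prop⟩
    ⟨fun p => Λ ((2 - (p.1 : ℝ)) • p.2.1), by fun_prop⟩ ?_ ?_ ?_ ?_ ?_
  · intro t x
    have := hΛ2 (σ t) x
    simp only [ContinuousMap.coe_mk, sphereIncl]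
    rw [← this, unitInterval.coe_symm_eq]
    congr 2; ring
  · intro a
    simp only [ContinuousMap.coe_mk, unitInterval.symm_zero, k1]
    exact (hJ1 _).symm
  · intro a
    simp [k0]
  · intro y
    simp only [ContinuousMap.coe_mk, Set.Icc.coe_zero, sub_zero]
    exact (hJ2 _).symm
  · intro y
    simp only [ContinuousMap.coe_mk, Set.Icc.coe_one, ContinuousMap.id_apply]
    rw [← hΛ1]; norm_num

/-- Attaching a cell is compatible with homotopy equivalences of the base. -/
lemma attachMap_homotopyEquiv (φ : C(↥(cellSphere d), A)) (e : ContinuousMap.HomotopyEquiv A A') :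
    Nonempty (ContinuousMap.HomotopyEquiv (attachSp φ) (attachSp (e.toFun.comp φ))) := by
  -- left inverses
  have key : ∀ {C C' : Type} [TopologicalSpace C] [TopologicalSpace C'] (u : C(C, C'))
      (v : C(C', C)), (v.comp u).Homotopic (ContinuousMap.id _) → ∀ φ : C(↥(cellSphere d), C),
      ∃ (J : C(attachSp (v.comp (u.comp φ)), attachSp φ))
        (J' : C(attachSp φ, attachSp (v.comp (u.comp φ)))),
        ((J.comp (attachMap v (u.comp φ))).comp (attachMap u φ)).Homotopic (ContinuousMap.id _) ∧
        (J'.comp J).Homotopic (ContinuousMap.id _) := by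
    intro C C' _ _ u v h φ
    obtain ⟨h⟩ := h
    let k : C(I × C, C) := h.symm.toContinuousMap
    have k0 : ∀ a, k (0, a) = a := fun a => h.symm.apply_zero a
    have k1 : ∀ a, k (1, a) = v (u a) := fun a => h.symm.apply_one a
    obtain ⟨Λ, J, a1, a2, a3, a4⟩ := exists_attachCompare φ (v.comp (u.comp φ))
      ⟨fun p => k (p.1, φ p.2), by fun_prop⟩ (fun x => k0 _) (fun x => k1 _)
    obtain ⟨Λ', J', b1, b2, b3, b4⟩ := exists_attachCompare (v.comp (u.comp φ)) φ
      ⟨fun p => k (σ p.1, φ p.2), by fun_prop⟩ (fun x => by simp [k1]) (fun x => by simp [k0])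
    refine ⟨J, J', attachMap_left_inv φ u v k k0 k1 Λ J a1 a2 a3 a4, ?_⟩
    exact attachCompare_left_inv _ Λ J a1 a2 a3 a4 Λ' J' b1 b2 b3 b4
  obtain ⟨J, J', h1, h2⟩ := key e.toFun e.invFun e.left_inv φ
  obtain ⟨J₂, -, h3, -⟩ := key e.invFun e.toFun e.right_inv (e.toFun.comp φ)
  set U := attachMap e.toFun φ
  set V := attachMap e.invFun (e.toFun.comp φ)
  set W := J₂.comp (attachMap e.toFun (e.invFun.comp (e.toFun.comp φ)))
  refine ⟨⟨U, J.comp V, h1, ?_⟩⟩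
  -- `g = J ∘ V` has the left inverse `W ∘ J'`
  have hg : ((W.comp J').comp (J.comp V)).Homotopic (ContinuousMap.id _) := by
    have a : (W.comp ((J'.comp J).comp V)).Homotopic (W.comp ((ContinuousMap.id _).comp V)) :=
      ContinuousMap.Homotopic.comp (ContinuousMap.Homotopic.refl _)
        (ContinuousMap.Homotopic.comp h2 (ContinuousMap.Homotopic.refl _))
    exact a.trans h3
  -- hence `U ∘ g ≃ id`
  have a1 : (((W.comp J').comp (J.comp V)).comp (U.comp (J.comp V))).Homotopic
      ((ContinuousMap.id _).comp (U.comp (J.comp V))) :=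
    ContinuousMap.Homotopic.comp hg (ContinuousMap.Homotopic.refl _)
  have a2 : ((W.comp J').comp (((J.comp V).comp U).comp (J.comp V))).Homotopic
      ((W.comp J').comp ((ContinuousMap.id _).comp (J.comp V))) :=
    ContinuousMap.Homotopic.comp (ContinuousMap.Homotopic.refl _)
      (ContinuousMap.Homotopic.comp h1 (ContinuousMap.Homotopic.refl _))
  exact (a1.symm.trans a2).trans hg

end Attach

/-! ### Spaces with finitely many cells attached -/

lemma attachedCells_homotopy_invariant (L : List ℕ) : ∀ {A A' Z : TopCat.{0}},
    AttachedCells A Z L → ContinuousMap.HomotopyEquiv ↑A ↑A' →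
    ∃ Z' : TopCat.{0}, AttachedCells A' Z' L ∧
      Nonempty (ContinuousMap.HomotopyEquiv ↑Z ↑Z') := by
  induction L with
  | nil =>
    rintro A A' Z ⟨h⟩ e
    exact ⟨A', ⟨Homeomorph.refl _⟩, ⟨h.symm.toHomotopyEquiv.trans e⟩⟩
  | cons d L ih =>
    rintro A A' Z ⟨B, ⟨φ, ⟨hφ⟩⟩, hB⟩ e
    obtain ⟨E⟩ := attachMap_homotopyEquiv φ e
    obtain ⟨Z', h1, h2⟩ := ih (A' := TopCat.of (attachSp (e.toFun.comp φ))) hB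
      (hφ.toHomotopyEquiv.trans E)
    exact ⟨Z', ⟨_, ⟨_, ⟨Homeomorph.refl _⟩⟩, h1⟩, h2⟩

lemma attachedCells_append (L L' : List ℕ) : ∀ {A Z Z' : TopCat.{0}},
    AttachedCells A Z L → AttachedCells Z Z' L' → AttachedCells A Z' (L ++ L') := by
  induction L with
  | nil =>
    rintro A Z Z' ⟨h⟩ h'
    cases L' with
    | nil =>
      obtain ⟨h'⟩ := h'
      exact ⟨h.trans h'⟩
    | cons d L' =>
      obtain ⟨B, ⟨φ, ⟨hφ⟩⟩, hB⟩ := h'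
      refine ⟨B, ⟨(⟨h.symm, by fun_prop⟩ : C(↑Z, ↑A)).comp φ, ⟨hφ.trans ?_⟩⟩, hB⟩
      exact
      { toFun := attachMap _ φ
        invFun := attachDesc _ ((attachBase φ).comp ⟨h, by fun_prop⟩) (attachCell φ) (by
          intro x; simp [attachCell_sphere])
        left_inv := fun z => attach_ind φ (P := fun z => attachDesc _ _ _ _ (attachMap _ φ z) = z)
          (fun a => by simp [attachMap]) (fun y => by simp [attachMap]) z
        right_inv := fun z => attach_ind _ (P := fun z => attachMap _ φ (attachDesc _ _ _ _ z) = z)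
          (fun a => by simp [attachMap]) (fun y => by simp [attachMap]) z }
  | cons d L ih =>
    rintro A Z Z' ⟨B, h, hB⟩ hZ
    exact ⟨B, h, ih hB hZ⟩

/-! ### Recognizing attached cells -/

section Recognize

variable {d : ℕ} {A Y : Type} [TopologicalSpace A] [TopologicalSpace Y]

instance compactSpace_cellBall (d : ℕ) : CompactSpace ↥(cellBall d) :=
  isCompact_iff_compactSpace.1 (isCompact_closedBall _ _)

instance compactSpace_cellSphere (d : ℕ) : CompactSpace ↥(cellSphere d) :=
  isCompact_iff_compactSpace.1 (isCompact_sphere _ _)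

lemma attach_homeo (i : C(A, Y)) (χ : C(↥(cellBall d), Y)) (φ : C(↥(cellSphere d), A))
    (hq : Topology.IsQuotientMap (Sum.elim i χ)) (hi : Function.Injective i)
    (hφ : ∀ x, i (φ x) = χ (sphereIncl d x))
    (hinj : ∀ y y' : ↥(cellBall d), ‖y.1‖ ≠ 1 → χ y = χ y' → y = y')
    (hdisj : ∀ (a : A) (y : ↥(cellBall d)), ‖y.1‖ ≠ 1 → i a ≠ χ y) :
    Nonempty (Y ≃ₜ attachSp φ) := by
  let f : C(attachSp φ, Y) := attachDesc φ i χ hφ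
  have hfq : Topology.IsQuotientMap f :=
    Topology.IsQuotientMap.of_comp (f := (Quot.mk (attachRel φ))) continuous_quot_mk
      f.continuous (by
        convert hq using 1
        funext z; cases z <;> rfl)
  have hbd : ∀ y : ↥(cellBall d), ‖y.1‖ = 1 → ∃ a, attachCell φ y = attachBase φ a := fun y hy =>
    ⟨φ ⟨y.1, by simpa [cellSphere] using hy⟩, attachCell_sphere φ ⟨y.1, _⟩⟩
  have hcb : ∀ (y : ↥(cellBall d)) (z : attachSp φ), ‖y.1‖ ≠ 1 → f (attachCell φ y) = f z →
      attachCell φ y = z := by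
    intro y z hy
    refine attach_ind φ (P := fun z => f (attachCell φ y) = f z → attachCell φ y = z) ?_ ?_ z
    · intro a h
      exact absurd h.symm (hdisj a y hy)
    · intro y' h
      rw [hinj y y' hy h]
  have hfi : Function.Injective f := by
    intro z z'
    refine attach_ind φ (P := fun z => f z = f z' → z = z') ?_ ?_ z
    · intro a
      refine attach_ind φ (P := fun z' => f (attachBase φ a) = f z' → attachBase φ a = z') ?_ ?_ z'
      · intro a' h
        rw [hi h]
      · intro y h
        by_cases hy : ‖y.1‖ = 1
        · obtain ⟨a', ha'⟩ := hbd y hy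
          rw [ha'] at h ⊢
          rw [hi h]
        · exact (hcb y _ hy h.symm).symm
    · intro y h
      by_cases hy : ‖y.1‖ = 1
      · obtain ⟨a, ha⟩ := hbd y hy
        rw [ha] at h ⊢
        revert h
        refine attach_ind φ (P := fun z' => f (attachBase φ a) = f z' → attachBase φ a = z')
          ?_ ?_ z'
        · intro a' h
          rw [hi h]
        · intro y h
          by_cases hy : ‖y.1‖ = 1
          · obtain ⟨a', ha'⟩ := hbd y hy
            rw [ha'] at h ⊢
            rw [hi h]
          · exact (hcb y _ hy h.symm).symm
      · exact hcb y _ hy h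
  have hopen : IsOpenMap f := fun U hU => by
    rw [← hfq.isOpen_preimage, Set.preimage_image_eq _ hfi]; exact hU
  exact ⟨((Equiv.ofBijective f ⟨hfi, hfq.surjective⟩).toHomeomorphOfContinuousOpen
    f.continuous hopen).symm⟩

/-- A closed set together with a cell glued to it along the boundary sphere. -/
lemma attachOneCell_of_closed [T2Space Y] (A : Set Y) (hA : IsClosed A) (χ : C(↥(cellBall d), Y))
    (hmem : ∀ y, χ y ∈ A ↔ ‖y.1‖ = 1)
    (hinj : ∀ y y' : ↥(cellBall d), ‖y.1‖ ≠ 1 → χ y = χ y' → y = y') :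
    AttachOneCell (TopCat.of ↥A) (TopCat.of ↥(A ∪ Set.range χ)) d := by
  let i : C(↥A, ↥(A ∪ Set.range χ)) := ⟨fun a => ⟨a.1, Or.inl a.2⟩, by fun_prop⟩
  let χ' : C(↥(cellBall d), ↥(A ∪ Set.range χ)) := ⟨fun a => ⟨χ a, Or.inr ⟨a, rfl⟩⟩, by fun_prop⟩
  let φ : C(↥(cellSphere d), ↥A) :=
    ⟨fun x => ⟨χ (sphereIncl d x), (hmem _).2 (sphere_norm x)⟩, by fun_prop⟩
  refine ⟨φ, attach_homeo i χ' φ ?_ ?_ ?_ ?_ ?_⟩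
  · refine IsClosedMap.isQuotientMap (IsClosedMap.sumElim ?_ ?_) ?_ ?_
    · exact hA.isClosedMap_inclusion Set.subset_union_left
    · exact χ'.continuous.isClosedMap
    · exact continuous_sumElim.2 ⟨i.continuous, χ'.continuous⟩
    · rintro ⟨z, hz | ⟨y, rfl⟩⟩
      · exact ⟨Sum.inl ⟨z, hz⟩, rfl⟩
      · exact ⟨Sum.inr y, rfl⟩
  · intro a a' h
    exact Subtype.ext (congrArg (fun z => z.1) h)
  · intro x; rfl
  · intro y y' hy h
    exact hinj y y' hy (congrArg (fun z => z.1) h)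
  · intro a y hy h
    have : a.1 = χ y := congrArg (fun z => z.1) h
    exact hy ((hmem y).1 (this ▸ a.2))

lemma attachedCells_of_closed [T2Space Y] (A : Set Y) (hA : IsClosed A) (k : ℕ) :
    ∀ χ : Fin k → C(↥(cellBall d), Y), (∀ s y, χ s y ∈ A ↔ ‖y.1‖ = 1) →
    (∀ s s' (y y' : ↥(cellBall d)), ‖y.1‖ ≠ 1 → χ s y = χ s' y' → s = s' ∧ y = y') →
    AttachedCells (TopCat.of ↥A) (TopCat.of ↥(A ∪ ⋃ s, Set.range (χ s)))
      (List.replicate k d) := by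
  induction k with
  | zero =>
    intro χ _ _
    exact ⟨Homeomorph.setCongr (by simp)⟩
  | succ k ih =>
    intro χ h1 h2
    have h3 := ih (fun s => χ s.castSucc) (fun s => h1 _)
      (fun s s' y y' hy h => ⟨Fin.castSucc_injective _ (h2 _ _ y y' hy h).1, (h2 _ _ y y' hy h).2⟩)
    rw [List.replicate_succ']
    refine attachedCells_append _ _ h3 ?_
    have h4 : A ∪ ⋃ s, Set.range (χ s) =
      (A ∪ ⋃ s : Fin k, Set.range (χ s.castSucc)) ∪ Set.range (χ (Fin.last k)) := by
      ext z; simp [Fin.exists_fin_succ', or_assoc]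
    rw [h4]
    refine ⟨_, attachOneCell_of_closed _ ?_ (χ (Fin.last k)) ?_ ?_, ⟨Homeomorph.refl _⟩⟩
    · refine hA.union (isClosed_iUnion_of_finite fun s => ?_)
      exact (isCompact_range (χ s.castSucc).continuous).isClosed
    · intro y
      refine ⟨?_, fun h => Or.inl ((h1 _ y).2 h)⟩
      rintro (h | h)
      · exact (h1 _ y).1 h
      · by_contra hy
        obtain ⟨s, y', h⟩ := Set.mem_iUnion.1 h
        exact (Fin.castSucc_lt_last s).ne' (h2 _ _ y y' hy h.symm).1
    · exact fun y y' hy h => (h2 _ _ y y' hy h).2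

end Recognize

/-! ### Finite cell complexes are compact Hausdorff -/

section CompactT2

variable {d : ℕ} {A : Type} [TopologicalSpace A]

lemma t2Space_of_isClosedMap {X Y : Type} [TopologicalSpace X] [TopologicalSpace Y]
    [CompactSpace X] [T2Space X] (f : X → Y) (hf : Continuous f) (hc : IsClosedMap f)
    (hs : Function.Surjective f) : T2Space Y := by
  have hsing : ∀ y, IsClosed ({y} : Set Y) := by
    intro y
    obtain ⟨x, rfl⟩ := hs y
    simpa using hc _ (isClosed_singleton (x := x))
  refine ⟨fun y y' hy => ?_⟩
  obtain ⟨U, V, hU, hV, hyU, hyV, hUV⟩ := normal_separation ((hsing y).preimage hf)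
    ((hsing y').preimage hf) (Disjoint.preimage f (by simpa using hy))
  refine ⟨(f '' Uᶜ)ᶜ, (f '' Vᶜ)ᶜ, (hc _ hU.isClosed_compl).isOpen_compl,
    (hc _ hV.isClosed_compl).isOpen_compl, ?_, ?_, ?_⟩
  · rintro ⟨x, hx, rfl⟩; exact hx (hyU rfl)
  · rintro ⟨x, hx, rfl⟩; exact hx (hyV rfl)
  · rw [Set.disjoint_left]
    intro z hz hz'
    obtain ⟨x, rfl⟩ := hs z
    have h1 : x ∈ U := by by_contra h; exact hz ⟨x, h, rfl⟩
    have h2 : x ∈ V := by by_contra h; exact hz' ⟨x, h, rfl⟩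
    exact Set.disjoint_left.1 hUV h1 h2

open Classical in
/-- A normal form for points of the attaching space. -/
def attachCode (φ : C(↥(cellSphere d), A)) : attachSp φ → A ⊕ ↥(cellBall d) :=
  Quot.lift (Sum.elim Sum.inl fun y => if h : ‖y.1‖ = 1 then
    Sum.inl (φ ⟨y.1, by simpa [cellSphere] using h⟩) else Sum.inr y) (by
      rintro _ _ ⟨x, rfl, rfl⟩
      have := sphere_norm x
      simp [this])

lemma attachBase_injective (φ : C(↥(cellSphere d), A)) : Function.Injective (attachBase φ) := by
  intro a a' h
  exact Sum.inl_injective (congrArg (attachCode φ) h)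

lemma attachCell_code (φ : C(↥(cellSphere d), A)) (y : ↥(cellBall d)) (h : ‖y.1‖ ≠ 1) :
    attachCode φ (attachCell φ y) = Sum.inr y := dif_neg h

lemma attachBase_ne_cell (φ : C(↥(cellSphere d), A)) (a : A) (y : ↥(cellBall d))
    (h : ‖y.1‖ ≠ 1) : attachBase φ a ≠ attachCell φ y := by
  intro h'
  have := congrArg (attachCode φ) h'
  rw [attachCell_code φ y h] at this
  exact Sum.inl_ne_inr (show Sum.inl a = Sum.inr y from this)

lemma attachCell_mem_range_base (φ : C(↥(cellSphere d), A)) (y : ↥(cellBall d)) :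
    attachCell φ y ∈ Set.range (attachBase φ) ↔ ‖y.1‖ = 1 := by
  constructor
  · rintro ⟨a, ha⟩
    by_contra h
    exact attachBase_ne_cell φ a y h ha
  · intro h
    exact ⟨_, (attachCell_sphere φ ⟨y.1, by simpa [cellSphere] using h⟩).symm⟩

lemma attachCell_inj (φ : C(↥(cellSphere d), A)) (y y' : ↥(cellBall d)) (h : ‖y.1‖ ≠ 1)
    (hy : attachCell φ y = attachCell φ y') : y = y' := by
  by_cases h' : ‖y'.1‖ = 1
  · exact absurd ((attachCell_mem_range_base φ y).1 (hy ▸ (attachCell_mem_range_base φ y').2 h')) h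
  · have := congrArg (attachCode φ) hy
    rw [attachCell_code φ y h, attachCell_code φ y' h'] at this
    exact Sum.inr_injective this

instance [CompactSpace A] (φ : C(↥(cellSphere d), A)) : CompactSpace (attachSp φ) :=
  inferInstanceAs (CompactSpace (Quot _))

lemma t2Space_attachSp [CompactSpace A] [T2Space A] (φ : C(↥(cellSphere d), A)) :
    T2Space (attachSp φ) := by
  refine t2Space_of_isClosedMap (Sum.elim (attachBase φ) (attachCell φ))
    (continuous_sumElim.2 ⟨(attachBase φ).continuous, (attachCell φ).continuous⟩) ?_ ?_
  · have hclosed : ∀ C : Set (attachSp φ), IsClosed (attachBase φ ⁻¹' C) →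
        IsClosed (attachCell φ ⁻¹' C) → IsClosed C := by
      intro C h1 h2
      have hq : Topology.IsQuotientMap (Quot.mk (attachRel φ)) := isQuotientMap_quot_mk
      exact hq.isClosed_preimage.1 (isClosed_sum_iff.2 ⟨h1, h2⟩)
    have hbase : IsClosedMap (attachBase φ) := by
      intro C hC
      refine hclosed _ ?_ ?_
      · rwa [Set.preimage_image_eq _ (attachBase_injective φ)]
      · have : attachCell φ ⁻¹' (attachBase φ '' C) = sphereIncl d '' (φ ⁻¹' C) := by
          ext y
          constructor
          · rintro ⟨a, ha, h⟩
            have hy := (attachCell_mem_range_base φ y).1 ⟨a, h⟩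
            refine ⟨⟨y.1, by simpa [cellSphere] using hy⟩, ?_, rfl⟩
            have := attachCell_sphere φ ⟨y.1, by simpa [cellSphere] using hy⟩
            rw [Set.mem_preimage, ← attachBase_injective φ (h.trans this)]
            exact ha
          · rintro ⟨x, hx, rfl⟩
            exact ⟨φ x, hx, (attachCell_sphere φ x).symm⟩
        rw [this]
        exact (sphereIncl d).continuous.isClosedMap _ (hC.preimage φ.continuous)
    refine IsClosedMap.sumElim hbase ?_
    intro C hC
    have hS : IsClosed (φ '' (sphereIncl d ⁻¹' C)) :=
      φ.continuous.isClosedMap _ (hC.preimage (sphereIncl d).continuous)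
    refine hclosed _ ?_ ?_
    · convert hS using 1
      ext a
      constructor
      · rintro ⟨y, hy, h⟩
        have hy1 := (attachCell_mem_range_base φ y).1 ⟨a, h.symm⟩
        have := attachCell_sphere φ ⟨y.1, by simpa [cellSphere] using hy1⟩
        exact ⟨⟨y.1, by simpa [cellSphere] using hy1⟩, hy, attachBase_injective φ (this.symm.trans h)⟩
      · rintro ⟨x, hx, rfl⟩
        exact ⟨_, hx, attachCell_sphere φ x⟩
    · have : attachCell φ ⁻¹' (attachCell φ '' C) =
          C ∪ attachCell φ ⁻¹' (attachBase φ '' (φ '' (sphereIncl d ⁻¹' C))) := by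
        ext y
        constructor
        · rintro ⟨y', hy', h⟩
          by_cases h1 : ‖y'.1‖ = 1
          · right
            have := attachCell_sphere φ ⟨y'.1, by simpa [cellSphere] using h1⟩
            exact ⟨_, ⟨⟨y'.1, by simpa [cellSphere] using h1⟩, hy', rfl⟩, this.symm.trans h⟩
          · left
            rw [← attachCell_inj φ y' y h1 h]; exact hy'
        · rintro (h | ⟨_, ⟨x, hx, rfl⟩, h⟩)
          · exact ⟨y, h, rfl⟩
          · exact ⟨_, hx, (attachCell_sphere φ x).trans h⟩
      rw [this]
      exact hC.union ((hbase _ hS).preimage (attachCell φ).continuous)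
  · intro z
    exact attach_ind φ (P := fun z => ∃ w, Sum.elim (attachBase φ) (attachCell φ) w = z)
      (fun a => ⟨Sum.inl a, rfl⟩) (fun y => ⟨Sum.inr y, rfl⟩) z

end CompactT2

/-! ### The product of a finite cell complex with the circle -/

section TimesCircle

/-- A homeomorphism from the `(d+1)`-ball to the cylinder over the `d`-ball. -/
lemma exists_ball_cylinder (d : ℕ) :
    ∃ f : C(↥(cellBall (d + 1)), ↥(cellBall d) × unitInterval), Function.Bijective f ∧
      ∀ z, ‖z.1‖ = 1 ↔ (‖(f z).1.1‖ = 1 ∨ (f z).2 = 0 ∨ (f z).2 = 1) := by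
  have L : EuclideanSpace ℝ (Fin (d + 1)) ≃L[ℝ] EuclideanSpace ℝ (Fin d) × ℝ :=
    ContinuousLinearEquiv.ofFinrankEq (by simp)
  obtain ⟨s, hs⟩ : ∃ s : Set (EuclideanSpace ℝ (Fin (d + 1))),
    s = L.toHomeomorph ⁻¹' (Metric.closedBall 0 1 ×ˢ Set.Icc 0 1) := ⟨_, rfl⟩
  have hsc : IsClosed s := by
    rw [hs]
    exact (Metric.isClosed_closedBall.prod isClosed_Icc).preimage L.toHomeomorph.continuous
  have h_interior : interior s = L.toHomeomorph ⁻¹' (Metric.ball 0 1 ×ˢ Set.Ioo 0 1) := by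
    rw [hs, ← Homeomorph.preimage_interior, interior_prod_eq, interior_closedBall _ one_ne_zero,
      interior_Icc]
  have hcompact : IsCompact s := by
    rw [hs, L.toHomeomorph.isCompact_preimage]
    exact (isCompact_closedBall _ _).prod isCompact_Icc
  have hconv : Convex ℝ s := by
    have : Convex ℝ (Metric.closedBall (0 : EuclideanSpace ℝ (Fin d)) 1 ×ˢ Set.Icc (0 : ℝ) 1) :=
      (convex_closedBall _ _).prod (convex_Icc _ _)
    rw [hs]
    exact this.linear_preimage L.toLinearEquiv.toLinearMap
  have hne : (interior s).Nonempty := by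
    refine ⟨L.symm (0, 1 / 2), ?_⟩
    rw [h_interior]
    simp only [Set.mem_preimage, ContinuousLinearEquiv.coe_toHomeomorph,
      ContinuousLinearEquiv.apply_symm_apply]
    exact ⟨Metric.mem_ball_self one_pos, by norm_num, by norm_num⟩
  have hbdd := hcompact.isBounded
  obtain ⟨h, hi, hc, hf⟩ :=
    exists_homeomorph_image_interior_closure_frontier_eq_unitBall hconv hne hbdd
  rw [hsc.closure_eq] at hc
  have hmem : ∀ z : ↥(cellBall (d + 1)), h.symm z.1 ∈ s := by
    intro z
    have : z.1 ∈ h '' s := by rw [hc]; exact z.2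
    obtain ⟨w, hw, hwz⟩ := this
    rw [← hwz]; simpa using hw
  have hs' : ∀ w, w ∈ s ↔ ‖(L w).1‖ ≤ 1 ∧ 0 ≤ (L w).2 ∧ (L w).2 ≤ 1 := fun w => by
    rw [hs]; simp
  have h_interior_iff : ∀ w, w ∈ interior s ↔ ‖(L w).1‖ < 1 ∧ 0 < (L w).2 ∧ (L w).2 < 1 := fun w => by
    rw [h_interior]; simp
  clear hs h_interior hf
  refine ⟨⟨fun z => (⟨(L (h.symm z.1)).1, mem_closedBall_zero_iff.2 ((hs' _).1 (hmem z)).1⟩,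
    ⟨(L (h.symm z.1)).2, ((hs' _).1 (hmem z)).2⟩),
    by fun_prop⟩, ⟨?_, ?_⟩, ?_⟩
  · intro z z' hz
    simp only [ContinuousMap.coe_mk, Prod.mk.injEq] at hz
    exact Subtype.ext (h.symm.injective (L.injective (Prod.ext (congrArg Subtype.val hz.1)
      (congrArg Subtype.val hz.2))))
  · rintro ⟨y, t⟩
    have h1 : L.symm (y.1, t.1) ∈ s := by
      rw [hs']
      simpa using ⟨ball_norm y, t.2⟩
    have h2 : h (L.symm (y.1, t.1)) ∈ Metric.closedBall (0 : EuclideanSpace ℝ (Fin (d + 1))) 1 := by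
      rw [← hc]; exact ⟨_, h1, rfl⟩
    refine ⟨⟨_, h2⟩, ?_⟩
    simp
  · intro z
    have e1 : ‖z.1‖ = 1 ↔ h.symm z.1 ∉ interior s := by
      have : h.symm z.1 ∈ interior s ↔ z.1 ∈ Metric.ball (0 : EuclideanSpace ℝ (Fin (d + 1))) 1 := by
        rw [← hi]
        constructor
        · intro hz; exact ⟨_, hz, by simp⟩
        · rintro ⟨w, hw, hwz⟩; rw [← hwz]; simpa using hw
      rw [this, mem_ball_zero_iff, not_lt]
      exact ⟨fun h => h.ge, fun h => le_antisymm (ball_norm z) h⟩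
    have b1 := (hs' _).1 (hmem z)
    rw [e1, h_interior_iff]
    simp only [ContinuousMap.coe_mk, ← Subtype.coe_inj, Set.Icc.coe_zero, Set.Icc.coe_one]
    constructor
    · intro h
      by_contra! h'
      exact h ⟨lt_of_le_of_ne b1.1 h'.1, lt_of_le_of_ne b1.2.1 (Ne.symm h'.2.1),
        lt_of_le_of_ne b1.2.2 h'.2.2⟩
    · rintro (h | h | h) ⟨h1, h2, h3⟩ <;> linarith

lemma circle_exp_param : ∀ t t' : unitInterval, t ≠ 0 → t ≠ 1 →
    Circle.exp (2 * Real.pi * t) = Circle.exp (2 * Real.pi * t') → t = t' := by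
  intro t t' h0 h1 h
  rw [Circle.exp_eq_exp] at h
  obtain ⟨m, hm⟩ := h
  have hpi := Real.pi_pos
  have e : (t : ℝ) = t' + m := by
    have : 2 * Real.pi * (t : ℝ) = 2 * Real.pi * (t' + m) := by rw [hm]; ring
    exact mul_left_cancel₀ (by positivity) this
  have t0 : 0 < (t : ℝ) := lt_of_le_of_ne t.2.1 (fun h => h0 (Subtype.ext h.symm))
  have t1 : (t : ℝ) < 1 := lt_of_le_of_ne t.2.2 (fun h => h1 (Subtype.ext h))
  have a0 := t'.2.1
  have a1 := t'.2.2
  have m0 : (m : ℝ) < 1 := by linarith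
  have m1 : (-1 : ℝ) < m := by linarith
  have : m = 0 := by
    have h1 : m < 1 := by exact_mod_cast m0
    have h2 : -1 < m := by exact_mod_cast m1
    omega
  rw [this] at e
  exact Subtype.ext (by simpa using e)

lemma attachSp_prod_circle {d : ℕ} {A : Type} [TopologicalSpace A] [CompactSpace A] [T2Space A]
    (φ : C(↥(cellSphere d), A)) :
    AttachedCells (TopCat.of (A × Circle)) (TopCat.of (attachSp φ × Circle)) [d, d + 1] := by
  have := t2Space_attachSp φ
  let i : A × Circle → attachSp φ × Circle := Prod.map (attachBase φ) id
  have hi : Topology.IsClosedEmbedding i := by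
    refine Continuous.isClosedEmbedding (by fun_prop) ?_
    exact (attachBase_injective φ).prodMap Function.injective_id
  have hir : Set.range i = Set.range (attachBase φ) ×ˢ Set.univ := by
    simp [i, Set.range_prodMap]
  let χ₁ : C(↥(cellBall d), attachSp φ × Circle) := ⟨fun y => (attachCell φ y, 1), by fun_prop⟩
  obtain ⟨f, hf, hfb⟩ := exists_ball_cylinder d
  let χ₂ : C(↥(cellBall (d + 1)), attachSp φ × Circle) :=
    ⟨fun z => (attachCell φ (f z).1, Circle.exp (2 * Real.pi * (f z).2)), by fun_prop⟩
  have s1 : AttachOneCell (TopCat.of ↥(Set.range i)) (TopCat.of ↥(Set.range i ∪ Set.range χ₁)) d := by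
    refine attachOneCell_of_closed _ hi.isClosed_range χ₁ ?_ ?_
    · intro y
      rw [hir]
      simpa [χ₁] using attachCell_mem_range_base φ y
    · intro y y' hy h
      exact attachCell_inj φ y y' hy (congrArg Prod.fst h)
  have s2 : AttachOneCell (TopCat.of ↥(Set.range i ∪ Set.range χ₁))
      (TopCat.of ↥((Set.range i ∪ Set.range χ₁) ∪ Set.range χ₂)) (d + 1) := by
    refine attachOneCell_of_closed _ ?_ χ₂ ?_ ?_
    · exact hi.isClosed_range.union (isCompact_range χ₁.continuous).isClosed
    · intro z
      rw [hfb, Set.mem_union, hir]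
      constructor
      · rintro (⟨h, -⟩ | ⟨y, h⟩)
        · exact Or.inl ((attachCell_mem_range_base φ _).1 h)
        · right
          by_contra! hne
          have h2 : Circle.exp (2 * Real.pi * (f z).2) =
              Circle.exp (2 * Real.pi * (0 : unitInterval)) := by
            have := congrArg Prod.snd h
            simp only [χ₁, χ₂, ContinuousMap.coe_mk] at this
            rw [← this]; simp
          exact hne.1 (circle_exp_param _ _ hne.1 hne.2 h2)
      · rintro (h | h | h)
        · exact Or.inl ⟨(attachCell_mem_range_base φ _).2 h, trivial⟩
        · right
          exact ⟨(f z).1, by simp [χ₁, χ₂, h]⟩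
        · right
          exact ⟨(f z).1, by simp [χ₁, χ₂, h]⟩
    · intro z z' hz h
      have hz' : ¬ (‖(f z).1.1‖ = 1 ∨ (f z).2 = 0 ∨ (f z).2 = 1) := fun h => hz ((hfb z).2 h)
      push Not at hz'
      refine hf.1 (Prod.ext ?_ ?_)
      · exact attachCell_inj φ _ _ hz'.1 (congrArg Prod.fst h)
      · exact circle_exp_param _ _ hz'.2.1 hz'.2.2 (congrArg Prod.snd h)
  have s3 : (Set.range i ∪ Set.range χ₁) ∪ Set.range χ₂ = Set.univ := by
    rw [Set.eq_univ_iff_forall]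
    rintro ⟨z, u⟩
    refine attach_ind φ (P := fun z => (z, u) ∈ (Set.range i ∪ Set.range χ₁) ∪ Set.range χ₂) ?_ ?_ z
    · intro a
      exact Or.inl (Or.inl ⟨(a, u), rfl⟩)
    · intro y
      right
      obtain ⟨t, ht⟩ : ∃ t : unitInterval, Circle.exp (2 * Real.pi * t) = u := by
        have hpi := Real.pi_pos
        refine ⟨⟨Int.fract (Complex.arg u / (2 * Real.pi)), Int.fract_nonneg _,
          (Int.fract_lt_one _).le⟩, ?_⟩
        rw [← Circle.exp_arg u, Circle.exp_eq_exp]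
        refine ⟨-⌊Complex.arg u / (2 * Real.pi)⌋, ?_⟩
        simp only [Int.fract, Circle.exp_arg]
        push_cast
        field_simp
        ring
      obtain ⟨w, hw⟩ := hf.2 (y, t)
      exact ⟨w, by simp [χ₂, hw, ht]⟩
  refine attachedCells_append [] [d, d + 1] (Z := TopCat.of ↥(Set.range i))
    ⟨hi.isEmbedding.toHomeomorph⟩ ⟨_, s1, _, s2, ⟨?_⟩⟩
  exact (Homeomorph.setCongr s3).trans (Homeomorph.Set.univ _)

lemma attachedCells_prod_circle (L : List ℕ) : ∀ {A Z : TopCat.{0}}, CompactSpace ↑A → T2Space ↑A →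
    AttachedCells A Z L → ∃ L' : List ℕ,
      AttachedCells (TopCat.of (↑A × Circle)) (TopCat.of (↑Z × Circle)) L' ∧
      (L'.map fun d => (-1 : ℤ) ^ d).sum = 0 := by
  induction L with
  | nil =>
    rintro A Z _ _ ⟨h⟩
    exact ⟨[], ⟨h.prodCongr (Homeomorph.refl _)⟩, rfl⟩
  | cons d L ih =>
    rintro A Z h1 h2 ⟨B, ⟨φ, ⟨hφ⟩⟩, hB⟩
    have := t2Space_attachSp φ
    have h3 : CompactSpace ↑B := hφ.symm.compactSpace
    have h4 : T2Space ↑B := hφ.symm.t2Space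
    obtain ⟨L', h5, h6⟩ := ih h3 h4 hB
    have h7 : AttachedCells (TopCat.of (attachSp φ × Circle)) (TopCat.of (↑B × Circle)) [] :=
      ⟨hφ.symm.prodCongr (Homeomorph.refl _)⟩
    refine ⟨[d, d + 1] ++ ([] ++ L'), attachedCells_append _ _ (attachSp_prod_circle φ)
      (attachedCells_append _ _ h7 h5), ?_⟩
    simp [h6, pow_succ]

/-- A product with the circle has vanishing Euler characteristic. -/
lemma hasEulerChar_prod_circle {F : Type} [TopologicalSpace F] {m : ℤ} (h : HasEulerChar F m) :
    HasEulerChar (F × Circle) 0 := by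
  obtain ⟨Z, L, h1, ⟨h2⟩, -⟩ := h
  have a : CompactSpace ↑(TopCat.of Empty) := inferInstanceAs (CompactSpace Empty)
  have b : T2Space ↑(TopCat.of Empty) := inferInstanceAs (T2Space Empty)
  obtain ⟨L', h3, h4⟩ := attachedCells_prod_circle L a b h1
  have h5 : AttachedCells (TopCat.of Empty) (TopCat.of (Empty × Circle)) [] :=
    ⟨Homeomorph.empty (X := Empty) (Y := Empty × Circle)⟩
  exact ⟨_, _, attachedCells_append _ _ h5 h3,
    ⟨h2.prodCongr (ContinuousMap.HomotopyEquiv.refl _)⟩, by simpa using h4.symm⟩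

end TimesCircle

/-- Subspace of a subspace versus intersection. -/
def preimageValHomeomorph {E : Type} [TopologicalSpace E] (Y S : Set E) :
    ↥((↑) ⁻¹' S : Set ↥Y) ≃ₜ ↥(Y ∩ S) where
  toFun y := ⟨y.1.1, y.1.2, y.2⟩
  invFun z := ⟨⟨z.1, z.2.1⟩, z.2.2⟩
  left_inv _ := rfl
  right_inv _ := rfl
  continuous_toFun := by fun_prop
  continuous_invFun := by fun_prop

/-- A deformation of `M` into `Z` which preserves `Z` makes the inclusion a homotopy
equivalence. -/
lemma homotopyEquiv_of_deformation {E : Type} [TopologicalSpace E] {Z M : Set E} (hZM : Z ⊆ M)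
    (H : ℝ → E → E) (hH : ContinuousOn (fun p : ℝ × E => H p.1 p.2) (Set.Icc 0 1 ×ˢ M))
    (h0 : ∀ x ∈ M, H 0 x = x) (hM : ∀ s ∈ Set.Icc (0 : ℝ) 1, ∀ x ∈ M, H s x ∈ M)
    (h1 : ∀ x ∈ M, H 1 x ∈ Z) (hZ : ∀ s ∈ Set.Icc (0 : ℝ) 1, ∀ x ∈ Z, H s x ∈ Z) :
    Nonempty (ContinuousMap.HomotopyEquiv ↥Z ↥M) := by
  have hc : ∀ {N : Set E}, N ⊆ M → Continuous fun p : unitInterval × ↥N => H p.1 p.2 := by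
    intro N hN
    exact hH.comp_continuous (f := fun p : unitInterval × ↥N => ((p.1 : ℝ), (p.2 : E)))
      (by fun_prop) fun p => ⟨p.1.2, hN p.2.2⟩
  have hc1 : Continuous fun x : ↥M => H 1 x :=
    (hc subset_rfl).comp (f := fun x : ↥M => ((1 : unitInterval), x)) (by fun_prop)
  refine ⟨⟨⟨fun z => ⟨z, hZM z.2⟩, by fun_prop⟩, ⟨fun x => ⟨H 1 x, h1 x x.2⟩, hc1.subtype_mk _⟩, ?_, ?_⟩⟩
  · refine ⟨ContinuousMap.Homotopy.symm ⟨⟨fun p => ⟨H p.1 p.2, hZ _ p.1.2 _ p.2.2⟩,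
      (hc hZM).subtype_mk _⟩, ?_, ?_⟩⟩
    · exact fun x => Subtype.ext (h0 _ (hZM x.2))
    · exact fun x => rfl
  · refine ⟨ContinuousMap.Homotopy.symm ⟨⟨fun p => ⟨H p.1 p.2, hM _ p.1.2 _ p.2.2⟩,
      (hc subset_rfl).subtype_mk _⟩, ?_, ?_⟩⟩
    · exact fun x => Subtype.ext (h0 _ x.2)
    · exact fun x => rfl

/-- A semiflow on `Y` decreasing `f`, with finitely many hyperbolic rest points at which `f` and
the semiflow have a standard form in the boxes parametrised by `j s`. -/
structure MorseFlow {E ι : Type} [TopologicalSpace E] {d : ℕ} (Φ : ℝ → E → E) (f : E → ℝ)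
    (j : ι → EuclideanSpace ℝ (Fin d) × EuclideanSpace ℝ (Fin d) → E)
    (q : ι → E → EuclideanSpace ℝ (Fin d) × EuclideanSpace ℝ (Fin d)) (b : ι → ℝ) (ρ a : ℝ)
    (Y : Set E) : Prop where
  continuous : Continuous fun p : ℝ × E => Φ p.1 p.2
  zero : ∀ x, Φ 0 x = x
  add : ∀ s t x, Φ (s + t) x = Φ s (Φ t x)
  mem : ∀ x ∈ Y, ∀ t, 0 ≤ t → Φ t x ∈ Y
  f_continuous : Continuous f
  anti : ∀ x ∈ Y, ∀ t, 0 ≤ t → f (Φ t x) ≤ f x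
  pos : 0 < ρ
  j_mem : ∀ s, ∀ p ∈ Metric.closedBall 0 ρ, j s p ∈ Y
  j_continuous : ∀ s, ContinuousOn (j s) (Metric.closedBall 0 ρ)
  q_continuous : ∀ s, Continuous (q s)
  q_j : ∀ s, ∀ p ∈ Metric.closedBall 0 ρ, q s (j s p) = p
  j_disj : ∀ s s', ∀ p ∈ Metric.closedBall 0 ρ, ∀ p' ∈ Metric.closedBall 0 ρ,
    j s p = j s' p' → s = s'
  j_open : ∀ s, ∃ U, IsOpen U ∧ U ∩ Y = j s '' Metric.ball 0 ρ
  f_j : ∀ s, ∀ p ∈ Metric.closedBall 0 ρ, f (j s p) = b s + ‖p.2‖ ^ 2 - ‖p.1‖ ^ 2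
  lin : ∀ s, ∀ p ∈ Metric.closedBall 0 ρ, ∀ t, 0 ≤ t → Real.exp t * ‖p.1‖ ≤ ρ →
    Φ t (j s p) = j s (Real.exp t • p.1, Real.exp (-t) • p.2)
  rate : ∀ r, 0 < r → ∃ κ, 0 < κ ∧ ∀ x ∈ Y, ∀ τ, 0 ≤ τ →
    (∀ t ∈ Set.Icc 0 τ, a ≤ f (Φ t x) ∧ ∀ s, Φ t x ∉ j s '' Metric.ball 0 r) →
    f (Φ τ x) ≤ f x - κ * τ
  lt : ∀ s, a < b s

namespace MorseFlow

variable {E ι : Type} [TopologicalSpace E] {d : ℕ} {Φ : ℝ → E → E} {f : E → ℝ}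
    {j : ι → EuclideanSpace ℝ (Fin d) × EuclideanSpace ℝ (Fin d) → E}
    {q : ι → E → EuclideanSpace ℝ (Fin d) × EuclideanSpace ℝ (Fin d)} {b : ι → ℝ} {ρ a : ℝ}
    {Y : Set E}

lemma anti_add (h : MorseFlow Φ f j q b ρ a Y) {x : E} (hx : x ∈ Y) {s t : ℝ} (hs : 0 ≤ s)
    (hst : s ≤ t) : f (Φ t x) ≤ f (Φ s x) := by
  have := h.anti _ (h.mem x hx s hs) (t - s) (sub_nonneg.2 hst)
  rwa [← h.add, sub_add_cancel] at this

/-- Without rest points, `Y` deforms to the sublevel set. -/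
lemma homotopyEquiv_of_isEmpty [IsEmpty ι] (h : MorseFlow Φ f j q b ρ a Y) :
    Nonempty (ContinuousMap.HomotopyEquiv ↥(Y ∩ {x | f x ≤ a}) ↥Y) := by
  obtain ⟨κ, hκ, hr⟩ := h.rate 1 one_pos
  let T : E → ℝ := fun x => max 0 ((f x - a) / κ) + 1
  have hT : Continuous T := by have := h.f_continuous; fun_prop
  have hT0 : ∀ x, 0 ≤ T x := fun x => by positivity
  refine homotopyEquiv_of_deformation Set.inter_subset_left (fun s x => Φ (s * T x) x) ?_ ?_ ?_ ?_ ?_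
  · exact (h.continuous.comp (f := fun p : ℝ × E => (p.1 * T p.2, p.2))
      (by fun_prop)).continuousOn
  · intro x _; simp [h.zero]
  · intro s hs x hx
    exact h.mem x hx _ (mul_nonneg hs.1 (hT0 x))
  · intro x hx
    refine ⟨h.mem x hx _ (by simpa using hT0 x), ?_⟩
    by_contra hf
    simp only [Set.mem_ofPred_eq, one_mul, not_le] at hf
    have := hr x hx (T x) (hT0 x) fun t ht =>
      ⟨hf.le.trans (h.anti_add hx ht.1 ht.2), fun s => isEmptyElim s⟩
    have h2 : (f x - a) / κ * κ = f x - a := div_mul_cancel₀ _ hκ.ne'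
    have h3 : κ * ((f x - a) / κ) ≤ κ * T x :=
      mul_le_mul_of_nonneg_left ((le_max_right 0 _).trans (le_add_of_nonneg_right zero_le_one)) hκ.le
    linarith
  · rintro s hs x ⟨hx, hfx⟩
    exact ⟨h.mem x hx _ (mul_nonneg hs.1 (hT0 x)), (h.anti x hx _ (mul_nonneg hs.1 (hT0 x))).trans hfx⟩

/-- Restriction of a Morse flow to a sublevel set not containing the top rest points. -/
lemma restrict (h : MorseFlow Φ f j q b ρ a Y) {B r : ℝ} (hr : 0 < r) (hrρ : r ≤ ρ)
    (ha : a ≤ B - r ^ 2) (hb : ∀ s, b s < B → b s + r ^ 2 + r ^ 2 ≤ B)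
    (hB : ∀ s, b s ≤ B) :
    MorseFlow (ι := {s // b s < B}) Φ f (fun s => j s) (fun s => q s) (fun s => b s) r a
      (Y ∩ {x | f x ≤ B - r ^ 2}) where
  continuous := h.continuous
  zero := h.zero
  add := h.add
  mem x hx t ht := ⟨h.mem x hx.1 t ht, (h.anti x hx.1 t ht).trans hx.2⟩
  f_continuous := h.f_continuous
  anti x hx := h.anti x hx.1
  pos := hr
  j_mem s p hp := by
    have hp' := Metric.closedBall_subset_closedBall hrρ hp
    refine ⟨h.j_mem s p hp', ?_⟩
    rw [Set.mem_ofPred_eq, h.f_j _ _ hp']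
    have h2 : ‖p.2‖ ≤ r := (norm_snd_le p).trans (mem_closedBall_zero_iff.1 hp)
    have := pow_le_pow_left₀ (norm_nonneg _) h2 2
    nlinarith [hb s s.2, sq_nonneg ‖p.1‖]
  j_continuous s := (h.j_continuous s).mono (Metric.closedBall_subset_closedBall hrρ)
  q_continuous s := h.q_continuous s
  q_j s p hp := h.q_j s p (Metric.closedBall_subset_closedBall hrρ hp)
  j_disj s s' p hp p' hp' he := Subtype.ext (h.j_disj s s' p
    (Metric.closedBall_subset_closedBall hrρ hp) p'
    (Metric.closedBall_subset_closedBall hrρ hp') he)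
  j_open s := by
    obtain ⟨U, hU, hUY⟩ := h.j_open s
    refine ⟨U ∩ q s ⁻¹' Metric.ball 0 r, hU.inter (Metric.isOpen_ball.preimage (h.q_continuous s)), ?_⟩
    ext x
    constructor
    · rintro ⟨⟨hxU, hxq⟩, hxY, -⟩
      obtain ⟨p, hp, rfl⟩ : x ∈ j s '' Metric.ball 0 ρ := hUY ▸ ⟨hxU, hxY⟩
      rw [Set.mem_preimage, h.q_j s p (Metric.ball_subset_closedBall hp)] at hxq
      exact ⟨p, hxq, rfl⟩
    · rintro ⟨p, hp, rfl⟩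
      have hpρ := Metric.ball_subset_ball hrρ hp
      have hm : j s p ∈ U ∩ Y := hUY ▸ ⟨p, hpρ, rfl⟩
      refine ⟨⟨hm.1, ?_⟩, hm.2, ?_⟩
      · rwa [Set.mem_preimage, h.q_j s p (Metric.ball_subset_closedBall hpρ)]
      · rw [Set.mem_ofPred_eq, h.f_j _ _ (Metric.ball_subset_closedBall hpρ)]
        have h2 : ‖p.2‖ ≤ r := (norm_snd_le p).trans (mem_ball_zero_iff.1 hp).le
        have := pow_le_pow_left₀ (norm_nonneg _) h2 2
        nlinarith [hb s s.2, sq_nonneg ‖p.1‖]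
  f_j s p hp := h.f_j s p (Metric.closedBall_subset_closedBall hrρ hp)
  lin s p hp t ht he := h.lin s p (Metric.closedBall_subset_closedBall hrρ hp) t ht (he.trans hrρ)
  rate r' hr' := by
    obtain ⟨κ, hκ, hk⟩ := h.rate (min r' r) (lt_min hr' hr)
    refine ⟨κ, hκ, fun x hx τ hτ ht => hk x hx.1 τ hτ fun t htt => ⟨(ht t htt).1, fun s hs => ?_⟩⟩
    rcases (hB s).lt_or_eq with hsB | hsB
    · exact (ht t htt).2 ⟨s, hsB⟩ (Set.image_mono (Metric.ball_subset_ball (min_le_left _ _)) hs)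
    · obtain ⟨p, hp, hpe⟩ := hs
      have hpr : ‖p‖ < r := (mem_ball_zero_iff.1 hp).trans_le (min_le_right _ _)
      have h1 := (h.anti x hx.1 t htt.1).trans hx.2
      rw [← hpe, h.f_j _ _ (mem_closedBall_zero_iff.2 (hpr.le.trans hrρ)), hsB] at h1
      have h2 : ‖p.1‖ < r := (norm_fst_le p).trans_lt hpr
      have := pow_lt_pow_left₀ h2 (norm_nonneg _) two_ne_zero
      nlinarith [sq_nonneg ‖p.2‖]
  lt s := h.lt s

end MorseFlow

/-- A cutoff function which is `1` for `t ≤ ρ / 2` and `0` for `3 * ρ / 4 ≤ t`. -/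
def boxCutoff (ρ t : ℝ) : ℝ := max 0 (min 1 (3 - 4 * (t / ρ)))

lemma continuous_boxCutoff (ρ : ℝ) : Continuous (boxCutoff ρ) := by
  unfold boxCutoff; fun_prop

lemma boxCutoff_mem (ρ t : ℝ) : boxCutoff ρ t ∈ Set.Icc (0 : ℝ) 1 :=
  ⟨le_max_left _ _, max_le zero_le_one (min_le_left _ _)⟩

lemma boxCutoff_of_le {ρ t : ℝ} (hρ : 0 < ρ) (ht : t ≤ ρ / 2) : boxCutoff ρ t = 1 := by
  have : t / ρ ≤ 1 / 2 := by rw [div_le_iff₀ hρ]; linarith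
  rw [boxCutoff, min_eq_left (by linarith), max_eq_right zero_le_one]

lemma boxCutoff_self {ρ : ℝ} (hρ : 0 < ρ) : boxCutoff ρ ρ = 0 := by
  rw [boxCutoff, div_self hρ.ne', max_eq_left]
  exact (min_le_right _ _).trans (by norm_num)

lemma mem_closedBall_prod {V W : Type} [SeminormedAddCommGroup V] [SeminormedAddCommGroup W]
    {p : V × W} {r : ℝ} : p ∈ Metric.closedBall 0 r ↔ ‖p.1‖ ≤ r ∧ ‖p.2‖ ≤ r := by
  rw [mem_closedBall_zero_iff, Prod.norm_def, max_le_iff]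

lemma exists_exit_time {x r t : ℝ} (hx : 0 ≤ x) (hxr : x ≤ r) (ht : 0 ≤ t) :
    Real.exp t * x ≤ r ∨ ∃ t0, 0 ≤ t0 ∧ t0 ≤ t ∧ Real.exp t0 * x = r := by
  rcases le_or_gt (Real.exp t * x) r with hle | hgt
  · exact Or.inl hle
  have hp1 : 0 < x := hx.lt_of_ne fun h0 => by
    rw [← h0, mul_zero] at hgt
    linarith
  have hr0 : 0 < r := hp1.trans_le hxr
  have het : Real.exp (Real.log (r / x)) * x = r := by
    rw [Real.exp_log (div_pos hr0 hp1), div_mul_cancel₀ _ hp1.ne']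
  refine Or.inr ⟨Real.log (r / x), Real.log_nonneg ((one_le_div hp1).2 hxr), ?_, het⟩
  rw [← Real.exp_le_exp]
  exact le_of_mul_le_mul_right (het.le.trans hgt.le) hp1

open Classical in
/-- Push each box onto its unstable disc. -/
def boxPush {E ι : Type} {d : ℕ}
    (j : ι → EuclideanSpace ℝ (Fin d) × EuclideanSpace ℝ (Fin d) → E)
    (q : ι → E → EuclideanSpace ℝ (Fin d) × EuclideanSpace ℝ (Fin d)) (ρ u : ℝ) (x : E) : E :=
  if h : ∃ s, x ∈ j s '' Metric.closedBall 0 ρ then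
    j h.choose ((q h.choose x).1,
      (1 - u * boxCutoff ρ ‖q h.choose x‖) • (q h.choose x).2)
  else x

namespace MorseFlow

variable {E ι : Type} [TopologicalSpace E] {d : ℕ} {Φ : ℝ → E → E} {f : E → ℝ}
    {j : ι → EuclideanSpace ℝ (Fin d) × EuclideanSpace ℝ (Fin d) → E}
    {q : ι → E → EuclideanSpace ℝ (Fin d) × EuclideanSpace ℝ (Fin d)} {b : ι → ℝ} {ρ a : ℝ}
    {Y : Set E}

lemma boxPush_j (h : MorseFlow Φ f j q b ρ a Y) (s : ι)
    {p : EuclideanSpace ℝ (Fin d) × EuclideanSpace ℝ (Fin d)} (hp : p ∈ Metric.closedBall 0 ρ)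
    (u : ℝ) : boxPush j q ρ u (j s p) = j s (p.1, (1 - u * boxCutoff ρ ‖p‖) • p.2) := by
  have hex : ∃ s', j s p ∈ j s' '' Metric.closedBall 0 ρ := ⟨s, p, hp, rfl⟩
  have hs : hex.choose = s := by
    obtain ⟨p', hp', he⟩ := hex.choose_spec
    exact h.j_disj _ _ _ hp' _ hp he
  rw [boxPush, dif_pos hex, hs, h.q_j s p hp]

lemma boxPush_of_notMem {u : ℝ} {x : E} (hx : ∀ s, x ∉ j s '' Metric.closedBall 0 ρ) :
    boxPush j q ρ u x = x := by
  rw [boxPush, dif_neg (by simpa only [not_exists] using hx)]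

lemma pushed_mem {p : EuclideanSpace ℝ (Fin d) × EuclideanSpace ℝ (Fin d)}
    (hp : p ∈ Metric.closedBall 0 ρ) {u : ℝ} (hu : u ∈ Set.Icc (0 : ℝ) 1) :
    (p.1, (1 - u * boxCutoff ρ ‖p‖) • p.2) ∈ Metric.closedBall
      (0 : EuclideanSpace ℝ (Fin d) × EuclideanSpace ℝ (Fin d)) ρ ∧
    ‖(1 - u * boxCutoff ρ ‖p‖) • p.2‖ ≤ ‖p.2‖ := by
  have h1 := boxCutoff_mem ρ ‖p‖
  have h2 : 0 ≤ 1 - u * boxCutoff ρ ‖p‖ := by nlinarith [hu.1, hu.2, h1.1, h1.2]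
  have h3 : 1 - u * boxCutoff ρ ‖p‖ ≤ 1 := by nlinarith [hu.1, hu.2, h1.1, h1.2]
  have h4 : ‖(1 - u * boxCutoff ρ ‖p‖) • p.2‖ ≤ ‖p.2‖ := by
    rw [norm_smul, Real.norm_of_nonneg h2]
    exact mul_le_of_le_one_left (norm_nonneg _) h3
  refine ⟨?_, h4⟩
  rw [mem_closedBall_zero_iff] at hp ⊢
  exact (max_le_max le_rfl h4).trans hp

lemma continuousOn_boxPush [T2Space E] [Finite ι] (h : MorseFlow Φ f j q b ρ a Y) :
    ContinuousOn (fun p : ℝ × E => boxPush j q ρ p.1 p.2) (Set.Icc 0 1 ×ˢ Y) := by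
  choose U hU hUY using h.j_open
  let P : Option ι → Set (ℝ × E) := fun o => o.elim (Set.Icc 0 1 ×ˢ (⋃ s, U s)ᶜ)
    fun s => Set.Icc 0 1 ×ˢ (j s '' Metric.closedBall 0 ρ)
  have hcomp : ∀ s, IsCompact (j s '' Metric.closedBall 0 ρ) := fun s =>
    (isCompact_closedBall _ _).image_of_continuousOn (h.j_continuous s)
  have hP : ∀ o, IsClosed (P o) := by
    rintro (_ | s)
    · exact isClosed_Icc.prod (isOpen_iUnion hU).isClosed_compl
    · exact isClosed_Icc.prod (hcomp s).isClosed
  have hcont : ∀ o, ContinuousOn (fun p : ℝ × E => boxPush j q ρ p.1 p.2)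
      (P o ∩ Set.univ ×ˢ Y) := by
    rintro (_ | s)
    · refine continuous_snd.continuousOn.congr ?_
      rintro ⟨u, x⟩ ⟨⟨-, hx⟩, -, hxY⟩
      simp only
      by_cases hex : ∃ s, x ∈ j s '' Metric.closedBall 0 ρ
      · obtain ⟨s, p, hp, rfl⟩ := hex
        rw [h.boxPush_j s hp]
        have : ‖p‖ = ρ := by
          refine le_antisymm (mem_closedBall_zero_iff.1 hp) (not_lt.1 fun hlt => hx ?_)
          have : j s p ∈ U s ∩ Y := by
            rw [hUY]; exact ⟨p, mem_ball_zero_iff.2 hlt, rfl⟩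
          exact Set.mem_iUnion.2 ⟨s, this.1⟩
        rw [this, boxCutoff_self h.pos, mul_zero, sub_zero, one_smul]
      · exact boxPush_of_notMem (not_exists.1 hex)
    · have h1 : ContinuousOn (fun p : ℝ × E => j s ((q s p.2).1,
          (1 - p.1 * boxCutoff ρ ‖q s p.2‖) • (q s p.2).2)) (P (some s)) := by
        have hq := h.q_continuous s
        have hb := continuous_boxCutoff ρ
        refine (h.j_continuous s).comp (f := fun p : ℝ × E => ((q s p.2).1,
          (1 - p.1 * boxCutoff ρ ‖q s p.2‖) • (q s p.2).2)) ?_ ?_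
        · exact Continuous.continuousOn (by fun_prop)
        · rintro ⟨u, x⟩ ⟨hu, p, hp, rfl⟩
          simp only [h.q_j s p hp]
          exact (pushed_mem hp hu).1
      refine (h1.congr ?_).mono Set.inter_subset_left
      rintro ⟨u, x⟩ ⟨hu, p, hp, rfl⟩
      simp only [h.q_j s p hp, h.boxPush_j s hp]
  have hU : Set.Icc (0 : ℝ) 1 ×ˢ Y ⊆ ⋃ o, (P o ∩ Set.univ ×ˢ Y) := by
    rintro ⟨u, x⟩ ⟨hu, hx⟩
    by_cases hxU : ∃ s, x ∈ U s
    · obtain ⟨s, hs⟩ := hxU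
      have : x ∈ j s '' Metric.ball 0 ρ := hUY s ▸ ⟨hs, hx⟩
      exact Set.mem_iUnion.2 ⟨some s, ⟨hu, Set.image_mono Metric.ball_subset_closedBall this⟩,
        trivial, hx⟩
    · exact Set.mem_iUnion.2 ⟨none, ⟨hu, by simpa using hxU⟩, trivial, hx⟩
  rw [continuousOn_iff_continuous_domRestrict]
  have hS : Continuous ((Set.Icc (0 : ℝ) 1 ×ˢ Y).domRestrict
      fun p : ℝ × E => boxPush j q ρ p.1 p.2) := by
    refine (locallyFinite_of_finite fun o : Option ι => ((↑) ⁻¹' P o :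
      Set ↥(Set.Icc (0 : ℝ) 1 ×ˢ Y))).continuous ?_ (fun o => (hP o).preimage
        continuous_subtype_val) fun o => ?_
    · refine Set.eq_univ_of_forall fun p => ?_
      obtain ⟨o, ho⟩ := Set.mem_iUnion.1 (hU p.2)
      exact Set.mem_iUnion.2 ⟨o, ho.1⟩
    · exact (hcont o).comp continuous_subtype_val.continuousOn fun p hp => ⟨hp, trivial, p.2.2⟩
  exact hS

lemma boxPush_mem (h : MorseFlow Φ f j q b ρ a Y) {u : ℝ} (hu : u ∈ Set.Icc (0 : ℝ) 1) {x : E}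
    (hx : x ∈ Y) : boxPush j q ρ u x ∈ Y ∧ f (boxPush j q ρ u x) ≤ f x := by
  by_cases hex : ∃ s, x ∈ j s '' Metric.closedBall 0 ρ
  · obtain ⟨s, p, hp, rfl⟩ := hex
    obtain ⟨h1, h2⟩ := pushed_mem hp hu
    rw [h.boxPush_j s hp]
    refine ⟨h.j_mem s _ h1, ?_⟩
    rw [h.f_j s _ h1, h.f_j s _ hp]
    have := pow_le_pow_left₀ (norm_nonneg _) h2 2
    linarith
  · rw [boxPush_of_notMem (not_exists.1 hex)]
    exact ⟨hx, le_rfl⟩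

lemma boxPush_zero (h : MorseFlow Φ f j q b ρ a Y) (x : E) : boxPush j q ρ 0 x = x := by
  by_cases hex : ∃ s, x ∈ j s '' Metric.closedBall 0 ρ
  · obtain ⟨s, p, hp, rfl⟩ := hex
    rw [h.boxPush_j s hp]
    simp
  · exact boxPush_of_notMem (not_exists.1 hex)

/-- An orbit through a box either leaves through the side where `f` is small or stays inside. -/
lemma flow_box (h : MorseFlow Φ f j q b ρ a Y) (s : ι)
    {p : EuclideanSpace ℝ (Fin d) × EuclideanSpace ℝ (Fin d)} {r : ℝ} (hr : r ≤ ρ)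
    (h1 : ‖p.1‖ ≤ r) (h2 : ‖p.2‖ ≤ ρ) {t : ℝ} (ht : 0 ≤ t) :
    f (Φ t (j s p)) ≤ b s + ‖p.2‖ ^ 2 - r ^ 2 ∨
      (Real.exp t * ‖p.1‖ ≤ r ∧ Φ t (j s p) = j s (Real.exp t • p.1, Real.exp (-t) • p.2)) := by
  have hp : p ∈ Metric.closedBall 0 ρ := mem_closedBall_prod.2 ⟨h1.trans hr, h2⟩
  rcases exists_exit_time (norm_nonneg p.1) h1 ht with hle | ⟨t0, ht0, ht0t, het⟩
  · exact Or.inr ⟨hle, h.lin s p hp t ht (hle.trans hr)⟩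
  left
  refine (h.anti_add (h.j_mem s p hp) ht0 ht0t).trans ?_
  have hsm : ‖Real.exp (-t0) • p.2‖ ≤ ‖p.2‖ := by
    rw [norm_smul, Real.norm_of_nonneg (Real.exp_pos _).le]
    exact mul_le_of_le_one_left (norm_nonneg _) (Real.exp_le_one_iff.2 (by linarith))
  have hsx : ‖Real.exp t0 • p.1‖ = r := by
    rw [norm_smul, Real.norm_of_nonneg (Real.exp_pos _).le, het]
  have hm : (Real.exp t0 • p.1, Real.exp (-t0) • p.2) ∈ Metric.closedBall
      (0 : EuclideanSpace ℝ (Fin d) × EuclideanSpace ℝ (Fin d)) ρ :=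
    mem_closedBall_prod.2 ⟨hsx.le.trans hr, hsm.trans h2⟩
  have hf := h.f_j s _ hm
  rw [← h.lin s p hp t0 ht0 (het.le.trans hr)] at hf
  have hsq := pow_le_pow_left₀ (norm_nonneg _) hsm 2
  rw [hf]
  dsimp only
  rw [hsx]
  exact sub_le_sub_right (add_le_add_right hsq _) _

end MorseFlow

namespace MorseFlow

variable {E ι : Type} [TopologicalSpace E] {d : ℕ} {Φ : ℝ → E → E} {f : E → ℝ}
    {j : ι → EuclideanSpace ℝ (Fin d) × EuclideanSpace ℝ (Fin d) → E}
    {q : ι → E → EuclideanSpace ℝ (Fin d) × EuclideanSpace ℝ (Fin d)} {b : ι → ℝ} {ρ a : ℝ}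
    {Y : Set E}

/-- Flowing long enough, every point gets below the level `B - r ^ 2` or close to a rest point at
the top level `B`. -/
lemma exists_time (h : MorseFlow Φ f j q b ρ a Y) {B r : ℝ} (hr : 0 < r) (hrρ : r ≤ ρ / 4)
    (ha : a ≤ B - r ^ 2) (hb : ∀ s, b s < B → b s + r ^ 2 + r ^ 2 ≤ B) (hB : ∀ s, b s ≤ B) :
    ∃ T : E → ℝ, Continuous T ∧ (∀ x, 0 ≤ T x) ∧ ∀ x ∈ Y, f (Φ (T x) x) ≤ B - r ^ 2 ∨
      ∃ s p, ‖p‖ ≤ ρ / 2 ∧ b s = B ∧ Φ (T x) x = j s p := by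
  obtain ⟨κ, hκ, hk⟩ := h.rate r hr
  have hρ := h.pos
  let T : E → ℝ := fun x => max 0 ((f x - (B - r ^ 2)) / κ) + 1
  have hT : Continuous T := by have := h.f_continuous; fun_prop
  have hT0 : ∀ x, 0 ≤ T x := fun x => by positivity
  refine ⟨T, hT, hT0, fun x hx => ?_⟩
  by_contra! hcon
  obtain ⟨hf, hno⟩ := hcon
  have hhigh : ∀ t ∈ Set.Icc 0 (T x), B - r ^ 2 < f (Φ t x) := fun t ht =>
    hf.trans_le (h.anti_add hx ht.1 ht.2)
  obtain ⟨t0, ht0, s, p, hp, hpe⟩ : ∃ t0 ∈ Set.Icc 0 (T x), ∃ s, Φ t0 x ∈ j s '' Metric.ball 0 r := by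
    by_contra! hcon
    have := hk x hx (T x) (hT0 x) fun t ht => ⟨ha.trans (hhigh t ht).le, hcon t ht⟩
    have h2 : (f x - (B - r ^ 2)) / κ * κ = f x - (B - r ^ 2) := div_mul_cancel₀ _ hκ.ne'
    have h3 : κ * ((f x - (B - r ^ 2)) / κ) ≤ κ * T x :=
      mul_le_mul_of_nonneg_left ((le_max_right 0 _).trans
        (le_add_of_nonneg_right zero_le_one)) hκ.le
    linarith
  have hpr : ‖p‖ < r := mem_ball_zero_iff.1 hp
  have hp1 : ‖p.1‖ < r := (norm_fst_le p).trans_lt hpr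
  have hp2 : ‖p.2‖ < r := (norm_snd_le p).trans_lt hpr
  have hp2' : ‖p.2‖ ^ 2 < r ^ 2 := pow_lt_pow_left₀ hp2 (norm_nonneg _) two_ne_zero
  have hpc : p ∈ Metric.closedBall 0 ρ := mem_closedBall_zero_iff.2 (by linarith)
  have hfp := hhigh t0 ht0
  rw [← hpe, h.f_j s p hpc] at hfp
  have hsB : b s = B := by
    refine (hB s).eq_of_not_lt fun hlt => ?_
    have := hb s hlt
    have := sq_nonneg ‖p.1‖
    linarith
  have hadd : Φ (T x) x = Φ (T x - t0) (j s p) := by rw [hpe, ← h.add, sub_add_cancel]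
  have hrr : r ^ 2 ≤ (ρ / 4) ^ 2 := pow_le_pow_left₀ hr.le hrρ 2
  rcases h.flow_box s (p := p) (r := ρ / 2) (by linarith) (by linarith) (by linarith)
    (sub_nonneg.2 ht0.2) with hle | ⟨hle, he⟩
  · rw [← hadd, hsB] at hle
    have := sq_nonneg ρ
    linarith
  · refine hno s _ ?_ hsB (hadd.trans he)
    have h3 : ‖Real.exp (-(T x - t0)) • p.2‖ ≤ ‖p.2‖ := by
      rw [norm_smul, Real.norm_of_nonneg (Real.exp_pos _).le]
      exact mul_le_of_le_one_left (norm_nonneg _)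
        (Real.exp_le_one_iff.2 (by linarith [ht0.2]))
    have h4 : ‖Real.exp (T x - t0) • p.1‖ ≤ ρ / 2 := by
      rwa [norm_smul, Real.norm_of_nonneg (Real.exp_pos _).le]
    exact mem_closedBall_zero_iff.1 (mem_closedBall_prod.2 ⟨h4, by linarith⟩)

/-- The unstable discs of radius `r` at the top level. -/
def topDiscs (j : ι → EuclideanSpace ℝ (Fin d) × EuclideanSpace ℝ (Fin d) → E) (b : ι → ℝ)
    (B r : ℝ) : Set E :=
  {z | ∃ s, b s = B ∧ ∃ x, ‖x‖ ≤ r ∧ z = j s (x, 0)}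

lemma homotopyEquiv_topDiscs [T2Space E] [Finite ι] (h : MorseFlow Φ f j q b ρ a Y) {B r : ℝ}
    (hr : 0 < r) (hrρ : r ≤ ρ / 4)
    (ha : a ≤ B - r ^ 2) (hb : ∀ s, b s < B → b s + r ^ 2 + r ^ 2 ≤ B) (hB : ∀ s, b s ≤ B) :
    Nonempty (ContinuousMap.HomotopyEquiv
      ↥(Y ∩ ({x | f x ≤ B - r ^ 2} ∪ topDiscs j b B r)) ↥Y) := by
  obtain ⟨T, hT, hT0, hTY⟩ := h.exists_time hr hrρ ha hb hB
  have hρ := h.pos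
  have hrρ' : r ≤ ρ := by linarith
  have hsT : ∀ s ∈ Set.Icc (0 : ℝ) 1, ∀ x, 0 ≤ s * T x := fun s hs x => mul_nonneg hs.1 (hT0 x)
  refine homotopyEquiv_of_deformation Set.inter_subset_left
    (fun s x => boxPush j q ρ s (Φ (s * T x) x)) ?_ ?_ ?_ ?_ ?_
  · refine h.continuousOn_boxPush.comp (f := fun p : ℝ × E => (p.1, Φ (p.1 * T p.2) p.2)) ?_ ?_
    · have := h.continuous.comp (f := fun p : ℝ × E => (p.1 * T p.2, p.2)) (by fun_prop)
      exact (continuous_fst.prodMk this).continuousOn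
    · rintro ⟨s, x⟩ ⟨hs, hx⟩
      exact ⟨hs, h.mem x hx _ (hsT s hs x)⟩
  · intro x _
    simp only [zero_mul, h.zero, h.boxPush_zero]
  · exact fun s hs x hx => (h.boxPush_mem hs (h.mem x hx _ (hsT s hs x))).1
  · intro x hx
    have hm := h.mem x hx _ (hT0 x)
    obtain ⟨hm1, hm2⟩ := h.boxPush_mem (u := 1) ⟨zero_le_one, le_rfl⟩ hm
    simp only [one_mul]
    refine ⟨hm1, ?_⟩
    rcases hTY x hx with hle | ⟨s, p, hp, hsB, hpe⟩
    · exact Or.inl (hm2.trans hle)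
    · have hpc : p ∈ Metric.closedBall 0 ρ := mem_closedBall_zero_iff.2 (by linarith)
      have hbp := h.boxPush_j s hpc 1
      rw [boxCutoff_of_le hρ hp, mul_one, sub_self, zero_smul] at hbp
      rw [hpe, hbp]
      rcases le_or_gt ‖p.1‖ r with hle | hgt
      · exact Or.inr ⟨s, hsB, p.1, hle, rfl⟩
      · left
        have hc : (p.1, (0 : EuclideanSpace ℝ (Fin d))) ∈ Metric.closedBall
            (0 : EuclideanSpace ℝ (Fin d) × EuclideanSpace ℝ (Fin d)) ρ :=
          mem_closedBall_prod.2 ⟨(mem_closedBall_prod.1 hpc).1, by simpa using hρ.le⟩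
        have hsq := pow_lt_pow_left₀ hgt hr.le two_ne_zero
        rw [Set.mem_ofPred_eq, h.f_j s _ hc, hsB]
        simp only [norm_zero]
        linarith
  · rintro s hs x ⟨hx, hxf⟩
    have hm := h.mem x hx _ (hsT s hs x)
    obtain ⟨hm1, hm2⟩ := h.boxPush_mem hs hm
    refine ⟨hm1, ?_⟩
    have key : ∀ z, z ∈ Y → f z ≤ B - r ^ 2 → f (boxPush j q ρ s z) ≤ B - r ^ 2 :=
      fun z hz hzf => (h.boxPush_mem hs hz).2.trans hzf
    rcases hxf with hxf | ⟨s', hs', y, hy, rfl⟩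
    · exact Or.inl (key _ hm ((h.anti x hx _ (hsT s hs x)).trans hxf))
    · rcases h.flow_box s' (p := (y, 0)) hrρ' hy (by simpa using hρ.le) (hsT s hs (j s' (y, 0)))
        with hle | ⟨hle, he⟩
      · refine Or.inl (key _ hm ?_)
        simpa [hs'] using hle
      · right
        rw [smul_zero] at he
        have hn : ‖Real.exp (s * T (j s' (y, 0))) • y‖ ≤ r := by
          rwa [norm_smul, Real.norm_of_nonneg (Real.exp_pos _).le]
        have hc : (Real.exp (s * T (j s' (y, 0))) • y, (0 : EuclideanSpace ℝ (Fin d))) ∈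
            Metric.closedBall (0 : EuclideanSpace ℝ (Fin d) × EuclideanSpace ℝ (Fin d)) ρ :=
          mem_closedBall_prod.2 ⟨hn.trans hrρ', by simpa using hρ.le⟩
        refine ⟨s', hs', _, hn, ?_⟩
        rw [he, h.boxPush_j s' hc, smul_zero]

lemma attachedCells_topDiscs [T2Space E] (h : MorseFlow Φ f j q b ρ a Y) {B r : ℝ}
    (hr : 0 < r) (hrρ : r ≤ ρ) {k : ℕ} (e : Fin k ≃ {s // b s = B}) :
    ∃ Z : TopCat.{0}, AttachedCells (TopCat.of ↥(Y ∩ {x | f x ≤ B - r ^ 2})) Z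
      (List.replicate k d) ∧ Nonempty (ContinuousMap.HomotopyEquiv ↑Z
        ↥(Y ∩ ({x | f x ≤ B - r ^ 2} ∪ topDiscs j b B r))) := by
  have hbox : ∀ y : ↥(cellBall d), (r • y.1, (0 : EuclideanSpace ℝ (Fin d))) ∈ Metric.closedBall
      (0 : EuclideanSpace ℝ (Fin d) × EuclideanSpace ℝ (Fin d)) ρ := by
    intro y
    refine mem_closedBall_prod.2 ⟨?_, by simpa using h.pos.le⟩
    have hy : ‖y.1‖ ≤ 1 := mem_closedBall_zero_iff.1 y.2
    rw [norm_smul, Real.norm_of_nonneg hr.le]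
    exact (mul_le_of_le_one_right hr.le hy).trans hrρ
  let χ : Fin k → C(↥(cellBall d), ↥Y) := fun i =>
    ⟨fun y => ⟨j (e i) (r • y.1, 0), h.j_mem _ _ (hbox y)⟩, Continuous.subtype_mk
      ((h.j_continuous (e i)).comp_continuous (by fun_prop) hbox) _⟩
  let A : Set ↥Y := (↑) ⁻¹' {x | f x ≤ B - r ^ 2}
  have hA : IsClosed A :=
    (isClosed_le h.f_continuous continuous_const).preimage continuous_subtype_val
  have h1 : ∀ s y, χ s y ∈ A ↔ ‖y.1‖ = 1 := by
    intro i y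
    have hy : ‖y.1‖ ≤ 1 := mem_closedBall_zero_iff.1 y.2
    change f (j (e i) (r • y.1, 0)) ≤ B - r ^ 2 ↔ _
    rw [h.f_j _ _ (hbox y), (e i).2]
    simp only [norm_zero, norm_smul, Real.norm_of_nonneg hr.le]
    constructor
    · intro hle
      refine le_antisymm hy (not_lt.1 fun hlt => ?_)
      have : r * ‖y.1‖ < r := mul_lt_of_lt_one_right hr hlt
      have := pow_lt_pow_left₀ this (by positivity) two_ne_zero
      linarith
    · intro he
      rw [he]
      simp
  have h2 : ∀ s s' (y y' : ↥(cellBall d)), ‖y.1‖ ≠ 1 → χ s y = χ s' y' → s = s' ∧ y = y' := by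
    intro i i' y y' _ he
    have he' : j (e i) (r • y.1, 0) = j (e i') (r • y'.1, 0) := congrArg Subtype.val he
    have hs := h.j_disj _ _ _ (hbox y) _ (hbox y') he'
    refine ⟨e.injective (Subtype.ext hs), ?_⟩
    have hq := congrArg (q (e i)) he'
    rw [h.q_j _ _ (hbox y), hs, h.q_j _ _ (hbox y')] at hq
    exact Subtype.ext (smul_right_injective _ hr.ne' (congrArg Prod.fst hq))
  have hat := attachedCells_of_closed A hA k χ h1 h2
  obtain ⟨Z, hZ, ⟨g⟩⟩ := attachedCells_homotopy_invariant
    (A' := TopCat.of ↥(Y ∩ {x | f x ≤ B - r ^ 2})) _ hat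
    (preimageValHomeomorph Y {x | f x ≤ B - r ^ 2}).toHomotopyEquiv
  refine ⟨Z, hZ, ⟨g.symm.trans (Homeomorph.toHomotopyEquiv ?_)⟩⟩
  have hset : A ∪ ⋃ s, Set.range (χ s) =
      (↑) ⁻¹' ({x | f x ≤ B - r ^ 2} ∪ topDiscs j b B r) := by
    rw [Set.preimage_union]
    congr 1
    ext z
    simp only [Set.mem_iUnion, Set.mem_range, Set.mem_preimage]
    constructor
    · rintro ⟨i, y, rfl⟩
      refine ⟨e i, (e i).2, r • y.1, ?_, rfl⟩
      have hy : ‖y.1‖ ≤ 1 := mem_closedBall_zero_iff.1 y.2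
      rw [norm_smul, Real.norm_of_nonneg hr.le]
      exact mul_le_of_le_one_right hr.le hy
    · rintro ⟨s, hs, x, hx, hz⟩
      refine ⟨e.symm ⟨s, hs⟩, ⟨r⁻¹ • x, mem_closedBall_zero_iff.2 ?_⟩, Subtype.ext ?_⟩
      · rw [norm_smul, norm_inv, Real.norm_of_nonneg hr.le]
        exact inv_mul_le_one_of_le₀ hx hr.le
      · rw [hz]
        change j (e (e.symm ⟨s, hs⟩)) (r • (r⁻¹ • x), 0) = _
        rw [e.apply_symm_apply, smul_inv_smul₀ hr.ne']
  exact (Homeomorph.setCongr hset).trans (preimageValHomeomorph Y _)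

end MorseFlow

/-- **The fundamental theorem of Morse theory** for flows in standard form near rest points of
middle index. -/
theorem MorseFlow.attachedCells {E : Type} [TopologicalSpace E] [T2Space E] {d : ℕ} (N : ℕ) :
    ∀ {ι : Type} [Finite ι] {Φ : ℝ → E → E} {f : E → ℝ}
    {j : ι → EuclideanSpace ℝ (Fin d) × EuclideanSpace ℝ (Fin d) → E}
    {q : ι → E → EuclideanSpace ℝ (Fin d) × EuclideanSpace ℝ (Fin d)} {b : ι → ℝ} {ρ a : ℝ}
    {Y : Set E}, MorseFlow Φ f j q b ρ a Y → Nat.card ι = N →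
    ∃ Z : TopCat.{0}, AttachedCells (TopCat.of ↥(Y ∩ {x | f x ≤ a})) Z (List.replicate N d) ∧
      Nonempty (ContinuousMap.HomotopyEquiv ↑Z ↥Y) := by
  induction N using Nat.strong_induction_on with
  | _ N ih =>
  intro ι _ Φ f j q b ρ a Y h hN
  cases isEmpty_or_nonempty ι with
  | inl hι =>
    rw [Nat.card_eq_zero.2 (Or.inl hι)] at hN
    subst hN
    exact ⟨TopCat.of _, ⟨Homeomorph.refl _⟩, h.homotopyEquiv_of_isEmpty⟩
  | inr hι =>
    obtain ⟨s0, hs0⟩ := Finite.exists_max b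
    set B := b s0 with hB
    obtain ⟨g, hg, hga, hgb⟩ : ∃ g, 0 < g ∧ a + g ≤ B ∧ ∀ s, b s < B → b s + g ≤ B := by
      have hfin : Set.Finite ((fun s => B - b s) '' {s | b s < B}) := Set.toFinite _
      have hev : ∀ᶠ g in 𝓝[>] (0 : ℝ), (0 < g ∧ a + g ≤ B) ∧ ∀ s, b s < B → b s + g ≤ B := by
        have hlt : ∀ c : ℝ, c < B → ∀ᶠ g in 𝓝[>] (0 : ℝ), c + g ≤ B := by
          intro c hc
          filter_upwards [Ioo_mem_nhdsGT (sub_pos.2 hc)] with g hg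
          linarith [hg.2]
        refine (Eventually.and (show ∀ᶠ g in 𝓝[>] (0 : ℝ), 0 < g from self_mem_nhdsWithin) (hlt a (h.lt s0))).and (eventually_all.2 fun s => ?_)
        by_cases hs : b s < B
        · filter_upwards [hlt _ hs] with g hg _ using hg
        · exact Eventually.of_forall fun g hs' => absurd hs' hs
      obtain ⟨g, ⟨h1, h2⟩, h3⟩ := hev.exists
      exact ⟨g, h1, h2, h3⟩
    obtain ⟨r, hr, hrρ, hrg⟩ : ∃ r, 0 < r ∧ r ≤ ρ / 4 ∧ r ^ 2 + r ^ 2 ≤ g := by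
      have hρ := h.pos
      refine ⟨min (ρ / 4) (min 1 (g / 2)), by positivity, min_le_left _ _, ?_⟩
      set r := min (ρ / 4) (min 1 (g / 2))
      have h0 : 0 ≤ r := by positivity
      have h1 : r ≤ 1 := (min_le_right _ _).trans (min_le_left _ _)
      have h2 : r ≤ g / 2 := (min_le_right _ _).trans (min_le_right _ _)
      nlinarith
    have ha : a ≤ B - r ^ 2 := by linarith [sq_nonneg r]
    have hb : ∀ s, b s < B → b s + r ^ 2 + r ^ 2 ≤ B := fun s hs => by linarith [hgb s hs]
    have hrρ' : r ≤ ρ := by linarith [h.pos]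
    let k := Nat.card {s // b s = B}
    have e : Fin k ≃ {s // b s = B} := (Finite.equivFin _).symm
    have hcard : Nat.card {s // b s < B} + k = N := by
      have := Nat.card_congr (Equiv.sumCompl fun s => b s < B)
      rw [Nat.card_sum, hN] at this
      rw [← this]
      congr 1
      exact Nat.card_congr (Equiv.subtypeEquivRight fun s =>
        ⟨fun hs => hs.not_lt, fun hs => le_antisymm (hs0 s) (not_lt.1 hs)⟩)
    have hk : 0 < k := by
      have : Nonempty {s // b s = B} := ⟨⟨s0, rfl⟩⟩
      exact Nat.card_pos
    obtain ⟨Z1, hZ1, ⟨e1⟩⟩ := ih (Nat.card {s // b s < B}) (by omega)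
      (h.restrict hr hrρ' ha hb hs0) rfl
    obtain ⟨Z2, hZ2, ⟨e2⟩⟩ := h.attachedCells_topDiscs hr hrρ' e
    obtain ⟨e3⟩ := h.homotopyEquiv_topDiscs hr hrρ ha hb hs0
    obtain ⟨Z3, hZ3, ⟨e4⟩⟩ := attachedCells_homotopy_invariant _ hZ2 e1.symm
    have hset : Y ∩ {x | f x ≤ B - r ^ 2} ∩ {x | f x ≤ a} = Y ∩ {x | f x ≤ a} := by
      ext x
      simp only [Set.mem_inter_iff, Set.mem_ofPred_eq]
      exact ⟨fun hx => ⟨hx.1.1, hx.2⟩, fun hx => ⟨⟨hx.1, hx.2.trans ha⟩, hx.2⟩⟩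
    rw [hset] at hZ1
    refine ⟨Z3, ?_, ⟨e4.symm.trans (e2.trans e3)⟩⟩
    rw [← hcard, ← List.replicate_append_replicate]
    exact attachedCells_append _ _ hZ1 hZ3

/-- Bounded smooth vector fields subject to convex constraints along a closed set can be
constructed locally. -/
lemma exists_bounded_field {n : ℕ} {X : Set (Fin n → ℂ)} (hX : IsClosed X)
    (t : (Fin n → ℂ) → Set (Fin n → ℂ)) (ht : ∀ x ∈ X, Convex ℝ (t x)) (R C : ℝ) (hC : 0 ≤ C)
    (hloc : ∀ x0 ∈ X, ∃ U ∈ 𝓝 x0, ∃ g : (Fin n → ℂ) → (Fin n → ℂ), ContDiffOn ℝ (⊤ : ℕ∞) g U ∧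
      (∀ x ∈ U, x ∈ X → g x ∈ t x) ∧ ∀ x ∈ U, R ≤ ‖x‖ → ‖g x‖ ≤ C) :
    ∃ V : (Fin n → ℂ) → (Fin n → ℂ), ContDiff ℝ (⊤ : ℕ∞) V ∧ (∃ C', ∀ x, ‖V x‖ ≤ C') ∧
      ∀ x ∈ X, V x ∈ t x := by
  obtain ⟨g, hg⟩ := exists_contMDiffMap_forall_mem_convex_of_local
    (I := 𝓘(ℝ, Fin n → ℂ)) (n := ((⊤ : ℕ∞) : ℕ∞))
    (t := fun x => {w | (x ∈ X → w ∈ t x) ∧ (R ≤ ‖x‖ → ‖w‖ ≤ C)}) (by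
      intro x u hu w hw a b ha hb hab
      refine ⟨fun hx => ht x hx (hu.1 hx) (hw.1 hx) ha hb hab, fun hx => ?_⟩
      exact mem_closedBall_zero_iff.1 (convex_closedBall (0 : Fin n → ℂ) C
        (mem_closedBall_zero_iff.2 (hu.2 hx)) (mem_closedBall_zero_iff.2 (hw.2 hx)) ha hb hab)) (by
      intro x0
      by_cases hx0 : x0 ∈ X
      · obtain ⟨U, hU, g, hg, h1, h2⟩ := hloc x0 hx0
        exact ⟨U, hU, g, hg.contMDiffOn, fun x hx => ⟨h1 x hx, h2 x hx⟩⟩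
      · exact ⟨Xᶜ, hX.isOpen_compl.mem_nhds hx0, fun _ => 0, contMDiffOn_const,
          fun x hx => ⟨fun hx' => absurd hx' hx, fun _ => by simpa using hC⟩⟩)
  have hgc : ContDiff ℝ (⊤ : ℕ∞) g := g.contMDiff.contDiff
  obtain ⟨C', hC'⟩ := (isCompact_closedBall (0 : Fin n → ℂ) R).exists_bound_of_continuousOn
    hgc.continuous.continuousOn
  refine ⟨g, hgc, ⟨max C' C, fun x => ?_⟩, fun x hx => (hg x).1 hx⟩
  rcases le_total R ‖x‖ with h | h
  · exact ((hg x).2 h).trans (le_max_right _ _)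
  · exact (hC' x (mem_closedBall_zero_iff.2 h)).trans (le_max_left _ _)

lemma LCIChart.contDiffOn_section {n r d : ℕ} {X : Set (Fin n → ℂ)} {x0 : Fin n → ℂ}
    (C : LCIChart X r d x0) {w : (Fin n → ℂ) → (Fin r → ℂ) × (Fin d → ℂ)}
    (hw : ContDiff ℝ (⊤ : ℕ∞) w) :
    ContDiffOn ℝ (⊤ : ℕ∞) (fun x => fderiv ℂ C.e.symm (C.e x) (w x)) C.e.source := by
  intro x hx
  refine ContDiffAt.contDiffWithinAt (ContDiffAt.clm_apply_complex ?_ hw.contDiffAt)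
  have h1 : ContDiffOn ℂ ⊤ (fderiv ℂ C.e.symm) C.e.target :=
    C.contDiffOn_symm.fderiv_of_isOpen C.e.open_target (by simp)
  have h2 := (h1.contDiffAt (C.e.open_target.mem_nhds (C.e.map_source hx))).comp x
    C.contDiff.contDiffAt
  exact (h2.restrict_scalars ℝ).of_le le_top

lemma LCIChart.section_mem {n r d : ℕ} {X : Set (Fin n → ℂ)} {x0 : Fin n → ℂ}
    (C : LCIChart X r d x0) {x : Fin n → ℂ} (hx : x ∈ C.e.source) (hxX : x ∈ X) (t : Fin d → ℂ) :
    fderiv ℂ C.e.symm (C.e x) (0, t) ∈ zTangent X x := by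
  refine C.mem_zTangent_of_fst_eq_zero hx hxX ?_
  have := C.fderiv_fderiv_symm (C.e.map_source hx) (0, t)
  rw [C.e.left_inv hx] at this
  rw [this]

lemma IsLCI.exists_section {n r d : ℕ} {X : Set (Fin n → ℂ)} (h : IsLCI X r) (hrd : r + d = n)
    {x0 : Fin n → ℂ} (hx0 : x0 ∈ X) {u : Fin n → ℂ} (hu : u ∈ zTangent X x0) :
    ∃ U, IsOpen U ∧ x0 ∈ U ∧ ∃ g : (Fin n → ℂ) → (Fin n → ℂ), ContDiffOn ℝ (⊤ : ℕ∞) g U ∧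
      g x0 = u ∧ ∀ x ∈ U, x ∈ X → g x ∈ zTangent X x := by
  obtain ⟨π, hπ⟩ := exists_proj_injOn (h.finrank_zTangent hrd hx0)
  obtain ⟨C, -⟩ := h.exists_chart hrd hx0 π hπ
  have h0 : fderiv ℂ C.e x0 u = (0, (fderiv ℂ C.e x0 u).2) :=
    Prod.ext (C.fst_eq_zero x0 C.mem_source hx0 u hu) rfl
  refine ⟨C.e.source, C.e.open_source, C.mem_source,
    fun x => fderiv ℂ C.e.symm (C.e x) (0, (fderiv ℂ C.e x0 u).2),
    C.contDiffOn_section contDiff_const, ?_, fun x hx hxX => C.section_mem hx hxX _⟩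
  simp only
  rw [← h0, C.fderiv_symm_fderiv C.mem_source]

lemma IsLCI.exists_section_eq_one {n r d : ℕ} {X : Set (Fin n → ℂ)} (h : IsLCI X r)
    (hrd : r + d = n) (ℓ : (Fin n → ℂ) →L[ℂ] ℂ)
    {x0 : Fin n → ℂ} (hx0 : x0 ∈ X) {u : Fin n → ℂ} (hu : u ∈ zTangent X x0) (hℓ : ℓ u = 1) :
    ∃ U, IsOpen U ∧ x0 ∈ U ∧ ∃ g : (Fin n → ℂ) → (Fin n → ℂ), ContDiffOn ℝ (⊤ : ℕ∞) g U ∧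
      g x0 = u ∧ ∀ x ∈ U, x ∈ X → g x ∈ zTangent X x ∧ ℓ (g x) = 1 := by
  obtain ⟨U, hU, hxU, g, hg, hg0, hgT⟩ := h.exists_section hrd hx0 hu
  have hℓg : ContDiffOn ℝ (⊤ : ℕ∞) (fun x => ℓ (g x)) U :=
    (ℓ.restrictScalars ℝ).contDiff.comp_contDiffOn hg
  have hopen : IsOpen (U ∩ (fun x => ℓ (g x)) ⁻¹' {0}ᶜ) :=
    hℓg.continuousOn.isOpen_inter_preimage hU isOpen_compl_singleton
  refine ⟨_, hopen, ⟨hxU, by simp [hg0, hℓ]⟩, fun x => (ℓ (g x))⁻¹ • g x, ?_, ?_, ?_⟩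
  · have hc := (hℓg.mono Set.inter_subset_left).inv fun x (hx : x ∈ U ∩ _) => hx.2
    rw [contDiffOn_pi]
    intro i
    exact hc.mul (contDiffOn_pi.1 (hg.mono Set.inter_subset_left) i)
  · simp [hg0, hℓ]
  · intro x hx hxX
    refine ⟨Submodule.smul_mem _ _ (hgT x hx.1 hxX), ?_⟩
    rw [map_smul, smul_eq_mul, inv_mul_cancel₀ hx.2]

/-- A bounded tangent field along which `ℓ` has derivative `1` away from a neighbourhood of its
critical points. -/
lemma IsLCI.exists_unit_field {n r d : ℕ} {X : Set (Fin n → ℂ)} (h : IsLCI X r) (hrd : r + d = n)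
    (ℓ : (Fin n → ℂ) →L[ℂ] ℂ) {N : Set (Fin n → ℂ)} (hN : IsOpen N)
    (hcrit : ∀ x ∈ X, (∀ v ∈ zTangent X x, ℓ v = 0) → x ∈ N) {R C : ℝ}
    (hinf : ∀ x ∈ X, R ≤ ‖x‖ → ∃ u ∈ zTangent X x, ℓ u = 1 ∧ ‖u‖ ≤ C) :
    ∃ V : (Fin n → ℂ) → (Fin n → ℂ), ContDiff ℝ (⊤ : ℕ∞) V ∧ (∃ C', ∀ x, ‖V x‖ ≤ C') ∧
      ∀ x ∈ X, V x ∈ zTangent X x ∧ (x ∉ N → ℓ (V x) = 1) := by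
  refine exists_bounded_field h.isClosed
    (fun x => {w | w ∈ zTangent X x ∧ (x ∉ N → ℓ w = 1)}) ?_ R (max C 0 + 1) (by positivity) ?_
  · intro x _ u hu w hw α β hα hβ hαβ
    refine ⟨((zTangent X x).restrictScalars ℝ).convex hu.1 hw.1 hα hβ hαβ, fun hx => ?_⟩
    have e1 : ℓ (α • u) = α • ℓ u := (ℓ.restrictScalars ℝ).map_smul α u
    have e2 : ℓ (β • w) = β • ℓ w := (ℓ.restrictScalars ℝ).map_smul β w
    rw [map_add, e1, e2, hu.2 hx, hw.2 hx, ← add_smul, hαβ, one_smul]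
  intro x0 hx0
  by_cases hR : R ≤ ‖x0‖
  · obtain ⟨u, hu, hu1, huC⟩ := hinf x0 hx0 hR
    obtain ⟨U, hU, hxU, g, hg, hg0, hgT⟩ := h.exists_section_eq_one hrd ℓ hx0 hu hu1
    have hopen : IsOpen (U ∩ g ⁻¹' Metric.ball 0 (max C 0 + 1)) :=
      hg.continuousOn.isOpen_inter_preimage hU Metric.isOpen_ball
    refine ⟨_, hopen.mem_nhds ⟨hxU, ?_⟩, g, hg.mono Set.inter_subset_left,
      fun x hx hxX => ⟨(hgT x hx.1 hxX).1, fun _ => (hgT x hx.1 hxX).2⟩,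
      fun x hx _ => (mem_ball_zero_iff.1 hx.2).le⟩
    rw [Set.mem_preimage, hg0, mem_ball_zero_iff]
    exact (huC.trans (le_max_left _ _)).trans_lt (lt_add_one _)
  · by_cases hxN : x0 ∈ N
    · exact ⟨N, hN.mem_nhds hxN, fun _ => 0, contDiffOn_const,
        fun x hx _ => ⟨zero_mem _, fun h => absurd hx h⟩, fun x _ _ => by simp; positivity⟩
    · obtain ⟨u, hu, hu1⟩ : ∃ u ∈ zTangent X x0, ℓ u = 1 := by
        have := mt (hcrit x0 hx0) hxN
        push Not at this
        obtain ⟨v, hv, hv0⟩ := this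
        exact ⟨(ℓ v)⁻¹ • v, Submodule.smul_mem _ _ hv, by
          rw [map_smul, smul_eq_mul, inv_mul_cancel₀ hv0]⟩
      obtain ⟨U, hU, hxU, g, hg, hg0, hgT⟩ := h.exists_section_eq_one hrd ℓ hx0 hu hu1
      refine ⟨U ∩ {x | ‖x‖ < R}, (hU.inter (isOpen_lt continuous_norm continuous_const)).mem_nhds
        ⟨hxU, not_le.1 hR⟩, g, hg.mono Set.inter_subset_left,
        fun x hx hxX => ⟨(hgT x hx.1 hxX).1, fun _ => (hgT x hx.1 hxX).2⟩,
        fun x hx hxR => absurd hx.2 (not_lt.2 hxR)⟩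

lemma exists_sum_squares {M : Type} [AddCommGroup M] [Module ℂ M] [FiniteDimensional ℂ M] {d : ℕ}
    (hd : Module.finrank ℂ M = d) (B : M →ₗ[ℂ] M →ₗ[ℂ] ℂ) (hB : ∀ x y, B x y = B y x)
    (hnd : ∀ x, (∀ y, B x y = 0) → x = 0) :
    ∃ f : M ≃ₗ[ℂ] (Fin d → ℂ), ∀ x y, B x y = ∑ k, f x k * f y k := by
  subst hd
  have h1 := QuadraticMap.associated_left_inverse (R := ℂ) (S := ℂ) (B₁ := B) hB
  obtain ⟨f⟩ := QuadraticForm.equivalent_weightedSumSquares_of_isAlgClosed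
    (LinearMap.BilinMap.toQuadraticMap B) (by rw [h1]; exact hnd)
  have h2 : ∀ x, B x x = ∑ k, f x k * f x k := fun x => by
    have := f.map_app x
    rw [QuadraticMap.weightedSumSquares_apply] at this
    simpa using this.symm
  refine ⟨f.toLinearEquiv, fun x y => ?_⟩
  have h3 := h2 (x + y)
  have h4 : f (x + y) = f x + f y := f.toLinearEquiv.map_add x y
  have h5 : ∑ k, f (x + y) k * f (x + y) k = ∑ k, f x k * f x k + ∑ k, f y k * f y k
      + 2 * ∑ k, f x k * f y k := by
    rw [h4, Finset.mul_sum, ← Finset.sum_add_distrib, ← Finset.sum_add_distrib]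
    exact Finset.sum_congr rfl fun k _ => by simp only [Pi.add_apply]; ring
  rw [h5, ← h2, ← h2] at h3
  simp only [map_add, LinearMap.add_apply, hB y x] at h3
  have h6 : 2 * B x y = 2 * ∑ k, f x k * f y k := by linear_combination h3
  exact mul_left_cancel₀ two_ne_zero h6

/-- The Hessian form as a bilinear map. -/
def polyHessBilin {n : ℕ} (L : MvPolynomial (Fin n) ℂ) (x : Fin n → ℂ) :
    (Fin n → ℂ) →ₗ[ℂ] (Fin n → ℂ) →ₗ[ℂ] ℂ :=
  LinearMap.mk₂ ℂ (polyHess L x)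
    (fun u v w => by simp [polyHess, polyDer_apply, mul_add, add_mul, Finset.sum_add_distrib])
    (fun c u w => by
      simp only [polyHess, polyDer_apply, Pi.smul_apply, smul_eq_mul, Finset.mul_sum,
        Finset.sum_mul]
      exact Finset.sum_congr rfl fun i _ => Finset.sum_congr rfl fun j _ => by ring)
    (fun u v w => by simp [polyHess, mul_add, Finset.sum_add_distrib])
    (fun c u w => by
      simp only [polyHess, Pi.smul_apply, smul_eq_mul, Finset.mul_sum]
      exact Finset.sum_congr rfl fun i _ => by ring)

lemma polyHessBilin_apply {n : ℕ} (L : MvPolynomial (Fin n) ℂ) (x u v : Fin n → ℂ) :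
    polyHessBilin L x u v = polyHess L x u v := rfl

lemma polyHess_bound {n : ℕ} (L : MvPolynomial (Fin n) ℂ) (x : Fin n → ℂ) :
    ∃ C, 0 ≤ C ∧ ∀ u v, ‖polyHess L x u v‖ ≤ C * ‖u‖ * ‖v‖ := by
  refine ⟨∑ k, ‖polyDiff (MvPolynomial.pderiv k L) x‖, by positivity, fun u v => ?_⟩
  rw [polyHess, Finset.sum_mul, Finset.sum_mul]
  refine (norm_sum_le _ _).trans (Finset.sum_le_sum fun k _ => ?_)
  rw [norm_mul, ← polyDiff_apply]
  gcongr
  · exact ContinuousLinearMap.le_opNorm _ _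
  · exact norm_le_pi_norm v k

/-- Coordinates on the tangent space in which the Hessian is a sum of squares. -/
lemma exists_morse_coords {n d : ℕ} {T : Submodule ℂ (Fin n → ℂ)} (hT : Module.finrank ℂ T = d)
    (L : MvPolynomial (Fin n) ℂ) (p : Fin n → ℂ) {A : ℂ} (hA : A ≠ 0)
    (hnd : ∀ u ∈ T, (∀ v ∈ T, polyHess L p u v = 0) → u = 0) :
    ∃ π : (Fin n → ℂ) →L[ℂ] (Fin d → ℂ), (∀ v ∈ T, π v = 0 → v = 0) ∧
      ∀ u ∈ T, ∀ v ∈ T, A * polyHess L p u v = ∑ k, π u k * π v k := by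
  obtain ⟨f, hf⟩ := exists_sum_squares hT (A • (polyHessBilin L p).compl₁₂ T.subtype T.subtype)
    (fun x y => by simp [polyHessBilin_apply, polyHess_comm L p x y]) (fun x hx => by
      refine Subtype.ext (hnd x x.2 fun v hv => ?_)
      have := hx ⟨v, hv⟩
      simpa [polyHessBilin_apply, hA] using this)
  obtain ⟨π, hπ⟩ := exists_continuous_extend (f : T →ₗ[ℂ] (Fin d → ℂ))
  refine ⟨π, fun v hv h => ?_, fun u hu v hv => ?_⟩
  · rw [hπ ⟨v, hv⟩] at h
    exact congrArg Subtype.val (f.map_eq_zero_iff.1 h)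
  · rw [hπ ⟨u, hu⟩, hπ ⟨v, hv⟩]
    exact hf ⟨u, hu⟩ ⟨v, hv⟩

lemma polyDer_near {n : ℕ} {L : MvPolynomial (Fin n) ℂ} {p : Fin n → ℂ}
    (hL : ∀ k, MvPolynomial.eval p (MvPolynomial.pderiv k L) = 0) {ε : ℝ} (hε : 0 < ε) :
    ∀ᶠ x in 𝓝 p, ∀ w, ‖polyDer x w L - polyHess L p (x - p) w‖ ≤ ε * ‖x - p‖ * ‖w‖ := by
  have h1 : ∀ k, ∀ᶠ x in 𝓝 p, ‖MvPolynomial.eval x (MvPolynomial.pderiv k L) -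
      polyDer p (x - p) (MvPolynomial.pderiv k L)‖ ≤ ε / (n + 1) * ‖x - p‖ := fun k => by
    have := (hasFDerivAt_eval (MvPolynomial.pderiv k L) p).isLittleO.def
      (c := ε / (n + 1)) (by positivity)
    filter_upwards [this] with x hx
    rwa [hL, sub_zero, polyDiff_apply] at hx
  filter_upwards [eventually_all.2 h1] with x hx w
  rw [polyDer_apply, polyHess, ← Finset.sum_sub_distrib]
  simp only [← sub_mul]
  refine (norm_sum_le _ _).trans ?_
  calc _ ≤ ∑ _k : Fin n, ε / (n + 1) * ‖x - p‖ * ‖w‖ := Finset.sum_le_sum fun k _ => by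
        rw [norm_mul]
        gcongr
        · exact hx k
        · exact norm_le_pi_norm w k
    _ = n * (ε / (n + 1) * ‖x - p‖ * ‖w‖) := by simp
    _ = n / (n + 1) * (ε * ‖x - p‖ * ‖w‖) := by ring
    _ ≤ 1 * (ε * ‖x - p‖ * ‖w‖) := by
        gcongr
        rw [div_le_one (by positivity)]
        linarith
    _ = _ := one_mul _

lemma eval_near {n : ℕ} {L : MvPolynomial (Fin n) ℂ} {p : Fin n → ℂ}
    (hL : ∀ k, MvPolynomial.eval p (MvPolynomial.pderiv k L) = 0) {ε : ℝ} (hε : 0 < ε) :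
    ∀ᶠ x in 𝓝 p, ‖MvPolynomial.eval x L - MvPolynomial.eval p L -
      polyHess L p (x - p) (x - p) / 2‖ ≤ ε * ‖x - p‖ ^ 2 := by
  obtain ⟨δ, hδ, hb⟩ := Metric.eventually_nhds_iff_ball.1 (polyDer_near hL hε)
  filter_upwards [Metric.ball_mem_nhds p hδ] with x hx
  set u := x - p with hu
  have huδ : ‖u‖ < δ := by rwa [hu, ← dist_eq_norm]
  have hγ : ∀ s : ℝ, HasDerivAt (fun s : ℝ => p + (s : ℂ) • u) u s := fun s => by
    have h1 : HasDerivAt (fun s : ℝ => (s : ℂ)) 1 s := Complex.ofRealCLM.hasDerivAt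
    have := (h1.smul_const u).const_add p
    rwa [one_smul] at this
  have hder : ∀ s : ℝ, HasDerivAt (fun s : ℝ => MvPolynomial.eval (p + (s : ℂ) • u) L -
      (s : ℂ) ^ 2 * (polyHess L p u u / 2))
      (polyDer (p + (s : ℂ) • u) u L - s * polyHess L p u u) s := fun s => by
    have h1 := ((hasFDerivAt_eval L (p + (s : ℂ) • u)).restrictScalars ℝ).comp_hasDerivAt s (hγ s)
    have h2 : HasDerivAt (fun s : ℝ => (s : ℂ)) 1 s := Complex.ofRealCLM.hasDerivAt
    have h3 := h1.sub ((h2.pow 2).mul_const (polyHess L p u u / 2))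
    have e : polyDer (p + (s : ℂ) • u) u L - s * polyHess L p u u =
      ((polyDiff L (p + (s : ℂ) • u)).restrictScalars ℝ) u -
        (((2 : ℕ) : ℂ) * (s : ℂ) ^ (2 - 1) * 1) * (polyHess L p u u / 2) := by
      rw [ContinuousLinearMap.coe_restrictScalars', polyDiff_apply]
      push_cast; ring
    rw [e]; exact h3
  have hmv := norm_image_sub_le_of_norm_deriv_le_segment_01' (C := ε * ‖u‖ ^ 2)
    (fun s _ => (hder s).hasDerivWithinAt) (fun s hs => by
      have hs1 : ‖(s : ℂ) • u‖ ≤ ‖u‖ := by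
        rw [norm_smul, Complex.norm_real, Real.norm_of_nonneg hs.1]
        exact mul_le_of_le_one_left (norm_nonneg _) hs.2.le
      have h1 := hb (p + (s : ℂ) • u) (by
        rw [Metric.mem_ball, dist_eq_norm, add_sub_cancel_left]
        exact hs1.trans_lt huδ) u
      rw [add_sub_cancel_left] at h1
      have h2 : polyHess L p ((s : ℂ) • u) u = s * polyHess L p u u := by
        rw [← polyHessBilin_apply, map_smul, LinearMap.smul_apply, smul_eq_mul,
          polyHessBilin_apply]
      rw [h2] at h1
      refine h1.trans ?_
      rw [sq, ← mul_assoc]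
      gcongr)
  have e1 : p + u = x := by rw [hu]; abel
  simpa [e1, sub_right_comm] using hmv

lemma LCIChart.proj_section {n r d : ℕ} {X : Set (Fin n → ℂ)} {p : Fin n → ℂ}
    (C : LCIChart X r d p) {π : (Fin n → ℂ) →L[ℂ] (Fin d → ℂ)}
    (hπ : ∀ y, (C.e y).2 = π (y - p)) {z : (Fin r → ℂ) × (Fin d → ℂ)} (hz : z ∈ C.e.target)
    (w : (Fin r → ℂ) × (Fin d → ℂ)) : π (fderiv ℂ C.e.symm z w) = w.2 := by
  have h1 := (ContinuousLinearMap.snd ℂ (Fin r → ℂ) (Fin d → ℂ)).hasFDerivAt.comp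
    (C.e.symm z) (C.hasFDerivAt (C.e.symm z))
  have h2 : HasFDerivAt (fun y => π (y - p)) π (C.e.symm z) := by
    have := π.hasFDerivAt.comp (C.e.symm z) ((hasFDerivAt_id (C.e.symm z)).sub_const p)
    simpa using this
  have h3 : (fun y => π (y - p)) = ContinuousLinearMap.snd ℂ (Fin r → ℂ) (Fin d → ℂ) ∘ C.e :=
    funext fun y => (hπ y).symm
  rw [h3] at h2
  have h4 := congrArg (fun F => F (fderiv ℂ C.e.symm z w)) (h2.unique h1)
  have h5 := C.fderiv_fderiv_symm hz w
  refine h4.trans ?_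
  exact congrArg Prod.snd h5

lemma polyDer_eq_of_tangent {n : ℕ} {X : Set (Fin n → ℂ)} (ℓ : (Fin n → ℂ) →L[ℂ] ℂ)
    {L : MvPolynomial (Fin n) ℂ} (hL : ∀ y ∈ X, MvPolynomial.eval y L = ℓ y)
    {x w : Fin n → ℂ} (hw : w ∈ zTangent X x) : polyDer x w L = ℓ w := by
  let q : MvPolynomial (Fin n) ℂ := ∑ k, MvPolynomial.C (ℓ (Pi.single k 1)) * MvPolynomial.X k
  have hℓ : ∀ y : Fin n → ℂ, ℓ y = ∑ k, ℓ (Pi.single k 1) * y k := fun y => by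
    conv_lhs => rw [pi_eq_sum_univ' y, map_sum]
    refine Finset.sum_congr rfl fun k _ => ?_
    rw [map_smul, smul_eq_mul, mul_comm]
  have h1 := mem_zTangent_iff.1 hw (L - q) fun y hy => by
    rw [map_sub, hL y hy, hℓ y]; simp [q]
  rw [map_sub, sub_eq_zero] at h1
  rw [h1, hℓ w]
  simp [q, polyDer_mul, polyDer_X, polyDer_C]

lemma morse_estimate {w h0 h1 s A B : ℂ} {η Z t M K : ℝ} (hη : 0 ≤ η) (hη1 : η ≤ 1)
    (hK : 0 ≤ K) (hZ : 0 ≤ Z) (ht : 0 ≤ t)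
    (e1 : ‖w - h1‖ ≤ η * (M * Z) * (M * t)) (e2 : ‖h1 - h0‖ ≤ K * (2 * M * η) * Z * t)
    (e3 : A * h0 = s) (e4 : ‖B - A‖ ≤ η) (e5 : ‖h1‖ ≤ K * (M * Z) * (M * t)) :
    ‖B * w - s‖ ≤ η * ((M ^ 2 + K * M ^ 2) + ‖A‖ * (M ^ 2 + 2 * K * M)) * Z * t := by
  have hid : B * w - s = (B - A) * w + A * (w - h1) + A * (h1 - h0) := by rw [← e3]; ring
  have hw : ‖w‖ ≤ (M ^ 2 + K * M ^ 2) * Z * t := by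
    have h2 : ‖w‖ ≤ ‖w - h1‖ + ‖h1‖ := by simpa using norm_add_le (w - h1) h1
    have h3 : η * (M * Z) * (M * t) ≤ 1 * (M ^ 2 * Z * t) := by
      rw [show η * (M * Z) * (M * t) = η * (M ^ 2 * Z * t) by ring]
      gcongr
    nlinarith
  rw [hid]
  refine (norm_add_le _ _).trans ((add_le_add (norm_add_le _ _) le_rfl).trans ?_)
  rw [norm_mul, norm_mul, norm_mul]
  have h5 : ‖B - A‖ * ‖w‖ ≤ η * ((M ^ 2 + K * M ^ 2) * Z * t) := by gcongr
  have h6 := mul_le_mul_of_nonneg_left e1 (norm_nonneg A)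
  have h7 := mul_le_mul_of_nonneg_left e2 (norm_nonneg A)
  nlinarith

lemma morse_value_estimate {A δ s h0 h1 : ℂ} {η Z M K : ℝ} (hη : 0 ≤ η) (hη1 : η ≤ 1)
    (hK : 0 ≤ K) (hM : 0 ≤ M)
    (e1 : ‖δ - h1 / 2‖ ≤ η * (M * Z) ^ 2) (e2 : ‖h1 - h0‖ ≤ K * (2 * M * η) * Z * Z)
    (e3 : (starRingEnd ℂ A) * h0 = s) (e4 : ‖δ‖ ≤ η) (e5 : ‖h1‖ ≤ K * (M * Z) * (M * Z)) :
    |‖A + δ‖ ^ 2 - ‖A‖ ^ 2 - s.re| ≤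
      η * ((M ^ 2 + K * M ^ 2) + 2 * (‖A‖ * (M ^ 2 + 2 * K * M))) * Z ^ 2 := by
  have hδ : ‖δ‖ ≤ (M ^ 2 + K * M ^ 2) * Z ^ 2 := by
    have h2 : ‖δ‖ ≤ ‖δ - h1 / 2‖ + ‖h1 / 2‖ := by simpa using norm_add_le (δ - h1 / 2) (h1 / 2)
    have h3 : η * (M * Z) ^ 2 ≤ 1 * (M * Z) ^ 2 := by gcongr
    have h4 : ‖h1 / 2‖ = ‖h1‖ / 2 := by simp
    have h5 : 0 ≤ K * (M * Z) * (M * Z) := by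
      rw [mul_assoc]; exact mul_nonneg hK (mul_self_nonneg _)
    nlinarith
  have hid : ‖A + δ‖ ^ 2 - ‖A‖ ^ 2 - s.re =
      (2 * (starRingEnd ℂ A * (δ - h1 / 2)) + starRingEnd ℂ A * (h1 - h0)).re + ‖δ‖ ^ 2 := by
    rw [← e3]
    simp only [← Complex.normSq_eq_norm_sq, Complex.normSq_apply, Complex.add_re, Complex.add_im,
      Complex.mul_re, Complex.mul_im, Complex.conj_re, Complex.conj_im, Complex.sub_re,
      Complex.sub_im, Complex.re_ofNat, Complex.im_ofNat]
    have r1 : (h1 / 2).re = h1.re / 2 := by simp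
    have r2 : (h1 / 2).im = h1.im / 2 := by simp
    rw [r1, r2]
    ring
  rw [hid]
  refine (abs_add_le _ _).trans ?_
  have h3 := (Complex.abs_re_le_norm (2 * (starRingEnd ℂ A * (δ - h1 / 2)) +
    starRingEnd ℂ A * (h1 - h0))).trans (norm_add_le _ _)
  rw [norm_mul, norm_mul, norm_mul, RCLike.norm_conj, Complex.norm_ofNat] at h3
  have h4 := mul_le_mul_of_nonneg_left e1 (norm_nonneg A)
  have h5 := mul_le_mul_of_nonneg_left e2 (norm_nonneg A)
  have h6 : |‖δ‖ ^ 2| ≤ η * ((M ^ 2 + K * M ^ 2) * Z ^ 2) := by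
    rw [abs_of_nonneg (by positivity), sq]
    gcongr
  have h7 : 0 ≤ ‖A‖ * (K * (2 * M * η) * Z * Z) := by
    rw [mul_assoc _ Z Z]
    exact mul_nonneg (norm_nonneg _) (mul_nonneg (by positivity) (mul_self_nonneg _))
  nlinarith

/-- Near a nondegenerate critical point of `ℓ` there is a chart in which `|ℓ - c| ^ 2` is, to
second order, the real part of a sum of squares. -/
lemma IsLCI.exists_morse_chart {n r d : ℕ} {X : Set (Fin n → ℂ)} (h : IsLCI X r) (hrd : r + d = n)
    (ℓ : (Fin n → ℂ) →L[ℂ] ℂ) {c : ℂ} {p : Fin n → ℂ} (hp : p ∈ X) (hA : ℓ p ≠ c)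
    {L : MvPolynomial (Fin n) ℂ} (hL : ∀ y ∈ X, MvPolynomial.eval y L = ℓ y)
    (hL0 : ∀ k, MvPolynomial.eval p (MvPolynomial.pderiv k L) = 0)
    (hnd : ∀ u ∈ zTangent X p, (∀ v ∈ zTangent X p, polyHess L p u v = 0) → u = 0) :
    ∃ (π : (Fin n → ℂ) →L[ℂ] (Fin d → ℂ)) (C : LCIChart X r d p) (M : ℝ), 0 < M ∧
      (∀ y, (C.e y).2 = π (y - p)) ∧
      (∀ᶠ x in 𝓝 p, x ∈ C.e.source ∧ (x ∈ X → ‖x - p‖ ≤ M * ‖π (x - p)‖) ∧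
        ∀ t, ‖fderiv ℂ C.e.symm (C.e x) (0, t)‖ ≤ M * ‖t‖) ∧
      ∀ ε > 0, ∀ᶠ x in 𝓝 p, x ∈ X →
        (∀ t, ‖starRingEnd ℂ (ℓ x - c) * ℓ (fderiv ℂ C.e.symm (C.e x) (0, t)) -
          ∑ k, π (x - p) k * t k‖ ≤ ε * ‖π (x - p)‖ * ‖t‖) ∧
        |‖ℓ x - c‖ ^ 2 - ‖ℓ p - c‖ ^ 2 - (∑ k, π (x - p) k * π (x - p) k).re| ≤
          ε * ‖π (x - p)‖ ^ 2 := by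
  have hA' : ℓ p - c ≠ 0 := sub_ne_zero.2 hA
  obtain ⟨π, hinj, hsq⟩ := exists_morse_coords (h.finrank_zTangent hrd hp) L p
    ((map_ne_zero (starRingEnd ℂ)).2 hA') hnd
  obtain ⟨C, hC⟩ := h.exists_chart hrd hp π hinj
  have h0t : (0 : (Fin r → ℂ) × (Fin d → ℂ)) ∈ C.e.target := by
    rw [← C.map_center]; exact C.e.map_source C.mem_source
  set D := fderiv ℂ C.e.symm 0 with hD
  obtain ⟨K, hK, hKb⟩ := polyHess_bound L p
  set M := ‖D‖ + 1 with hM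
  have hM0 : 0 < M := by positivity
  have hcont : ContinuousAt (fun x => fderiv ℂ C.e.symm (C.e x)) p := by
    have h1 : ContinuousAt (fderiv ℂ C.e.symm) (C.e p) := by
      have h2 : ContDiffOn ℂ ⊤ (fderiv ℂ C.e.symm) C.e.target :=
        C.contDiffOn_symm.fderiv_of_isOpen C.e.open_target (by simp)
      exact h2.continuousOn.continuousAt (C.e.open_target.mem_nhds (by rwa [C.map_center]))
    exact h1.comp C.contDiff.continuous.continuousAt
  have hS : ∀ η > 0, ∀ᶠ x in 𝓝 p, ∀ t, ‖fderiv ℂ C.e.symm (C.e x) (0, t) - D (0, t)‖ ≤ η * ‖t‖ :=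
    fun η hη => by
    filter_upwards [Metric.continuousAt_iff'.1 hcont η hη] with x hx t
    rw [C.map_center, dist_eq_norm] at hx
    have h1 := (fderiv ℂ C.e.symm (C.e x) - D).le_opNorm (0, t)
    rw [sub_apply, Prod.norm_mk, norm_zero, max_eq_right (norm_nonneg t)] at h1
    exact h1.trans (by gcongr)
  have hlin : ∀ η > 0, ∀ᶠ x in 𝓝 p, x ∈ X → ‖x - p - D (0, π (x - p))‖ ≤ η * ‖π (x - p)‖ :=
    fun η hη => by
    have h1 := (C.hasFDerivAt_symm h0t).isLittleO.def hη
    have h2 : Tendsto C.e (𝓝 p) (𝓝 0) := by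
      have := C.contDiff.continuous.tendsto p
      rwa [C.map_center] at this
    filter_upwards [h2.eventually h1, C.e.open_source.mem_nhds C.mem_source] with x hx hxs hxX
    have h3 : C.e x = (0, π (x - p)) := Prod.ext ((C.mem_iff x hxs).1 hxX) (hC x)
    have h4 : C.e.symm 0 = p := by rw [← C.map_center, C.e.left_inv C.mem_source]
    rw [C.e.left_inv hxs, h4, sub_zero, h3, Prod.norm_mk, norm_zero,
      max_eq_right (norm_nonneg _)] at hx
    exact hx
  have hDb : ∀ t, ‖D (0, t)‖ ≤ ‖D‖ * ‖t‖ := fun t => by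
    have h1 := D.le_opNorm (0, t)
    rwa [Prod.norm_mk, norm_zero, max_eq_right (norm_nonneg t)] at h1
  have hDT : ∀ t, D (0, t) ∈ zTangent X p := fun t => by
    have := C.section_mem C.mem_source hp t
    rwa [C.map_center] at this
  have hπD : ∀ t, π (D (0, t)) = t := fun t => C.proj_section hC h0t (0, t)
  have hfirst : ∀ᶠ x in 𝓝 p, x ∈ C.e.source ∧ (x ∈ X → ‖x - p‖ ≤ M * ‖π (x - p)‖) ∧
        ∀ t, ‖fderiv ℂ C.e.symm (C.e x) (0, t)‖ ≤ M * ‖t‖ := by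
    filter_upwards [C.e.open_source.mem_nhds C.mem_source, hS 1 one_pos, hlin 1 one_pos] with
      x hx h1 h2
    refine ⟨hx, fun hxX => ?_, fun t => ?_⟩
    · have h3 := norm_add_le (x - p - D (0, π (x - p))) (D (0, π (x - p)))
      rw [sub_add_cancel] at h3
      have h4 := h2 hxX
      have h5 := hDb (π (x - p))
      rw [hM]; linarith
    · have h3 := norm_add_le (fderiv ℂ C.e.symm (C.e x) (0, t) - D (0, t)) (D (0, t))
      rw [sub_add_cancel] at h3
      have h4 := h1 t
      have h5 := hDb t
      rw [hM]; linarith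
  refine ⟨π, C, M, hM0, hC, hfirst, fun ε hε => ?_⟩
  set A := ℓ p - c with hAdef
  set Q := (M ^ 2 + K * M ^ 2) + 2 * (‖A‖ * (M ^ 2 + 2 * K * M)) with hQ
  have hQ0 : 0 ≤ Q := by positivity
  set η := min 1 (ε / (Q + 1)) with hηdef
  have hη : 0 < η := by positivity
  have hη1 : η ≤ 1 := min_le_left _ _
  have hηQ : η * Q ≤ ε := by
    have h1 : η * Q ≤ ε / (Q + 1) * (Q + 1) := by
      gcongr
      · exact min_le_right _ _
      · linarith
    rwa [div_mul_cancel₀ _ (by positivity)] at h1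
  have hℓc : ∀ᶠ x in 𝓝 p, ‖ℓ x - ℓ p‖ ≤ η := by
    have := Metric.continuousAt_iff'.1 (ℓ.continuous.continuousAt (x := p)) η hη
    filter_upwards [this] with x hx
    rw [dist_eq_norm] at hx
    exact hx.le
  filter_upwards [hfirst, hS η hη, hlin η hη, polyDer_near hL0 hη, eval_near hL0 hη, hℓc] with
    x hx1 hx2 hx3 hx4 hx5 hx6 hxX
  obtain ⟨hxs, hxu, hxw⟩ := hx1
  have hu := hxu hxX
  have hu' := hx3 hxX
  set ζ := π (x - p) with hζ
  set u := x - p with hu_def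
  have hsub : ∀ t, ‖polyHess L p u (fderiv ℂ C.e.symm (C.e x) (0, t)) -
      polyHess L p (D (0, ζ)) (D (0, t))‖ ≤ K * (2 * M * η) * ‖ζ‖ * ‖t‖ := fun t => by
    set w := fderiv ℂ C.e.symm (C.e x) (0, t)
    have e : polyHess L p u w - polyHess L p (D (0, ζ)) (D (0, t)) =
        polyHess L p (u - D (0, ζ)) w + polyHess L p (D (0, ζ)) (w - D (0, t)) := by
      simp only [← polyHessBilin_apply, map_sub, LinearMap.sub_apply]
      ring
    rw [e]
    refine (norm_add_le _ _).trans ?_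
    have g1 : K * ‖u - D (0, ζ)‖ * ‖w‖ ≤ K * (η * ‖ζ‖) * (M * ‖t‖) := by
      gcongr
      exact hxw t
    have g2 : K * ‖D (0, ζ)‖ * ‖w - D (0, t)‖ ≤ K * (M * ‖ζ‖) * (η * ‖t‖) := by
      gcongr
      · refine (hDb ζ).trans ?_
        gcongr
        rw [hM]; linarith
      · exact hx2 t
    have g3 := (hKb (u - D (0, ζ)) w).trans g1
    have g4 := (hKb (D (0, ζ)) (w - D (0, t))).trans g2
    linarith
  have hHD : ∀ t, starRingEnd ℂ A * polyHess L p (D (0, ζ)) (D (0, t)) = ∑ k, ζ k * t k := fun t => by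
    have := hsq _ (hDT ζ) _ (hDT t)
    rwa [hπD, hπD] at this
  have hHb : ∀ w, ‖polyHess L p u w‖ ≤ K * (M * ‖ζ‖) * ‖w‖ := fun w =>
    (hKb u w).trans (by gcongr)
  refine ⟨fun t => ?_, ?_⟩
  · have hw := C.section_mem hxs hxX t
    have h4 := hx4 (fderiv ℂ C.e.symm (C.e x) (0, t))
    rw [polyDer_eq_of_tangent ℓ hL hw] at h4
    have e1 : η * ‖u‖ * ‖fderiv ℂ C.e.symm (C.e x) (0, t)‖ ≤ η * (M * ‖ζ‖) * (M * ‖t‖) := by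
      gcongr
      exact hxw t
    have e5 : K * (M * ‖ζ‖) * ‖fderiv ℂ C.e.symm (C.e x) (0, t)‖ ≤
        K * (M * ‖ζ‖) * (M * ‖t‖) := by
      gcongr
      exact hxw t
    have e4 : ‖starRingEnd ℂ (ℓ x - c) - starRingEnd ℂ A‖ ≤ η := by
      rw [← map_sub, RCLike.norm_conj, hAdef, sub_sub_sub_cancel_right]
      exact hx6
    refine (morse_estimate hη.le hη1 hK (norm_nonneg ζ) (norm_nonneg t) (h4.trans e1) (hsub t)
      (hHD t) e4 ((hHb _).trans e5)).trans ?_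
    rw [RCLike.norm_conj]
    gcongr
    refine le_trans ?_ hηQ
    gcongr
    have : 0 ≤ ‖A‖ * (M ^ 2 + 2 * K * M) := by positivity
    rw [hQ]; linarith
  · have hxp : ‖(ℓ x - ℓ p) - polyHess L p u u / 2‖ ≤ η * (M * ‖ζ‖) ^ 2 := by
      rw [hL x hxX, hL p hp] at hx5
      exact hx5.trans (by gcongr)
    have hsub' : ‖polyHess L p u u - polyHess L p (D (0, ζ)) (D (0, ζ))‖ ≤
        K * (2 * M * η) * ‖ζ‖ * ‖ζ‖ := by
      have e : polyHess L p u u - polyHess L p (D (0, ζ)) (D (0, ζ)) =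
          polyHess L p (u - D (0, ζ)) u + polyHess L p (D (0, ζ)) (u - D (0, ζ)) := by
        simp only [← polyHessBilin_apply, map_sub, LinearMap.sub_apply]
        ring
      rw [e]
      refine (norm_add_le _ _).trans ?_
      have g1 : K * ‖u - D (0, ζ)‖ * ‖u‖ ≤ K * (η * ‖ζ‖) * (M * ‖ζ‖) := by gcongr
      have g2 : K * ‖D (0, ζ)‖ * ‖u - D (0, ζ)‖ ≤ K * (M * ‖ζ‖) * (η * ‖ζ‖) := by
        gcongr
        refine (hDb ζ).trans ?_
        gcongr
        rw [hM]; linarith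
      have g3 := (hKb (u - D (0, ζ)) u).trans g1
      have g4 := (hKb (D (0, ζ)) (u - D (0, ζ))).trans g2
      linarith
    have hfin := morse_value_estimate hη.le hη1 hK hM0.le hxp hsub' (hHD ζ) hx6
      ((hHb u).trans (by gcongr))
    rw [show A + (ℓ x - ℓ p) = ℓ x - c by rw [hAdef]; ring] at hfin
    refine hfin.trans ?_
    gcongr

lemma norm_sq_le_sum {d : ℕ} (ζ : Fin d → ℂ) : ‖ζ‖ ^ 2 ≤ ∑ k, ‖ζ k‖ ^ 2 := by
  have h0 : 0 ≤ ∑ k, ‖ζ k‖ ^ 2 := by positivity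
  have h1 : ‖ζ‖ ≤ √(∑ k, ‖ζ k‖ ^ 2) := by
    refine (pi_norm_le_iff_of_nonneg (Real.sqrt_nonneg _)).2 fun k => Real.le_sqrt_of_sq_le ?_
    exact Finset.single_le_sum (f := fun k => ‖ζ k‖ ^ 2) (fun _ _ => by positivity)
      (Finset.mem_univ k)
  calc ‖ζ‖ ^ 2 ≤ √(∑ k, ‖ζ k‖ ^ 2) ^ 2 := by gcongr
    _ = _ := Real.sq_sqrt h0

lemma sum_mul_neg_conj {d : ℕ} (ζ : Fin d → ℂ) :
    ∑ k, ζ k * (-starRingEnd ℂ (ζ k)) = -((∑ k, ‖ζ k‖ ^ 2 : ℝ) : ℂ) := by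
  push_cast
  rw [← Finset.sum_neg_distrib]
  refine Finset.sum_congr rfl fun k _ => ?_
  rw [mul_neg, Complex.mul_conj, Complex.normSq_eq_norm_sq]
  push_cast; rfl

lemma norm_neg_conj {d : ℕ} (ζ : Fin d → ℂ) : ‖fun k => -starRingEnd ℂ (ζ k)‖ = ‖ζ‖ := by
  simp [Pi.norm_def, nnnorm_neg]

/-- The points of `X` at which `ℓ` is critical. -/
def critSet {n : ℕ} (X : Set (Fin n → ℂ)) (ℓ : (Fin n → ℂ) →L[ℂ] ℂ) : Set (Fin n → ℂ) :=
  {x | x ∈ X ∧ ∀ v ∈ zTangent X x, ℓ v = 0}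

/-- `GoodPencil`, phrased with a continuous linear form. -/
structure IsGoodPencil {n : ℕ} (X : Set (Fin n → ℂ)) (ℓ : (Fin n → ℂ) →L[ℂ] ℂ) (c : ℂ) :
    Prop where
  noncritical : ∀ x ∈ critSet X ℓ, ℓ x ≠ c
  nondegenerate : ∀ x ∈ critSet X ℓ, ∃ L : MvPolynomial (Fin n) ℂ,
    (∀ y ∈ X, MvPolynomial.eval y L = ℓ y) ∧
    (∀ k, MvPolynomial.eval x (MvPolynomial.pderiv k L) = 0) ∧
    ∀ u ∈ zTangent X x, (∀ v ∈ zTangent X x, polyHess L x u v = 0) → u = 0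
  atInfinity : ∃ R C : ℝ, ∀ x ∈ X, R ≤ ‖x‖ → ∃ u ∈ zTangent X x, ℓ u = 1 ∧ ‖u‖ ≤ C

lemma IsGoodPencil.finite_critSet {n r d : ℕ} {X : Set (Fin n → ℂ)} {ℓ : (Fin n → ℂ) →L[ℂ] ℂ}
    {c : ℂ} (hg : IsGoodPencil X ℓ c) (h : IsLCI X r) (hrd : r + d = n) :
    (critSet X ℓ).Finite := by
  by_contra hinf
  obtain ⟨R, C, hRC⟩ := hg.atInfinity
  have hsub : critSet X ℓ ⊆ Metric.closedBall 0 R := fun x hx => by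
    rw [mem_closedBall_zero_iff]
    by_contra! hlt
    obtain ⟨u, hu, hu1, -⟩ := hRC x hx.1 hlt.le
    exact one_ne_zero (hu1.symm.trans (hx.2 u hu))
  obtain ⟨z, -, hz⟩ := Set.Infinite.exists_accPt_of_subset_isCompact hinf
    (isCompact_closedBall (0 : Fin n → ℂ) R) hsub
  have hzX : z ∈ X := by
    have h1 : z ∈ closure (critSet X ℓ) := hz.clusterPt.mem_closure
    exact h.isClosed.closure_subset_iff.2 (fun x hx => hx.1) h1
  have hfreq := accPt_iff_frequently.1 hz
  by_cases hzK : z ∈ critSet X ℓ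
  · obtain ⟨L, hL, hL0, hnd⟩ := hg.nondegenerate z hzK
    obtain ⟨π, C, M, hM, -, h1, h2⟩ :=
      h.exists_morse_chart hrd ℓ hzX (hg.noncritical z hzK) hL hL0 hnd
    obtain ⟨x, ⟨hxz, hxK⟩, ⟨hxs, hxM, -⟩, h3⟩ := (hfreq.and_eventually
      (h1.and (h2 (1 / 2) (by norm_num)))).exists
    have h4 := (h3 hxK.1).1 fun k => -starRingEnd ℂ (π (x - z) k)
    rw [hxK.2 _ (C.section_mem hxs hxK.1 _), mul_zero, sum_mul_neg_conj, norm_neg_conj,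
      zero_sub, neg_neg, Complex.norm_real, Real.norm_of_nonneg (by positivity)] at h4
    have h5 := norm_sq_le_sum (π (x - z))
    have h6 : ‖π (x - z)‖ = 0 := by nlinarith [norm_nonneg (π (x - z))]
    have h7 := hxM hxK.1
    rw [h6, mul_zero] at h7
    exact hxz (sub_eq_zero.1 (norm_le_zero_iff.1 h7))
  · obtain ⟨u, hu, hu0⟩ : ∃ u ∈ zTangent X z, ℓ u ≠ 0 := by
      by_contra! hcon
      exact hzK ⟨hzX, hcon⟩
    obtain ⟨U, hU, hzU, g, -, -, hgT⟩ := h.exists_section_eq_one hrd ℓ hzX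
      (Submodule.smul_mem _ (ℓ u)⁻¹ hu) (by rw [map_smul, smul_eq_mul, inv_mul_cancel₀ hu0])
    obtain ⟨x, ⟨-, hxK⟩, hxU⟩ := (hfreq.and_eventually (hU.mem_nhds hzU)).exists
    have h1 := hgT x hxU hxK.1
    exact one_ne_zero (h1.2.symm.trans (hxK.2 _ h1.1))

lemma exists_bump (n : ℕ) : ∃ B : ℝ, 0 ≤ B ∧ ∀ (p : Fin n → ℂ) (s : ℝ), 0 < s →
    ∃ β : (Fin n → ℂ) → ℝ, ContDiff ℝ (⊤ : ℕ∞) β ∧ (∀ x, 0 ≤ β x) ∧ (∀ x, β x ≤ 1) ∧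
      (∀ x, dist x p ≤ s / 4 → β x = 1) ∧ (∀ x, s / 2 ≤ dist x p → β x = 0) ∧
      ∀ x, ‖fderiv ℝ β x‖ ≤ B / s := by
  let θ : ContDiffBump (0 : Fin n → ℂ) := ⟨1 / 4, 1 / 2, by norm_num, by norm_num⟩
  have hθ : ContDiff ℝ (⊤ : ℕ∞) θ := θ.contDiff
  have hcs : HasCompactSupport (fderiv ℝ θ) := θ.hasCompactSupport.fderiv ℝ
  obtain ⟨B, hB⟩ := (hθ.continuous_fderiv (by simp)).bounded_above_of_compact_support hcs
  refine ⟨B, (norm_nonneg _).trans (hB 0), fun p s hs => ?_⟩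
  have hsc : ∀ x, ‖s⁻¹ • (x - p)‖ = dist x p / s := fun x => by
    rw [norm_smul, norm_inv, Real.norm_of_nonneg hs.le, dist_eq_norm, div_eq_inv_mul]
  refine ⟨fun x => θ (s⁻¹ • (x - p)), hθ.comp (by fun_prop), fun x => θ.nonneg, fun x => θ.le_one,
    fun x hx => θ.one_of_mem_closedBall ?_, fun x hx => θ.zero_of_le_dist ?_, fun x => ?_⟩
  · rw [mem_closedBall_zero_iff, hsc, div_le_iff₀ hs]
    change dist x p ≤ 1 / 4 * s
    linarith
  · rw [dist_zero_right, hsc, le_div_iff₀ hs]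
    change 1 / 2 * s ≤ dist x p
    linarith
  · have h1 : HasFDerivAt (fun x : Fin n → ℂ => s⁻¹ • (x - p))
        (s⁻¹ • ContinuousLinearMap.id ℝ (Fin n → ℂ)) x :=
      ((hasFDerivAt_id x).sub_const p).const_smul s⁻¹
    have h2 := ((hθ.differentiable (by simp)) (s⁻¹ • (x - p))).hasFDerivAt.comp x h1
    have h3 : fderiv ℝ (fun x => θ (s⁻¹ • (x - p))) x =
        s⁻¹ • fderiv ℝ θ (s⁻¹ • (x - p)) := by
      rw [show (fun x => θ (s⁻¹ • (x - p))) = θ ∘ fun x => s⁻¹ • (x - p) from rfl, h2.fderiv]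
      ext v; simp
    rw [h3, norm_smul, norm_inv, Real.norm_of_nonneg hs.le, div_eq_inv_mul]
    gcongr
    exact hB _

/-- The squared distance of `ℓ` to `c`. -/
def sqDist {n : ℕ} (ℓ : (Fin n → ℂ) →L[ℂ] ℂ) (c : ℂ) (x : Fin n → ℂ) : ℝ := ‖ℓ x - c‖ ^ 2

lemma hasFDerivAt_sqDist {n : ℕ} (ℓ : (Fin n → ℂ) →L[ℂ] ℂ) (c : ℂ) (x : Fin n → ℂ) :
    HasFDerivAt (sqDist ℓ c) (fderiv ℝ (sqDist ℓ c) x) x ∧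
      ∀ w, fderiv ℝ (sqDist ℓ c) x w = 2 * (starRingEnd ℂ (ℓ x - c) * ℓ w).re := by
  have h1 : HasFDerivAt (fun x => ℓ x - c) (ℓ.restrictScalars ℝ) x :=
    (ℓ.restrictScalars ℝ).hasFDerivAt.sub_const c
  have h2 := h1.norm_sq
  have h3 : fderiv ℝ (sqDist ℓ c) x = _ := h2.fderiv
  refine ⟨h3 ▸ h2, fun w => ?_⟩
  rw [h3]
  simp [Complex.inner, mul_comm]
  ring

lemma contDiff_sqDist {n : ℕ} (ℓ : (Fin n → ℂ) →L[ℂ] ℂ) (c : ℂ) :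
    ContDiff ℝ (⊤ : ℕ∞) (sqDist ℓ c) :=
  ((ℓ.restrictScalars ℝ).contDiff.sub contDiff_const).norm_sq ℝ

/-- The real part of a sum of squares. -/
def reSq {d : ℕ} (ζ : Fin d → ℂ) : ℝ := (∑ k, ζ k * ζ k).re

lemma contDiff_reSq {d : ℕ} : ContDiff ℝ (⊤ : ℕ∞) (reSq (d := d)) := by
  refine Complex.reCLM.contDiff.comp (ContDiff.sum fun k _ => ?_)
  have : ContDiff ℝ (⊤ : ℕ∞) fun ζ : Fin d → ℂ => ζ k := contDiff_apply ℝ ℂ k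
  exact this.mul this

lemma fderiv_reSq {d : ℕ} (ζ w : Fin d → ℂ) :
    fderiv ℝ reSq ζ w = 2 * (∑ k, ζ k * w k).re := by
  have h1 : ∀ k, HasFDerivAt (fun ζ : Fin d → ℂ => ζ k * ζ k)
      (ζ k • ContinuousLinearMap.proj (R := ℝ) (φ := fun _ : Fin d => ℂ) k +
        ζ k • ContinuousLinearMap.proj (R := ℝ) (φ := fun _ : Fin d => ℂ) k) ζ := fun k =>
    (hasFDerivAt_apply (𝕜 := ℝ) k ζ).mul (hasFDerivAt_apply (𝕜 := ℝ) k ζ)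
  have h2 := Complex.reCLM.hasFDerivAt.comp ζ (HasFDerivAt.fun_sum fun k (_ : k ∈ Finset.univ) => h1 k)
  have h3 : fderiv ℝ reSq ζ = _ := h2.fderiv
  rw [h3]
  simp [← two_mul, ← Finset.mul_sum]

/-- A Morse chart of `ℓ` on `X` at `p`, valid on the ball of radius `3 * δ`, with a cutoff. -/
structure MorseModel {n : ℕ} (X : Set (Fin n → ℂ)) (r d : ℕ) (ℓ : (Fin n → ℂ) →L[ℂ] ℂ) (c : ℂ)
    (p : Fin n → ℂ) (δ : ℝ) where
  π : (Fin n → ℂ) →L[ℂ] (Fin d → ℂ)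
  C : LCIChart X r d p
  β : (Fin n → ℂ) → ℝ
  proj_eq : ∀ y, (C.e y).2 = π (y - p)
  subset_source : Metric.closedBall p (3 * δ) ⊆ C.e.source
  contDiff : ContDiff ℝ (⊤ : ℕ∞) β
  eq_one : ∀ x, dist x p ≤ δ / 4 → β x = 1
  eq_zero : ∀ x, δ / 2 ≤ dist x p → β x = 0
  half_lt : ∀ x ∈ X, dist x p ≤ 3 * δ → sqDist ℓ c p / 2 < sqDist ℓ c x
  half_lt' : ∀ x ∈ X, dist x p ≤ 3 * δ → sqDist ℓ c p / 2 <
    sqDist ℓ c x + β x * (sqDist ℓ c p + reSq (π (x - p)) - sqDist ℓ c x)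
  base_le : ∀ x ∈ X, dist x p ≤ 3 * δ → fderiv ℝ (sqDist ℓ c) x
    (fderiv ℂ C.e.symm (C.e x) (0, fun k => -starRingEnd ℂ (π (x - p) k))) ≤
      -∑ k, ‖π (x - p) k‖ ^ 2
  le : ∀ x ∈ X, dist x p ≤ 3 * δ → fderiv ℝ (fun x => sqDist ℓ c x +
      β x * (sqDist ℓ c p + reSq (π (x - p)) - sqDist ℓ c x)) x
    (fderiv ℂ C.e.symm (C.e x) (0, fun k => -starRingEnd ℂ (π (x - p) k))) ≤
      -∑ k, ‖π (x - p) k‖ ^ 2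

lemma fderiv_cutoff {n d : ℕ} (ℓ : (Fin n → ℂ) →L[ℂ] ℂ) (c : ℂ) (p : Fin n → ℂ)
    (π : (Fin n → ℂ) →L[ℂ] (Fin d → ℂ)) {β : (Fin n → ℂ) → ℝ} (hβ : ContDiff ℝ (⊤ : ℕ∞) β)
    (x w : Fin n → ℂ) :
    fderiv ℝ (fun x => sqDist ℓ c x +
      β x * (sqDist ℓ c p + reSq (π (x - p)) - sqDist ℓ c x)) x w =
    (1 - β x) * fderiv ℝ (sqDist ℓ c) x w + β x * (2 * (∑ k, π (x - p) k * π w k).re) +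
      fderiv ℝ β x w * (sqDist ℓ c p + reSq (π (x - p)) - sqDist ℓ c x) := by
  have h0 := (hasFDerivAt_sqDist ℓ c x).1
  have h1 : HasFDerivAt β (fderiv ℝ β x) x := (hβ.differentiable (by simp) x).hasFDerivAt
  have h2 : HasFDerivAt (fun x => π (x - p)) (π.restrictScalars ℝ) x :=
    (π.restrictScalars ℝ).hasFDerivAt.comp x ((hasFDerivAt_id x).sub_const p)
  have h3 : HasFDerivAt (fun x => reSq (π (x - p)))
      ((fderiv ℝ reSq (π (x - p))).comp (π.restrictScalars ℝ)) x :=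
    HasFDerivAt.comp (g := reSq) (f := fun x => π (x - p)) x
      ((contDiff_reSq.differentiable (by simp)) (π (x - p))).hasFDerivAt h2
  have h4 := h0.add (h1.mul ((h3.const_add (sqDist ℓ c p)).sub h0))
  have h5 : fderiv ℝ (fun x => sqDist ℓ c x +
      β x * (sqDist ℓ c p + reSq (π (x - p)) - sqDist ℓ c x)) x = _ := h4.fderiv
  rw [h5]
  have h6 := fderiv_reSq (π (x - p)) (π w)
  simp only [add_apply, smul_apply, smul_eq_mul, sub_apply, ContinuousLinearMap.comp_apply,
    ContinuousLinearMap.coe_restrictScalars', h6, Pi.sub_apply]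
  ring

lemma IsGoodPencil.exists_morseModel {n r d : ℕ} {X : Set (Fin n → ℂ)} {ℓ : (Fin n → ℂ) →L[ℂ] ℂ}
    {c : ℂ} (hg : IsGoodPencil X ℓ c) (h : IsLCI X r) (hrd : r + d = n) {p : Fin n → ℂ}
    (hp : p ∈ critSet X ℓ) :
    ∃ δ₀ > 0, ∀ δ, 0 < δ → δ ≤ δ₀ → Nonempty (MorseModel X r d ℓ c p δ) := by
  obtain ⟨L, hL, hL0, hnd⟩ := hg.nondegenerate p hp
  obtain ⟨π, C, M, hM, hC, h1, h2⟩ :=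
    h.exists_morse_chart hrd ℓ hp.1 (hg.noncritical p hp) hL hL0 hnd
  obtain ⟨B, hB, hbump⟩ := exists_bump n
  set ε : ℝ := 1 / (2 + 3 * B * M * ‖π‖) with hε
  have hden : 0 < 2 + 3 * B * M * ‖π‖ := by positivity
  have hε0 : 0 < ε := by positivity
  have hε1 : ε * (2 + 3 * B * M * ‖π‖) = 1 := by rw [hε]; field_simp
  have hb : 0 < sqDist ℓ c p := by
    have := sub_ne_zero.2 (hg.noncritical p hp)
    unfold sqDist; positivity
  have h3 : ∀ᶠ x in 𝓝 p, sqDist ℓ c p / 2 < sqDist ℓ c x :=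
    (contDiff_sqDist ℓ c).continuous.continuousAt.eventually_const_lt (by linarith)
  have h4 : ∀ᶠ x in 𝓝 p, sqDist ℓ c p / 2 < sqDist ℓ c p + reSq (π (x - p)) := by
    have hc : Continuous fun x => sqDist ℓ c p + reSq (π (x - p)) :=
      continuous_const.add (contDiff_reSq.continuous.comp (by fun_prop))
    refine hc.continuousAt.eventually_const_lt ?_
    have : reSq (π (p - p)) = 0 := by simp [reSq]
    linarith
  obtain ⟨s, hs, hall⟩ := Metric.nhds_basis_closedBall.eventually_iff.1
    (((h1.and (h2 ε hε0)).and h3).and h4)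
  refine ⟨s / 3, by positivity, fun δ hδ hδs => ?_⟩
  obtain ⟨β, hβ, hβ0, hβ1, hβone, hβzero, hβd⟩ := hbump p δ hδ
  have hin : ∀ {x}, dist x p ≤ 3 * δ → x ∈ Metric.closedBall p s := fun hx => by
    rw [Metric.mem_closedBall]; linarith
  have hmain : ∀ x ∈ X, dist x p ≤ 3 * δ → ∃ w,
      w = fderiv ℂ C.e.symm (C.e x) (0, fun k => -starRingEnd ℂ (π (x - p) k)) ∧
      fderiv ℝ (sqDist ℓ c) x w ≤
        -(2 - 2 * ε) * ∑ k, ‖π (x - p) k‖ ^ 2 ∧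
      2 * (∑ k, π (x - p) k * π w k).re = -(2 * ∑ k, ‖π (x - p) k‖ ^ 2) ∧
      |fderiv ℝ β x w * (sqDist ℓ c p + reSq (π (x - p)) - sqDist ℓ c x)| ≤
        ε * (3 * B * M * ‖π‖) * ∑ k, ‖π (x - p) k‖ ^ 2 := by
    intro x hx hxp
    obtain ⟨⟨⟨⟨hxs, -, hxM⟩, hxe⟩, -⟩, -⟩ := hall (hin hxp)
    obtain ⟨he1, he2⟩ := hxe hx
    set w := fderiv ℂ C.e.symm (C.e x) (0, fun k => -starRingEnd ℂ (π (x - p) k)) with hw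
    have hS := norm_sq_le_sum (π (x - p))
    set S := ∑ k, ‖π (x - p) k‖ ^ 2 with hSdef
    have hζ : ‖π (x - p)‖ ≤ ‖π‖ * (3 * δ) :=
      (π.le_opNorm _).trans (by rw [← dist_eq_norm]; gcongr)
    refine ⟨w, rfl, ?_, ?_, ?_⟩
    · have h5 := he1 fun k => -starRingEnd ℂ (π (x - p) k)
      rw [sum_mul_neg_conj, norm_neg_conj, sub_neg_eq_add] at h5
      have h6 := (Complex.re_le_norm _).trans h5
      rw [Complex.add_re, Complex.ofReal_re] at h6
      rw [(hasFDerivAt_sqDist ℓ c x).2]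
      have h7 : ε * ‖π (x - p)‖ ^ 2 ≤ ε * S := by gcongr
      have h8 : (starRingEnd ℂ (ℓ x - c) * ℓ w).re + S ≤ ε * ‖π (x - p)‖ ^ 2 := by
        rw [sq, ← mul_assoc]; exact h6
      linarith
    · have h5 : π w = fun k => -starRingEnd ℂ (π (x - p) k) :=
        C.proj_section hC (C.e.map_source hxs) _
      rw [h5, sum_mul_neg_conj, Complex.neg_re, Complex.ofReal_re]
      ring
    · have h5 : |fderiv ℝ β x w| ≤ B / δ * (M * ‖π (x - p)‖) := by
        refine ((fderiv ℝ β x).le_opNorm w).trans ?_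
        have h6 := hxM fun k => -starRingEnd ℂ (π (x - p) k)
        rw [norm_neg_conj] at h6
        exact mul_le_mul (hβd x) h6 (norm_nonneg _) (by positivity)
      have h6 : |sqDist ℓ c p + reSq (π (x - p)) - sqDist ℓ c x| ≤ ε * ‖π (x - p)‖ ^ 2 := by
        rw [abs_sub_comm]
        refine le_trans (le_of_eq ?_) he2
        unfold sqDist reSq
        ring_nf
      rw [abs_mul]
      calc _ ≤ (B / δ * (M * ‖π (x - p)‖)) * (ε * ‖π (x - p)‖ ^ 2) :=
            mul_le_mul h5 h6 (abs_nonneg _) (by positivity)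
        _ ≤ (B / δ * (M * (‖π‖ * (3 * δ)))) * (ε * S) := by gcongr
        _ = _ := by field_simp
  refine ⟨⟨π, C, β, hC, fun x hx => (hall (hin hx)).1.1.1.1, hβ, hβone, hβzero,
    fun x _ hx => (hall (hin hx)).1.2, fun x _ hx => ?_, fun x hx hxp => ?_,
    fun x hx hxp => ?_⟩⟩
  · have h5 := (hall (hin hx)).1.2
    have h6 := (hall (hin hx)).2
    nlinarith [mul_nonneg (hβ0 x) (sub_nonneg.2 h6.le),
      mul_nonneg (sub_nonneg.2 (hβ1 x)) (sub_nonneg.2 h5.le), hβ0 x, hβ1 x]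
  · obtain ⟨w, hw, h5, -, -⟩ := hmain x hx hxp
    rw [← hw]
    have hS : 0 ≤ ∑ k, ‖π (x - p) k‖ ^ 2 := by positivity
    have : ε * 2 ≤ 1 := by
      rw [← hε1]; gcongr; linarith [show 0 ≤ 3 * B * M * ‖π‖ by positivity]
    nlinarith
  · obtain ⟨w, hw, h5, h6, h7⟩ := hmain x hx hxp
    rw [← hw, fderiv_cutoff ℓ c p π hβ, h6]
    have hS : 0 ≤ ∑ k, ‖π (x - p) k‖ ^ 2 := by positivity
    set S := ∑ k, ‖π (x - p) k‖ ^ 2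
    have h8 := (le_abs_self _).trans h7
    have h9 : (1 - β x) * fderiv ℝ (sqDist ℓ c) x w ≤ (1 - β x) * (-(2 - 2 * ε) * S) :=
      mul_le_mul_of_nonneg_left h5 (sub_nonneg.2 (hβ1 x))
    have h10 : (ε * (2 + 3 * B * M * ‖π‖)) * S = S := by rw [hε1, one_mul]
    nlinarith [mul_nonneg (mul_nonneg hε0.le hS) (hβ0 x)]

lemma IsGoodPencil.exists_models {n r d : ℕ} {X : Set (Fin n → ℂ)} {ℓ : (Fin n → ℂ) →L[ℂ] ℂ}
    {c : ℂ} (hg : IsGoodPencil X ℓ c) (h : IsLCI X r) (hrd : r + d = n) :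
    ∃ δ > 0, (∀ p : critSet X ℓ, Nonempty (MorseModel X r d ℓ c p δ)) ∧
      ∀ p q : critSet X ℓ, p ≠ q → 6 * δ < dist (p : Fin n → ℂ) q := by
  have hfin : Finite (critSet X ℓ) := (hg.finite_critSet h hrd).to_subtype
  choose δ₀ hδ₀ hmodel using fun p : critSet X ℓ => hg.exists_morseModel h hrd p.2
  have h1 : ∀ᶠ δ in 𝓝[>] (0 : ℝ), ∀ p, δ ≤ δ₀ p := by
    rw [eventually_all]
    exact fun p => eventually_nhdsWithin_of_eventually_nhds (eventually_le_nhds (hδ₀ p))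
  have h2 : ∀ᶠ δ in 𝓝[>] (0 : ℝ), ∀ p q : critSet X ℓ, p ≠ q →
      6 * δ < dist (p : Fin n → ℂ) q := by
    rw [eventually_all]
    intro p
    rw [eventually_all]
    intro q
    by_cases hpq : p = q
    · exact Eventually.of_forall fun _ hne => absurd hpq hne
    · have h3 : (0 : ℝ) < dist (p : Fin n → ℂ) q / 6 := by
        have := dist_pos.2 (fun h => hpq (Subtype.ext h))
        positivity
      filter_upwards [eventually_nhdsWithin_of_eventually_nhds (eventually_lt_nhds h3)] with δ hδ _
      linarith
  obtain ⟨δ, ⟨h3, h4⟩, hδ⟩ := ((h1.and h2).and self_mem_nhdsWithin).exists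
  exact ⟨δ, hδ, fun p => hmodel p δ hδ (h3 p), h4⟩

namespace MorseModel

variable {n r d : ℕ} {X : Set (Fin n → ℂ)} {ℓ : (Fin n → ℂ) →L[ℂ] ℂ} {c : ℂ} {p : Fin n → ℂ}
  {δ : ℝ}

/-- The downward gradient of the Morse chart. -/
def field (m : MorseModel X r d ℓ c p δ) (x : Fin n → ℂ) : Fin n → ℂ :=
  fderiv ℂ m.C.e.symm (m.C.e x) (0, fun k => -starRingEnd ℂ (m.π (x - p) k))

/-- The squared norm in the Morse chart. -/
def sq (m : MorseModel X r d ℓ c p δ) (x : Fin n → ℂ) : ℝ := ∑ k, ‖m.π (x - p) k‖ ^ 2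

/-- The local correction to `sqDist`. -/
def corr (m : MorseModel X r d ℓ c p δ) (x : Fin n → ℂ) : ℝ :=
  m.β x * (sqDist ℓ c p + reSq (m.π (x - p)) - sqDist ℓ c x)

lemma contDiffOn_field (m : MorseModel X r d ℓ c p δ) :
    ContDiffOn ℝ (⊤ : ℕ∞) m.field m.C.e.source := by
  refine m.C.contDiffOn_section (w := fun x => (0, fun k => -starRingEnd ℂ (m.π (x - p) k))) ?_
  refine contDiff_const.prodMk (contDiff_pi.2 fun k => ?_)
  refine (Complex.conjCLE.contDiff.comp (g := fun z => starRingEnd ℂ z) ?_).neg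
  exact (contDiff_apply ℝ ℂ k).comp
    ((m.π.restrictScalars ℝ).contDiff.comp (contDiff_id.sub contDiff_const))

lemma contDiff_smul_field (m : MorseModel X r d ℓ c p δ) (hδ : 0 < δ) {η : (Fin n → ℂ) → ℝ}
    (hη : ContDiff ℝ (⊤ : ℕ∞) η) (h0 : ∀ x, 2 * δ ≤ dist x p → η x = 0) :
    ContDiff ℝ (⊤ : ℕ∞) fun x => η x • m.field x := by
  rw [contDiff_iff_contDiffAt]
  intro x
  rcases lt_or_ge (dist x p) (3 * δ) with hx | hx
  · have hs : x ∈ m.C.e.source := m.subset_source (Metric.mem_closedBall.2 hx.le)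
    exact hη.contDiffAt.smul (m.contDiffOn_field.contDiffAt (m.C.e.open_source.mem_nhds hs))
  · refine (contDiffAt_const (c := (0 : Fin n → ℂ))).congr_of_eventuallyEq ?_
    have : ∀ᶠ y in 𝓝 x, 2 * δ < dist y p :=
      (continuous_id.dist continuous_const).continuousAt.eventually_const_lt
        (show 2 * δ < dist (id x) p by rw [id]; linarith)
    filter_upwards [this] with y hy
    rw [h0 y hy.le, zero_smul]

lemma bounded_smul_field (m : MorseModel X r d ℓ c p δ) (hδ : 0 < δ) {η : (Fin n → ℂ) → ℝ}
    (hη : ContDiff ℝ (⊤ : ℕ∞) η) (h0 : ∀ x, 2 * δ ≤ dist x p → η x = 0) :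
    ∃ B, ∀ x, ‖η x • m.field x‖ ≤ B := by
  refine (m.contDiff_smul_field hδ hη h0).continuous.bounded_above_of_compact_support ?_
  refine HasCompactSupport.of_support_subset_isCompact (isCompact_closedBall p (2 * δ)) ?_
  intro x hx
  rw [Metric.mem_closedBall]
  by_contra! hlt
  exact hx (by simp only [h0 x hlt.le, zero_smul])

lemma field_mem (m : MorseModel X r d ℓ c p δ) {x : Fin n → ℂ} (hx : x ∈ X)
    (hxp : dist x p ≤ 3 * δ) : m.field x ∈ zTangent X x :=
  m.C.section_mem (m.subset_source hxp) hx _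

lemma contDiff_corr (m : MorseModel X r d ℓ c p δ) : ContDiff ℝ (⊤ : ℕ∞) m.corr := by
  refine m.contDiff.mul ((contDiff_const.add ?_).sub (contDiff_sqDist ℓ c))
  exact contDiff_reSq.comp ((m.π.restrictScalars ℝ).contDiff.comp (contDiff_id.sub contDiff_const))

lemma corr_eq_zero (m : MorseModel X r d ℓ c p δ) {x : Fin n → ℂ} (hx : δ / 2 ≤ dist x p) :
    m.corr x = 0 := by
  rw [corr, m.eq_zero x hx, zero_mul]

end MorseModel

section

variable {n r d : ℕ} {X : Set (Fin n → ℂ)} {ℓ : (Fin n → ℂ) →L[ℂ] ℂ} {c : ℂ} {δ : ℝ}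
  [Fintype (critSet X ℓ)]

/-- The squared distance, corrected to be quadratic in the Morse charts. -/
def morseFn (m : ∀ p : critSet X ℓ, MorseModel X r d ℓ c p δ) (x : Fin n → ℂ) : ℝ :=
  sqDist ℓ c x + ∑ p, (m p).corr x

lemma contDiff_morseFn (m : ∀ p : critSet X ℓ, MorseModel X r d ℓ c p δ) :
    ContDiff ℝ (⊤ : ℕ∞) (morseFn m) :=
  (contDiff_sqDist ℓ c).add (ContDiff.sum fun p _ => (m p).contDiff_corr)

lemma morseFn_eq (m : ∀ p : critSet X ℓ, MorseModel X r d ℓ c p δ) (hδ : 0 < δ)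
    (hsep : ∀ p q : critSet X ℓ, p ≠ q → 6 * δ < dist (p : Fin n → ℂ) q) {x : Fin n → ℂ}
    (p : critSet X ℓ) (hx : dist x p ≤ 3 * δ) : morseFn m x = sqDist ℓ c x + (m p).corr x := by
  rw [morseFn, Finset.sum_eq_single p (fun q _ hq => ?_) (fun h => absurd (Finset.mem_univ p) h)]
  refine (m q).corr_eq_zero ?_
  have := hsep q p hq
  have := dist_triangle_left (q : Fin n → ℂ) p x
  linarith

lemma morseFn_eq_sqDist (m : ∀ p : critSet X ℓ, MorseModel X r d ℓ c p δ) {x : Fin n → ℂ}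
    (hx : ∀ p : critSet X ℓ, δ / 2 ≤ dist x p) : morseFn m x = sqDist ℓ c x := by
  rw [morseFn, Finset.sum_eq_zero fun p _ => (m p).corr_eq_zero (hx p), add_zero]

theorem exists_gradient_field (h : IsLCI X r) (hrd : r + d = n) (hg : IsGoodPencil X ℓ c)
    (hδ : 0 < δ) (m : ∀ p : critSet X ℓ, MorseModel X r d ℓ c p δ)
    (hsep : ∀ p q : critSet X ℓ, p ≠ q → 6 * δ < dist (p : Fin n → ℂ) q) :
    ∃ W : (Fin n → ℂ) → (Fin n → ℂ), ContDiff ℝ (⊤ : ℕ∞) W ∧ (∃ B, ∀ x, ‖W x‖ ≤ B) ∧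
      (∀ x ∈ X, W x ∈ zTangent X x) ∧ (∀ x ∈ X, ℓ x = c → W x = 0) ∧
      (∀ (p : critSet X ℓ) (x : Fin n → ℂ), dist x p ≤ δ → W x = (m p).field x) ∧
      (∀ (p : critSet X ℓ), ∀ x ∈ X, dist x p ≤ 2 * δ → fderiv ℝ (morseFn m) x (W x) ≤
        -min ((m p).sq x) (2 * sqDist ℓ c x / (1 + sqDist ℓ c x))) ∧
      ∀ x ∈ X, (∀ p : critSet X ℓ, 2 * δ ≤ dist x p) → fderiv ℝ (morseFn m) x (W x) ≤
        -(2 * sqDist ℓ c x / (1 + sqDist ℓ c x)) := by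
  obtain ⟨R, T, hRT⟩ := hg.atInfinity
  obtain ⟨v, hv, ⟨Bv, hBv⟩, hvX⟩ := h.exists_unit_field hrd ℓ
    (N := ⋃ p : critSet X ℓ, Metric.ball (p : Fin n → ℂ) δ)
    (isOpen_iUnion fun _ => Metric.isOpen_ball)
    (fun x hx hx0 => Set.mem_iUnion.2 ⟨⟨x, hx, hx0⟩, Metric.mem_ball_self hδ⟩) hRT
  obtain ⟨_, -, hbump⟩ := exists_bump n
  choose η hη hη0 hη1 hηone hηzero _ using fun p : critSet X ℓ => hbump p (4 * δ) (by positivity)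
  have hηone' : ∀ (p : critSet X ℓ) (x : Fin n → ℂ), dist x p ≤ δ → η p x = 1 := fun p x hx =>
    hηone p x (by linarith)
  have hηzero' : ∀ (p : critSet X ℓ) (x : Fin n → ℂ), 2 * δ ≤ dist x p → η p x = 0 := fun p x hx =>
    hηzero p x (by linarith)
  have hfar : ∀ (p : critSet X ℓ) (x : Fin n → ℂ), dist x p ≤ 2 * δ → ∀ q, q ≠ p → 2 * δ ≤ dist x q := by
    intro p x hx q hq
    have := hsep q p hq
    have := dist_triangle_left (q : Fin n → ℂ) p x
    linarith
  let s : (Fin n → ℂ) → ℂ := fun x => -((1 + sqDist ℓ c x)⁻¹ • (ℓ x - c))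
  have hpos : ∀ x, 0 ≤ sqDist ℓ c x := fun x => sq_nonneg _
  have hsc : ContDiff ℝ (⊤ : ℕ∞) s := by
    refine (ContDiff.smul (ContDiff.inv (contDiff_const.add (contDiff_sqDist ℓ c)) fun x => ?_)
      ((ℓ.restrictScalars ℝ).contDiff.sub contDiff_const)).neg
    have := hpos x
    positivity
  have hs1 : ∀ x, ‖s x‖ ≤ 1 := by
    intro x
    have := hpos x
    rw [norm_neg, norm_smul, norm_inv, Real.norm_of_nonneg (by positivity), inv_mul_eq_div,
      div_le_one (by positivity)]
    unfold sqDist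
    nlinarith [sq_nonneg (‖ℓ x - c‖ - 1)]
  have hsd : ∀ x w, ℓ w = 1 → fderiv ℝ (sqDist ℓ c) x (s x • w) =
      -(2 * sqDist ℓ c x / (1 + sqDist ℓ c x)) := by
    intro x w hw
    rw [(hasFDerivAt_sqDist ℓ c x).2, map_smul, hw, smul_eq_mul, mul_one]
    have h1 : starRingEnd ℂ (ℓ x - c) * s x =
        ((-(sqDist ℓ c x / (1 + sqDist ℓ c x)) : ℝ) : ℂ) := by
      have h2 : starRingEnd ℂ (ℓ x - c) * (ℓ x - c) = (sqDist ℓ c x : ℂ) := by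
        rw [mul_comm, Complex.mul_conj, Complex.normSq_eq_norm_sq]
        rfl
      simp only [s]
      rw [mul_neg, mul_smul_comm, h2, Complex.real_smul, div_eq_inv_mul]
      push_cast
      rfl
    rw [h1, Complex.ofReal_re]
    ring
  let W : (Fin n → ℂ) → (Fin n → ℂ) := fun x =>
    ∑ p, η p x • (m p).field x + (1 - ∑ p, η p x) • s x • v x
  have hnear : ∀ (p : critSet X ℓ) (x : Fin n → ℂ), dist x p ≤ 2 * δ →
      W x = η p x • (m p).field x + (1 - η p x) • s x • v x := by
    intro p x hx
    simp only [W]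
    rw [Finset.sum_eq_single p, Finset.sum_eq_single p]
    · exact fun q _ hq => hηzero' q x (hfar p x hx q hq)
    · exact fun h => absurd (Finset.mem_univ p) h
    · exact fun q _ hq => by rw [hηzero' q x (hfar p x hx q hq), zero_smul]
    · exact fun h => absurd (Finset.mem_univ p) h
  have haway : ∀ x : Fin n → ℂ, (∀ p : critSet X ℓ, 2 * δ ≤ dist x p) → W x = s x • v x := by
    intro x hx
    simp only [W]
    rw [Finset.sum_eq_zero fun p _ => by rw [hηzero' p x (hx p), zero_smul],
      Finset.sum_eq_zero fun p _ => hηzero' p x (hx p), zero_add, sub_zero, one_smul]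
  have hfd : ∀ x : Fin n → ℂ, (∀ p : critSet X ℓ, δ ≤ dist x p) →
      fderiv ℝ (morseFn m) x = fderiv ℝ (sqDist ℓ c) x := by
    intro x hx
    refine Filter.EventuallyEq.fderiv_eq ?_
    have h1 : ∀ᶠ y : Fin n → ℂ in 𝓝 x, ∀ p : critSet X ℓ, δ / 2 < dist y p := by
      rw [eventually_all]
      intro p
      refine (continuous_id.dist continuous_const).continuousAt.eventually_const_lt ?_
      have := hx p
      change δ / 2 < dist x p
      linarith
    filter_upwards [h1] with y hy using morseFn_eq_sqDist m fun p => (hy p).le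
  have hNout : ∀ x ∈ X, (∀ p : critSet X ℓ, δ ≤ dist x p) → ℓ (v x) = 1 := by
    intro x hx hxp
    refine (hvX x hx).2 fun hmem => ?_
    obtain ⟨p, hp⟩ := Set.mem_iUnion.1 hmem
    exact absurd hp (not_lt.2 (hxp p))
  refine ⟨W, ?_, ?_, ?_, ?_, ?_, ?_, ?_⟩
  · refine (ContDiff.sum fun p _ => (m p).contDiff_smul_field hδ (hη p) (hηzero' p)).add ?_
    exact (contDiff_const.sub (ContDiff.sum fun p _ => hη p)).smul (hsc.smul hv)
  · choose B hB using fun p => (m p).bounded_smul_field hδ (hη p) (hηzero' p)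
    refine ⟨∑ p, B p + Bv, fun x => (norm_add_le _ _).trans (add_le_add ?_ ?_)⟩
    · exact (norm_sum_le _ _).trans (Finset.sum_le_sum fun p _ => hB p x)
    · have h1 : |1 - ∑ p, η p x| ≤ 1 := by
        by_cases hx : ∃ p : critSet X ℓ, dist x p ≤ 2 * δ
        · obtain ⟨p, hp⟩ := hx
          rw [Finset.sum_eq_single p (fun q _ hq => hηzero' q x (hfar p x hp q hq))
            (fun h => absurd (Finset.mem_univ p) h), abs_le]
          constructor <;> linarith [hη0 p x, hη1 p x]
        · push Not at hx
          rw [Finset.sum_eq_zero fun p _ => hηzero' p x (hx p).le]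
          simp
      rw [norm_smul, norm_smul, Real.norm_eq_abs]
      calc _ ≤ 1 * (1 * Bv) := by gcongr; exacts [hs1 x, hBv x]
        _ = Bv := by ring
  · intro x hx
    refine add_mem (Submodule.sum_mem _ fun p _ => ?_) ?_
    · rcases le_total (dist x p) (3 * δ) with hxp | hxp
      · rw [← Complex.coe_smul]
        exact Submodule.smul_mem _ _ ((m p).field_mem hx hxp)
      · rw [hηzero' p x (by linarith), zero_smul]
        exact zero_mem _
    · rw [← Complex.coe_smul]
      exact Submodule.smul_mem _ _ (Submodule.smul_mem _ _ (hvX x hx).1)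
  · intro x hx hxc
    have hz : sqDist ℓ c x = 0 := by simp [sqDist, hxc]
    rw [haway x fun p => ?_]
    · simp [s, hxc]
    · by_contra! hlt
      have h1 := (m p).half_lt x hx (by linarith)
      have h2 := hpos p
      linarith
  · intro p x hx
    rw [hnear p x (by linarith), hηone' p x hx, one_smul, sub_self, zero_smul, add_zero]
  · intro p x hx hxp
    rcases lt_or_ge (dist x p) δ with hlt | hge
    · refine le_trans ?_ (neg_le_neg (min_le_left _ _))
      have h1 : fderiv ℝ (morseFn m) x = fderiv ℝ (fun x => sqDist ℓ c x + (m p).corr x) x := by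
        refine Filter.EventuallyEq.fderiv_eq ?_
        filter_upwards [Metric.ball_mem_nhds x (sub_pos.2 hlt)] with y hy
        refine morseFn_eq m hδ hsep p ?_
        have := dist_triangle y x (p : Fin n → ℂ)
        rw [Metric.mem_ball] at hy
        linarith
      rw [h1, hnear p x hxp, hηone' p x hlt.le, one_smul, sub_self, zero_smul, add_zero]
      exact (m p).le x hx (by linarith)
    · have hall : ∀ q : critSet X ℓ, δ ≤ dist x q := by
        intro q
        rcases eq_or_ne q p with rfl | hq
        · exact hge
        · linarith [hfar p x hxp q hq]
      rw [hfd x hall, hnear p x hxp, map_add, map_smul, map_smul, hsd x _ (hNout x hx hall),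
        smul_eq_mul, smul_eq_mul]
      have h1 : fderiv ℝ (sqDist ℓ c) x ((m p).field x) ≤ -(m p).sq x :=
        (m p).base_le x hx (by linarith)
      have h2 := min_le_left ((m p).sq x) (2 * sqDist ℓ c x / (1 + sqDist ℓ c x))
      have h3 := min_le_right ((m p).sq x) (2 * sqDist ℓ c x / (1 + sqDist ℓ c x))
      have h4 := mul_le_mul_of_nonneg_left (h1.trans (neg_le_neg h2)) (hη0 p x)
      have h5 := mul_le_mul_of_nonneg_left (neg_le_neg h3) (sub_nonneg.2 (hη1 p x))
      linarith
  · intro x hx hxp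
    have hall : ∀ q : critSet X ℓ, δ ≤ dist x q := fun q => by linarith [hxp q]
    rw [hfd x hall, haway x hxp, hsd x _ (hNout x hx hall)]

end

/-- Complex coordinates from pairs of imaginary and real parts. -/
def toCpx {d : ℕ} (P : EuclideanSpace ℝ (Fin d) × EuclideanSpace ℝ (Fin d)) : Fin d → ℂ :=
  fun k => ⟨P.2 k, P.1 k⟩

/-- The pair of imaginary and real parts. -/
def ofCpx {d : ℕ} (ζ : Fin d → ℂ) : EuclideanSpace ℝ (Fin d) × EuclideanSpace ℝ (Fin d) :=
  (WithLp.toLp 2 fun k => (ζ k).im, WithLp.toLp 2 fun k => (ζ k).re)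

lemma ofCpx_toCpx {d : ℕ} (P : EuclideanSpace ℝ (Fin d) × EuclideanSpace ℝ (Fin d)) :
    ofCpx (toCpx P) = P := rfl

lemma toCpx_ofCpx {d : ℕ} (ζ : Fin d → ℂ) : toCpx (ofCpx ζ) = ζ := rfl

lemma continuous_toCpx {d : ℕ} : Continuous (toCpx (d := d)) := by
  refine continuous_pi fun k => ?_
  have h : ∀ P : EuclideanSpace ℝ (Fin d) × EuclideanSpace ℝ (Fin d),
      toCpx P k = (P.2 k : ℂ) + (P.1 k : ℂ) * Complex.I := fun P =>
    (Complex.mk_eq_add_mul_I _ _)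
  simp only [h]
  fun_prop

lemma continuous_ofCpx {d : ℕ} : Continuous (ofCpx (d := d)) := by
  unfold ofCpx
  fun_prop

lemma reSq_toCpx {d : ℕ} (P : EuclideanSpace ℝ (Fin d) × EuclideanSpace ℝ (Fin d)) :
    reSq (toCpx P) = ‖P.2‖ ^ 2 - ‖P.1‖ ^ 2 := by
  rw [EuclideanSpace.norm_sq_eq, EuclideanSpace.norm_sq_eq, ← Finset.sum_sub_distrib, reSq,
    Complex.re_sum]
  refine Finset.sum_congr rfl fun k _ => ?_
  simp only [toCpx, Complex.mul_re, Real.norm_eq_abs, sq_abs]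
  ring

lemma norm_ofCpx_lt {d : ℕ} {ζ : Fin d → ℂ} {r : ℝ} (hr : 0 < r) (h : ∑ k, ‖ζ k‖ ^ 2 < r ^ 2) :
    ‖ofCpx ζ‖ < r := by
  have h1 : ∀ k, ‖ζ k‖ ^ 2 = (ζ k).re ^ 2 + (ζ k).im ^ 2 := fun k => by
    rw [← Complex.normSq_eq_norm_sq, Complex.normSq_apply]; ring
  have h2 : ‖(ofCpx ζ).1‖ ^ 2 ≤ ∑ k, ‖ζ k‖ ^ 2 := by
    rw [EuclideanSpace.norm_sq_eq]
    refine Finset.sum_le_sum fun k _ => ?_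
    rw [h1, Real.norm_eq_abs, sq_abs]
    exact le_add_of_nonneg_left (sq_nonneg _)
  have h3 : ‖(ofCpx ζ).2‖ ^ 2 ≤ ∑ k, ‖ζ k‖ ^ 2 := by
    rw [EuclideanSpace.norm_sq_eq]
    refine Finset.sum_le_sum fun k _ => ?_
    rw [h1, Real.norm_eq_abs, sq_abs]
    exact le_add_of_nonneg_right (sq_nonneg _)
  rw [Prod.norm_def, max_lt_iff]
  exact ⟨lt_of_pow_lt_pow_left₀ 2 hr.le (h2.trans_lt h),
    lt_of_pow_lt_pow_left₀ 2 hr.le (h3.trans_lt h)⟩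

namespace MorseModel

variable {n r d : ℕ} {X : Set (Fin n → ℂ)} {ℓ : (Fin n → ℂ) →L[ℂ] ℂ} {c : ℂ} {p : Fin n → ℂ}
  {δ : ℝ}

/-- The parametrization of `X` near `p`. -/
def box (m : MorseModel X r d ℓ c p δ)
    (P : EuclideanSpace ℝ (Fin d) × EuclideanSpace ℝ (Fin d)) : Fin n → ℂ :=
  m.C.e.symm (0, toCpx P)

/-- The inverse of `box`. -/
def coord (m : MorseModel X r d ℓ c p δ) (x : Fin n → ℂ) :
    EuclideanSpace ℝ (Fin d) × EuclideanSpace ℝ (Fin d) := ofCpx (m.π (x - p))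

lemma continuous_coord (m : MorseModel X r d ℓ c p δ) : Continuous m.coord :=
  continuous_ofCpx.comp (by fun_prop)

lemma exists_box (m : MorseModel X r d ℓ c p δ) (hδ : 0 < δ) : ∃ ρ > 0, ∀ P,
    ‖P‖ ≤ ρ → ((0, toCpx P) : (Fin r → ℂ) × (Fin d → ℂ)) ∈ m.C.e.target ∧
      dist (m.box P) p ≤ δ / 4 := by
  have h0 : ((0, toCpx (0 : EuclideanSpace ℝ (Fin d) × EuclideanSpace ℝ (Fin d))) :
      (Fin r → ℂ) × (Fin d → ℂ)) = 0 := rfl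
  have ht : (0 : (Fin r → ℂ) × (Fin d → ℂ)) ∈ m.C.e.target := by
    rw [← m.C.map_center]; exact m.C.e.map_source m.C.mem_source
  have hp : m.C.e.symm 0 = p := by rw [← m.C.map_center]; exact m.C.e.left_inv m.C.mem_source
  have hc : Continuous fun P : EuclideanSpace ℝ (Fin d) × EuclideanSpace ℝ (Fin d) =>
      ((0, toCpx P) : (Fin r → ℂ) × (Fin d → ℂ)) := continuous_const.prodMk continuous_toCpx
  have h1 : ∀ᶠ z in 𝓝 (0 : (Fin r → ℂ) × (Fin d → ℂ)), z ∈ m.C.e.target ∧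
      dist (m.C.e.symm z) p < δ / 4 := by
    refine (m.C.e.open_target.eventually_mem ht).and ?_
    have h2 := (m.C.e.continuousAt_symm ht).tendsto
    rw [hp] at h2
    exact h2 (Metric.ball_mem_nhds p (by positivity))
  have h2 := hc.tendsto 0
  rw [h0] at h2
  obtain ⟨ρ, hρ, hall⟩ := Metric.nhds_basis_closedBall.eventually_iff.1 (h2.eventually h1)
  exact ⟨ρ, hρ, fun P hP =>
    have h3 := hall (mem_closedBall_zero_iff.2 hP)
    ⟨h3.1, h3.2.le⟩⟩

lemma e_box (m : MorseModel X r d ℓ c p δ)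
    {P : EuclideanSpace ℝ (Fin d) × EuclideanSpace ℝ (Fin d)}
    (hP : ((0, toCpx P) : (Fin r → ℂ) × (Fin d → ℂ)) ∈ m.C.e.target) :
    m.C.e (m.box P) = (0, toCpx P) :=
  m.C.e.right_inv hP

lemma proj_box (m : MorseModel X r d ℓ c p δ)
    {P : EuclideanSpace ℝ (Fin d) × EuclideanSpace ℝ (Fin d)}
    (hP : ((0, toCpx P) : (Fin r → ℂ) × (Fin d → ℂ)) ∈ m.C.e.target) :
    m.π (m.box P - p) = toCpx P := by
  rw [← m.proj_eq, m.e_box hP]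

lemma coord_box (m : MorseModel X r d ℓ c p δ)
    {P : EuclideanSpace ℝ (Fin d) × EuclideanSpace ℝ (Fin d)}
    (hP : ((0, toCpx P) : (Fin r → ℂ) × (Fin d → ℂ)) ∈ m.C.e.target) :
    m.coord (m.box P) = P := by
  rw [coord, m.proj_box hP, ofCpx_toCpx]

lemma box_mem_source (m : MorseModel X r d ℓ c p δ)
    {P : EuclideanSpace ℝ (Fin d) × EuclideanSpace ℝ (Fin d)}
    (hP : ((0, toCpx P) : (Fin r → ℂ) × (Fin d → ℂ)) ∈ m.C.e.target) :
    m.box P ∈ m.C.e.source := m.C.e.map_target hP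

lemma box_mem (m : MorseModel X r d ℓ c p δ)
    {P : EuclideanSpace ℝ (Fin d) × EuclideanSpace ℝ (Fin d)}
    (hP : ((0, toCpx P) : (Fin r → ℂ) × (Fin d → ℂ)) ∈ m.C.e.target) : m.box P ∈ X := by
  rw [m.C.mem_iff _ (m.box_mem_source hP), m.e_box hP]

lemma box_coord (m : MorseModel X r d ℓ c p δ) {x : Fin n → ℂ} (hx : x ∈ X)
    (hxs : x ∈ m.C.e.source) : m.box (m.coord x) = x := by
  rw [box, coord, toCpx_ofCpx, ← m.proj_eq, ← (m.C.mem_iff x hxs).1 hx]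
  exact m.C.e.left_inv hxs

lemma continuousOn_box (m : MorseModel X r d ℓ c p δ) {ρ : ℝ}
    (hρ : ∀ P, ‖P‖ ≤ ρ → ((0, toCpx P) : (Fin r → ℂ) × (Fin d → ℂ)) ∈ m.C.e.target) :
    ContinuousOn m.box (Metric.closedBall 0 ρ) :=
  m.C.e.continuousOn_symm.comp (continuous_const.prodMk continuous_toCpx).continuousOn
    fun P hP => hρ P (mem_closedBall_zero_iff.1 hP)

lemma exists_isOpen_box (m : MorseModel X r d ℓ c p δ) {ρ : ℝ}
    (hρ : ∀ P, ‖P‖ ≤ ρ → ((0, toCpx P) : (Fin r → ℂ) × (Fin d → ℂ)) ∈ m.C.e.target) :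
    ∃ U, IsOpen U ∧ U ∩ X = m.box '' Metric.ball 0 ρ := by
  refine ⟨m.C.e.source ∩ m.coord ⁻¹' Metric.ball 0 ρ,
    m.C.e.open_source.inter (Metric.isOpen_ball.preimage m.continuous_coord), ?_⟩
  ext x
  constructor
  · rintro ⟨⟨hxs, hxq⟩, hx⟩
    exact ⟨_, hxq, m.box_coord hx hxs⟩
  · rintro ⟨P, hP, rfl⟩
    have ht := hρ P (mem_ball_zero_iff.1 hP).le
    refine ⟨⟨m.box_mem_source ht, ?_⟩, m.box_mem ht⟩
    rwa [Set.mem_preimage, m.coord_box ht]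

lemma sq_ge (m : MorseModel X r d ℓ c p δ) {x : Fin n → ℂ} (hx : x ∈ X)
    (hxs : x ∈ m.C.e.source) {s : ℝ} (hs : 0 < s) (hout : x ∉ m.box '' Metric.ball 0 s) :
    s ^ 2 ≤ m.sq x := by
  by_contra! hlt
  refine hout ⟨m.coord x, ?_, m.box_coord hx hxs⟩
  rw [mem_ball_zero_iff]
  exact norm_ofCpx_lt hs hlt

/-- The linear flow line in the Morse chart. -/
lemma hasDerivAt_box (m : MorseModel X r d ℓ c p δ)
    (P : EuclideanSpace ℝ (Fin d) × EuclideanSpace ℝ (Fin d)) (t : ℝ)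
    (hP : ((0, toCpx (Real.exp t • P.1, Real.exp (-t) • P.2)) : (Fin r → ℂ) × (Fin d → ℂ)) ∈
      m.C.e.target) :
    HasDerivAt (fun t => m.box (Real.exp t • P.1, Real.exp (-t) • P.2))
      (m.field (m.box (Real.exp t • P.1, Real.exp (-t) • P.2))) t := by
  have h1 : HasDerivAt (fun t : ℝ => toCpx (Real.exp t • P.1, Real.exp (-t) • P.2))
      (fun k => -starRingEnd ℂ (toCpx (Real.exp t • P.1, Real.exp (-t) • P.2) k)) t := by
    rw [hasDerivAt_pi]
    intro k
    have h2 : HasDerivAt (fun t : ℝ => ((Real.exp (-t) * P.2 k : ℝ) : ℂ) +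
        ((Real.exp t * P.1 k : ℝ) : ℂ) * Complex.I)
        (((Real.exp (-t) * -1 * P.2 k : ℝ) : ℂ) + ((Real.exp t * P.1 k : ℝ) : ℂ) * Complex.I) t :=
      ((((hasDerivAt_neg t).exp.mul_const _).ofReal_comp).add
        ((((Real.hasDerivAt_exp t).mul_const _).ofReal_comp).mul_const _))
    have h3 : (fun t : ℝ => toCpx (Real.exp t • P.1, Real.exp (-t) • P.2) k) =
        fun t : ℝ => ((Real.exp (-t) * P.2 k : ℝ) : ℂ) +
        ((Real.exp t * P.1 k : ℝ) : ℂ) * Complex.I := by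
      funext t
      exact Complex.mk_eq_add_mul_I _ _
    rw [h3]
    refine h2.congr_deriv ?_
    rw [← Complex.mk_eq_add_mul_I]
    apply Complex.ext
    · change Real.exp (-t) * -1 * P.2 k = -(Real.exp (-t) * P.2 k)
      ring
    · change Real.exp t * P.1 k = - -(Real.exp t * P.1 k)
      rw [neg_neg]
  have h2 : HasDerivAt (fun t : ℝ =>
      ((0, toCpx (Real.exp t • P.1, Real.exp (-t) • P.2)) : (Fin r → ℂ) × (Fin d → ℂ)))
      (0, fun k => -starRingEnd ℂ (toCpx (Real.exp t • P.1, Real.exp (-t) • P.2) k)) t :=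
    (hasDerivAt_const t _).prodMk h1
  have h3 := ((m.C.hasFDerivAt_symm hP).restrictScalars ℝ).comp_hasDerivAt t h2
  refine h3.congr_deriv ?_
  rw [field, m.e_box hP, m.proj_box hP]
  rfl

end MorseModel

section

variable {n r d : ℕ} {X : Set (Fin n → ℂ)} {ℓ : (Fin n → ℂ) →L[ℂ] ℂ} {c : ℂ} {δ : ℝ}
  [Fintype (critSet X ℓ)]

lemma morseFn_eq_or (m : ∀ p : critSet X ℓ, MorseModel X r d ℓ c p δ) (hδ : 0 < δ)
    (hsep : ∀ p q : critSet X ℓ, p ≠ q → 6 * δ < dist (p : Fin n → ℂ) q) {a : ℝ}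
    (ha : ∀ p : critSet X ℓ, a < sqDist ℓ c p / 2) {x : Fin n → ℂ} (hx : x ∈ X) :
    morseFn m x = sqDist ℓ c x ∨ a < morseFn m x ∧ a < sqDist ℓ c x := by
  by_cases h : ∃ p : critSet X ℓ, dist x p ≤ 3 * δ
  · obtain ⟨p, hp⟩ := h
    right
    rw [morseFn_eq m hδ hsep p hp]
    exact ⟨(ha p).trans ((m p).half_lt' x hx hp), (ha p).trans ((m p).half_lt x hx hp)⟩
  · push Not at h
    exact Or.inl (morseFn_eq_sqDist m fun p => by linarith [h p])

lemma hasDerivAt_morseFn (m : ∀ p : critSet X ℓ, MorseModel X r d ℓ c p δ)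
    {W : (Fin n → ℂ) → (Fin n → ℂ)} {Φ : ℝ → (Fin n → ℂ) → (Fin n → ℂ)} (hΦ : IsFlow W Φ)
    (x : Fin n → ℂ) (t : ℝ) : HasDerivAt (fun t => morseFn m (Φ t x))
      (fderiv ℝ (morseFn m) (Φ t x) (W (Φ t x))) t :=
  HasFDerivAt.comp_hasDerivAt (l := morseFn m) (f := fun t => Φ t x) t
    ((contDiff_morseFn m).differentiable (by simp) (Φ t x)).hasFDerivAt (hΦ.hasDerivAt x t)

theorem exists_morseFlow (h : IsLCI X r) (hrd : r + d = n) (hg : IsGoodPencil X ℓ c) :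
    ∃ a₀ > 0, ∀ a, 0 < a → a < a₀ → ∀ Y, (Y = X ∨ Y = X \ {x | ℓ x = c}) →
      ∃ Φ f j q b ρ, MorseFlow (ι := critSet X ℓ) (d := d) Φ f j q b ρ a Y ∧
        ∀ x ∈ X, f x ≤ a ↔ sqDist ℓ c x ≤ a := by
  obtain ⟨δ, hδ, hm, hsep⟩ := hg.exists_models h hrd
  have m := fun p => (hm p).some
  obtain ⟨W, hW, ⟨B, hB⟩, hWX, hW0, hWm, hWd, hWd'⟩ := exists_gradient_field h hrd hg hδ m hsep
  have hW1 : ContDiff ℝ 1 W := hW.of_le (by simp)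
  obtain ⟨Φ, hΦ⟩ := exists_flow hW1 hB
  have hpos : ∀ x, 0 ≤ sqDist ℓ c x := fun x => sq_nonneg _
  have hbpos : ∀ p : critSet X ℓ, 0 < sqDist ℓ c p := fun p => by
    have := sub_ne_zero.2 (hg.noncritical p p.2)
    unfold sqDist; positivity
  obtain ⟨a₀, hlt, ha₀⟩ : ∃ a₀, (∀ p : critSet X ℓ, a₀ < sqDist ℓ c p / 2) ∧ 0 < a₀ := by
    have h1 : ∀ᶠ a in 𝓝[>] (0 : ℝ), ∀ p : critSet X ℓ, a < sqDist ℓ c p / 2 := by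
      rw [eventually_all]
      exact fun p => eventually_nhdsWithin_of_eventually_nhds
        (eventually_lt_nhds (by linarith [hbpos p]))
    exact (h1.and self_mem_nhdsWithin).exists
  obtain ⟨ρ, hρbox, hρ⟩ : ∃ ρ, (∀ p P, ‖P‖ ≤ ρ →
      ((0, toCpx P) : (Fin r → ℂ) × (Fin d → ℂ)) ∈ (m p).C.e.target ∧
        dist ((m p).box P) p ≤ δ / 4) ∧ 0 < ρ := by
    choose ρ hρ0 hρ using fun p => (m p).exists_box hδ
    have h1 : ∀ᶠ s in 𝓝[>] (0 : ℝ), ∀ p, s < ρ p := by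
      rw [eventually_all]
      exact fun p => eventually_nhdsWithin_of_eventually_nhds (eventually_lt_nhds (hρ0 p))
    obtain ⟨s, hs, hs0⟩ := (h1.and self_mem_nhdsWithin).exists
    exact ⟨s, fun p P hP => hρ p P (hP.trans (hs p).le), hs0⟩
  have hΦX : ∀ x ∈ X, ∀ t, Φ t x ∈ X := fun x hx t =>
    hΦ.mem_iff_of_tangent h hrd hW1 hWX hx t
  have hanti : ∀ x ∈ X, fderiv ℝ (morseFn m) x (W x) ≤ 0 := by
    intro x hx
    have h1 : 0 ≤ 2 * sqDist ℓ c x / (1 + sqDist ℓ c x) := by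
      have := hpos x; positivity
    by_cases hp : ∃ p : critSet X ℓ, dist x p ≤ 2 * δ
    · obtain ⟨p, hp⟩ := hp
      refine (hWd p x hx hp).trans (neg_nonpos.2 (le_min ?_ h1))
      unfold MorseModel.sq; positivity
    · push Not at hp
      exact (hWd' x hx fun p => (hp p).le).trans (neg_nonpos.2 h1)
  refine ⟨a₀, ha₀, fun a ha haa₀ Y hY => ?_⟩
  have halt : ∀ p : critSet X ℓ, a < sqDist ℓ c p / 2 := fun p => haa₀.trans (hlt p)
  have hor := fun x (hx : x ∈ X) => morseFn_eq_or m hδ hsep halt hx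
  have hYX : Y ⊆ X := by
    rcases hY with rfl | rfl
    exacts [subset_rfl, Set.sdiff_subset]
  have hYmem : ∀ x ∈ X, 0 < sqDist ℓ c x → x ∈ Y := by
    intro x hx hx0
    rcases hY with rfl | rfl
    · exact hx
    · refine ⟨hx, fun hxc => hx0.ne' ?_⟩
      rw [Set.mem_ofPred_eq] at hxc
      simp [sqDist, hxc]
  have hboxY : ∀ p P, ‖P‖ ≤ ρ → (m p).box P ∈ Y := by
    intro p P hP
    obtain ⟨h1, h2⟩ := hρbox p P hP
    have h3 := (m p).half_lt _ ((m p).box_mem h1) (by linarith)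
    exact hYmem _ ((m p).box_mem h1) (by linarith [hbpos p])
  have hin : ∀ {P : EuclideanSpace ℝ (Fin d) × EuclideanSpace ℝ (Fin d)},
    P ∈ Metric.closedBall 0 ρ → ‖P‖ ≤ ρ := fun hP => mem_closedBall_zero_iff.1 hP
  refine ⟨Φ, morseFn m, fun p => (m p).box, fun p => (m p).coord, fun p => sqDist ℓ c p, ρ,
    ⟨hΦ.continuous, hΦ.zero, hΦ.add hW1, ?_, (contDiff_morseFn m).continuous, ?_, hρ,
      fun p P hP => hboxY p P (hin hP),
      fun p => (m p).continuousOn_box fun P hP => (hρbox p P hP).1,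
      fun p => (m p).continuous_coord, fun p P hP => (m p).coord_box (hρbox p P (hin hP)).1,
      ?_, ?_, ?_, ?_, ?_, fun p => by linarith [halt p, hbpos p]⟩, ?_⟩
  · intro x hx t _
    rcases hY with rfl | rfl
    · exact hΦX x hx t
    · refine ⟨hΦX x hx.1 t, fun hc => hx.2 ?_⟩
      have h1 := hΦ.eq_self_of_eq_zero hW1 (hW0 _ (hΦX x hx.1 t) hc) (-t)
      rw [← hΦ.add hW1, neg_add_cancel, hΦ.zero] at h1
      rw [h1]
      exact hc
  · intro x hx t ht
    have h1 : AntitoneOn (fun t => morseFn m (Φ t x)) (Set.Ici 0) := by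
      refine antitoneOn_of_deriv_nonpos (convex_Ici 0)
        (fun t _ => (hasDerivAt_morseFn m hΦ x t).continuousAt.continuousWithinAt)
        (fun t _ => (hasDerivAt_morseFn m hΦ x t).differentiableAt.differentiableWithinAt)
        fun t _ => ?_
      rw [(hasDerivAt_morseFn m hΦ x t).deriv]
      exact hanti _ (hΦX x (hYX hx) t)
    have h2 := h1 (Set.self_mem_Ici) (Set.mem_Ici.2 ht) ht
    simpa only [hΦ.zero] using h2
  · intro p p' P hP P' hP' hEq
    by_contra hne
    have h1 := (hρbox p P (hin hP)).2
    have h2 := (hρbox p' P' (hin hP')).2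
    have h3 := hsep p p' hne
    rw [← hEq] at h2
    have h4 := dist_triangle_left (p : Fin n → ℂ) p' ((m p).box P)
    linarith
  · intro p
    obtain ⟨U, hU, hUX⟩ := (m p).exists_isOpen_box fun P hP => (hρbox p P hP).1
    refine ⟨U, hU, subset_antisymm ?_ ?_⟩
    · rw [← hUX]
      exact Set.inter_subset_inter_right U hYX
    · intro x hx
      have hxU : x ∈ U ∩ X := hUX ▸ hx
      obtain ⟨P, hP, rfl⟩ := hx
      exact ⟨hxU.1, hboxY p P (mem_ball_zero_iff.1 hP).le⟩
  · intro p P hP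
    obtain ⟨h1, h2⟩ := hρbox p P (hin hP)
    rw [morseFn_eq m hδ hsep p (by linarith), MorseModel.corr, (m p).eq_one _ h2,
      (m p).proj_box h1, reSq_toCpx]
    ring
  · intro p P hP t ht hPt
    have hP1 : ‖P.2‖ ≤ ρ := (norm_snd_le P).trans (hin hP)
    have hbd : ∀ s ∈ Set.Icc 0 t, ‖(Real.exp s • P.1, Real.exp (-s) • P.2)‖ ≤ ρ := by
      intro s hs
      rw [Prod.norm_def, max_le_iff, norm_smul, norm_smul, Real.norm_eq_abs, Real.norm_eq_abs,
        Real.abs_exp, Real.abs_exp]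
      constructor
      · refine le_trans ?_ hPt
        gcongr
        exact hs.2
      · refine le_trans (mul_le_of_le_one_left (norm_nonneg _) ?_) hP1
        exact Real.exp_le_one_iff.2 (neg_nonpos.2 hs.1)
    have h1 := hΦ.eq_of_curve hW1
      (σ := fun s => (m p).box (Real.exp s • P.1, Real.exp (-s) • P.2)) ht fun s hs => by
        obtain ⟨h2, h3⟩ := hρbox p _ (hbd s hs)
        rw [hWm p _ (by linarith)]
        exact (m p).hasDerivAt_box P s h2
    simpa only [neg_zero, Real.exp_zero, one_smul, Prod.mk.eta] using h1
  · intro s hs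
    refine ⟨min (s ^ 2) (2 * a / (1 + a)), lt_min (by positivity) (by positivity),
      fun x hx τ hτ hout => ?_⟩
    set κ := min (s ^ 2) (2 * a / (1 + a)) with hκ
    have h1 : AntitoneOn (fun t => morseFn m (Φ t x) + κ * t) (Set.Icc 0 τ) := by
      have hd : ∀ t, HasDerivAt (fun t => morseFn m (Φ t x) + κ * t)
          (fderiv ℝ (morseFn m) (Φ t x) (W (Φ t x)) + κ * 1) t := fun t =>
        (hasDerivAt_morseFn m hΦ x t).add ((hasDerivAt_id t).const_mul κ)
      refine antitoneOn_of_deriv_nonpos (convex_Icc 0 τ)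
        (fun t _ => (hd t).continuousAt.continuousWithinAt)
        (fun t _ => (hd t).differentiableAt.differentiableWithinAt) fun t ht => ?_
      rw [(hd t).deriv]
      obtain ⟨h2, h3⟩ := hout t (interior_subset ht)
      have hyX := hΦX x (hYX hx) t
      set y := Φ t x
      have h4 : a ≤ sqDist ℓ c y := by
        rcases hor y hyX with h5 | h5
        · rwa [← h5]
        · exact h5.2.le
      have h5 : κ ≤ 2 * sqDist ℓ c y / (1 + sqDist ℓ c y) := by
        refine (min_le_right _ _).trans ?_
        have := hpos y
        rw [div_le_div_iff₀ (by positivity) (by positivity)]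
        nlinarith
      by_cases hp : ∃ p : critSet X ℓ, dist y p ≤ 2 * δ
      · obtain ⟨p, hp⟩ := hp
        have h6 := hWd p y hyX hp
        have h7 : s ^ 2 ≤ (m p).sq y :=
          (m p).sq_ge hyX ((m p).subset_source (Metric.mem_closedBall.2 (by linarith))) hs (h3 p)
        have h8 : κ ≤ min ((m p).sq y) (2 * sqDist ℓ c y / (1 + sqDist ℓ c y)) :=
          le_min ((min_le_left _ _).trans h7) h5
        linarith
      · push Not at hp
        have h6 := hWd' y hyX fun p => (hp p).le
        linarith
    have h2 := h1 (Set.left_mem_Icc.2 hτ) (Set.right_mem_Icc.2 hτ) hτ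
    simp only [hΦ.zero, mul_zero, add_zero] at h2
    linarith
  · intro x hx
    rcases hor x hx with h1 | ⟨h1, h2⟩
    · rw [h1]
    · exact iff_of_false (not_le.2 h1) (not_le.2 h2)

end

/-- A family of self-maps of `X` which translates the values of `ℓ` near `c`. -/
structure IsTransport {E : Type} [TopologicalSpace E] (X : Set E) (ℓ : E → ℂ) (c : ℂ) (ε : ℝ)
    (G : ℂ → E → E) : Prop where
  continuous : Continuous fun p : ℂ × E => G p.1 p.2
  zero : ∀ x, G 0 x = x
  mem : ∀ x ∈ X, ∀ ζ, G ζ x ∈ X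
  eq_add : ∀ x ∈ X, ∀ ζ : ℂ, ‖ℓ x - c‖ ≤ ε → ‖ζ‖ ≤ ε → ℓ (G ζ x) = ℓ x + ζ

lemma exists_isTransport {n r d : ℕ} {X : Set (Fin n → ℂ)} {ℓ : (Fin n → ℂ) →L[ℂ] ℂ} {c : ℂ}
    (h : IsLCI X r) (hrd : r + d = n) (hg : IsGoodPencil X ℓ c) :
    ∃ ε > 0, ∃ G, IsTransport X ℓ c ε G := by
  have hfin := hg.finite_critSet h hrd
  obtain ⟨ε, hε, hε0⟩ : ∃ ε, (∀ p ∈ critSet X ℓ, ε < ‖ℓ p - c‖ / 4) ∧ 0 < ε := by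
    have h1 : ∀ᶠ ε in 𝓝[>] (0 : ℝ), ∀ p ∈ critSet X ℓ, ε < ‖ℓ p - c‖ / 4 := by
      rw [hfin.eventually_all]
      intro p hp
      have := norm_pos_iff.2 (sub_ne_zero.2 (hg.noncritical p hp))
      exact eventually_nhdsWithin_of_eventually_nhds (eventually_lt_nhds (by linarith))
    exact (h1.and self_mem_nhdsWithin).exists
  obtain ⟨R, C, hRC⟩ := hg.atInfinity
  obtain ⟨V, hV, ⟨B, hB⟩, hVX⟩ := h.exists_unit_field hrd ℓ (N := {x | 4 * ε < ‖ℓ x - c‖})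
    (isOpen_lt continuous_const (by fun_prop))
    (fun x hx hx0 => by have := hε x ⟨hx, hx0⟩; rw [Set.mem_ofPred_eq]; linarith) hRC
  have hV1 : ContDiff ℝ 1 V := hV.of_le (by simp)
  have hW1 : ContDiff ℝ 1 fun x => Complex.I • V x := hV1.const_smul Complex.I
  have hB' : ∀ x, ‖Complex.I • V x‖ ≤ B := fun x => by simpa [norm_smul] using hB x
  obtain ⟨Φ, hΦ⟩ := exists_flow hV1 hB
  obtain ⟨Ψ, hΨ⟩ := exists_flow hW1 hB'
  have hΦX : ∀ x ∈ X, ∀ t, Φ t x ∈ X := fun x hx t =>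
    hΦ.mem_iff_of_tangent h hrd hV1 (fun x hx => (hVX x hx).1) hx t
  have hΨX : ∀ x ∈ X, ∀ t, Ψ t x ∈ X := fun x hx t =>
    hΨ.mem_iff_of_tangent h hrd hW1 (fun x hx => Submodule.smul_mem _ _ (hVX x hx).1) hx t
  have hV' : ∀ y ∈ X, ‖ℓ y - c‖ < 4 * ε → ℓ (V y) = 1 := fun y hy hlt =>
    (hVX y hy).2 (fun hN => lt_asymm hlt hN)
  refine ⟨ε, hε0, fun ζ x => Φ ζ.re (Ψ ζ.im x), ?_, fun x => by simp [hΦ.zero, hΨ.zero],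
    fun x hx ζ => hΦX _ (hΨX x hx _) _, fun x hx ζ hx0 hζ => ?_⟩
  · have h1 : Continuous fun p : ℂ × (Fin n → ℂ) => Ψ p.1.im p.2 :=
      hΨ.continuous.comp (f := fun p : ℂ × (Fin n → ℂ) => (p.1.im, p.2)) (by fun_prop)
    exact hΦ.continuous.comp ((Complex.continuous_re.comp continuous_fst).prodMk h1)
  · have hre : ‖(ζ.re : ℂ)‖ ≤ ε := by
      rw [Complex.norm_real]; exact (Complex.abs_re_le_norm ζ).trans hζ
    have him : ‖(ζ.im : ℂ) * Complex.I‖ ≤ ε := by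
      rw [norm_mul, Complex.norm_I, mul_one, Complex.norm_real]
      exact (Complex.abs_im_le_norm ζ).trans hζ
    have e1 : ‖ℓ x + (ζ.im : ℂ) * Complex.I - c‖ ≤ 2 * ε := by
      rw [add_sub_right_comm]
      exact (norm_add_le _ _).trans (by linarith)
    have h1 : ℓ (Ψ ζ.im x) = ℓ x + ζ.im * Complex.I :=
      hΨ.eq_add hB' (ℓ.restrictScalars ℝ) (X := X) (c := c) (r := 4 * ε) (r' := 3 * ε)
        (fun t => hΨX x hx t) (by linarith)
        (fun y hy hlt => by simp [hV' y hy hlt]) (hx0.trans (by linarith))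
        (e1.trans (by linarith))
    have h2 : ℓ (Φ ζ.re (Ψ ζ.im x)) = ℓ (Ψ ζ.im x) + ζ.re * 1 := by
      refine hΦ.eq_add hB (ℓ.restrictScalars ℝ) (X := X) (c := c) (r := 4 * ε) (r' := 3 * ε)
        (fun t => hΦX _ (hΨX x hx _) t) (by linarith) hV' ?_ ?_
      · change ‖ℓ (Ψ ζ.im x) - c‖ ≤ _
        rw [h1]; exact e1.trans (by linarith)
      · change ‖ℓ (Ψ ζ.im x) + ζ.re * 1 - c‖ ≤ _
        rw [h1, mul_one, add_sub_right_comm]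
        exact (norm_add_le _ _).trans (by linarith)
    rw [h2, h1]
    conv_rhs => rw [← Complex.re_add_im ζ]
    ring

lemma norm_ofReal_mul_le {s : ℝ} (hs : s ∈ Set.Icc (0 : ℝ) 1) {z : ℂ} {ε : ℝ} (hz : ‖z‖ ≤ ε) :
    ‖(s : ℂ) * z‖ ≤ ε := by
  rw [norm_mul, Complex.norm_real, Real.norm_of_nonneg hs.1]
  exact (mul_le_of_le_one_left (norm_nonneg _) hs.2).trans hz

namespace IsTransport

variable {E : Type} [TopologicalSpace E] {X : Set E} {ℓ : E → ℂ} {c : ℂ} {ε b : ℝ}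
  {G : ℂ → E → E}

lemma homotopyEquiv_fiber (hG : IsTransport X ℓ c ε G) (hℓ : Continuous ℓ) (hb : 0 ≤ b)
    (hbε : b ≤ ε) : Nonempty (ContinuousMap.HomotopyEquiv ↥(X ∩ {x | ℓ x = c})
      ↥(X ∩ {x | ‖ℓ x - c‖ ≤ b})) := by
  have key : ∀ s ∈ Set.Icc (0 : ℝ) 1, ∀ x ∈ X, ‖ℓ x - c‖ ≤ b →
      ℓ (G (s * (c - ℓ x)) x) = ℓ x + s * (c - ℓ x) := fun s hs x hx hxb =>
    hG.eq_add x hx _ (hxb.trans hbε)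
      (norm_ofReal_mul_le hs (by rw [norm_sub_rev]; exact hxb.trans hbε))
  refine homotopyEquiv_of_deformation (fun x hx => ⟨hx.1, ?_⟩) (fun s x => G (s * (c - ℓ x)) x)
    ?_ (fun x _ => by simp [hG.zero]) ?_ ?_ ?_
  · rw [Set.mem_ofPred_eq, show ℓ x = c from hx.2, sub_self, norm_zero]; exact hb
  · exact (hG.continuous.comp (f := fun p : ℝ × E => ((p.1 : ℂ) * (c - ℓ p.2), p.2))
      (by fun_prop)).continuousOn
  · rintro s hs x ⟨hx, hxb⟩
    refine ⟨hG.mem x hx _, ?_⟩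
    rw [Set.mem_ofPred_eq, key s hs x hx hxb,
      show ℓ x + s * (c - ℓ x) - c = ((1 - s : ℝ) : ℂ) * (ℓ x - c) by push_cast; ring]
    exact norm_ofReal_mul_le ⟨by linarith [hs.2], by linarith [hs.1]⟩ hxb
  · rintro x ⟨hx, hxb⟩
    refine ⟨hG.mem x hx _, ?_⟩
    have := key 1 (by simp) x hx hxb
    rw [Set.mem_ofPred_eq, this]
    simp
  · rintro s hs x ⟨hx, hxc⟩
    have hxc : ℓ x = c := hxc
    simpa [hxc, hG.zero] using hx

lemma homotopyEquiv_prod_circle (hG : IsTransport X ℓ c ε G) (hℓ : Continuous ℓ) (hb : 0 < b)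
    (hbε : b ≤ ε) : Nonempty (ContinuousMap.HomotopyEquiv (↥(X ∩ {x | ℓ x = c}) × Circle)
      ↥((X \ {x | ℓ x = c}) ∩ {x | ‖ℓ x - c‖ ≤ b})) := by
  let P : Set E := (X \ {x | ℓ x = c}) ∩ {x | ‖ℓ x - c‖ ≤ b}
  have hP0 : ∀ x : ↥P, ℓ x - c ≠ 0 := fun x => sub_ne_zero.2 x.2.1.2
  let ph : ↥P → Circle := fun x => ⟨(ℓ x - c) / (‖ℓ x - c‖ : ℂ), by
    simp [Submonoid.unitSphere, norm_ne_zero_iff.2 (hP0 x)]⟩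
  have hph : Continuous ph := by
    refine Continuous.subtype_mk (Continuous.div (by fun_prop) (by fun_prop) fun x => ?_) _
    simpa using hP0 x
  have hph' : ∀ x : ↥P, (ℓ x - c : ℂ) = ‖ℓ x - c‖ * (ph x : ℂ) := fun x =>
    (mul_div_cancel₀ _ (by simpa using hP0 x)).symm
  have hbu : ∀ u : Circle, ‖(b : ℂ) * u‖ = b := fun u => by
    rw [norm_mul, Complex.norm_real, Real.norm_of_nonneg hb.le, Circle.norm_coe, mul_one]
  have hpull : ∀ x : ↥P, ∀ s ∈ Set.Icc (0 : ℝ) 1, ℓ (G (-(s * (ℓ x - c))) x) =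
      ℓ x - s * (ℓ x - c) := fun x s hs => by
    rw [hG.eq_add x x.2.1.1 _ (x.2.2.trans hbε), ← sub_eq_add_neg]
    rw [norm_neg]
    exact norm_ofReal_mul_le hs (x.2.2.trans hbε)
  have hpush : ∀ y : ↥(X ∩ {x | ℓ x = c}), ∀ u : Circle, ∀ s ∈ Set.Icc (0 : ℝ) 1,
      ℓ (G (s * (b * u)) y) = c + s * (b * u) := fun y u s hs => by
    have hy : ℓ y = c := y.2.2
    rw [hG.eq_add y y.2.1 _ (by rw [hy, sub_self, norm_zero]; linarith), hy]
    exact norm_ofReal_mul_le hs ((hbu u).le.trans hbε)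
  let A : ℝ → ↥P → E := fun s x => G (s * (b * ph x)) (G (-(s * (ℓ x - c))) x)
  have hA : Continuous fun p : ℝ × ↥P => A p.1 p.2 := by
    have h1 : Continuous fun p : ℝ × ↥P => G (-(p.1 * (ℓ p.2 - c))) p.2 :=
      hG.continuous.comp (f := fun p : ℝ × ↥P => (-((p.1 : ℂ) * (ℓ p.2 - c)), (p.2 : E)))
        (by fun_prop)
    have h2 : Continuous fun p : ℝ × ↥P => (p.1 : ℂ) * (b * ph p.2) := by fun_prop
    exact hG.continuous.comp (h2.prodMk h1)
  have hAP : ∀ s ∈ Set.Icc (0 : ℝ) 1, ∀ x, A s x ∈ P := by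
    intro s hs x
    have hx0 : 0 < ‖ℓ x - c‖ := norm_pos_iff.2 (hP0 x)
    have hxb : ‖ℓ x - c‖ ≤ b := x.2.2
    have h1 : ℓ (A s x) - c = (((1 - s) * ‖ℓ x - c‖ + s * b : ℝ) : ℂ) * ph x := by
      rw [hG.eq_add _ (hG.mem x x.2.1.1 _), hpull x s hs]
      · push_cast
        linear_combination (1 - s : ℂ) * hph' x
      · rw [hpull x s hs,
          show ℓ x - s * (ℓ x - c) - c = ((1 - s : ℝ) : ℂ) * (ℓ x - c) by push_cast; ring]
        exact norm_ofReal_mul_le ⟨by linarith [hs.2], by linarith [hs.1]⟩ (hxb.trans hbε)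
      · exact norm_ofReal_mul_le hs ((hbu _).le.trans hbε)
    have h2 : 0 < (1 - s) * ‖ℓ x - c‖ + s * b := by
      rcases hs.1.eq_or_lt with rfl | h0
      · simpa using hx0
      · have := mul_nonneg (sub_nonneg.2 hs.2) hx0.le
        have := mul_pos h0 hb
        linarith
    have h3 : ‖ℓ (A s x) - c‖ = (1 - s) * ‖ℓ x - c‖ + s * b := by
      rw [h1, norm_mul, Complex.norm_real, Real.norm_of_nonneg h2.le, Circle.norm_coe, mul_one]
    refine ⟨⟨hG.mem _ (hG.mem x x.2.1.1 _) _, fun h0 => ?_⟩, ?_⟩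
    · have h0 : ℓ (A s x) = c := h0
      rw [h0, sub_self, norm_zero] at h3
      exact h2.ne h3
    · rw [Set.mem_ofPred_eq, h3]
      nlinarith [hs.2]
  let B : ℝ → ↥(X ∩ {x | ℓ x = c}) × Circle → E := fun s p =>
    G (-(s * (b * p.2))) (G (s * (b * p.2)) p.1)
  have hB : Continuous fun p : ℝ × (↥(X ∩ {x | ℓ x = c}) × Circle) => B p.1 p.2 := by
    have h1 : Continuous fun p : ℝ × (↥(X ∩ {x | ℓ x = c}) × Circle) =>
        G (p.1 * (b * p.2.2)) p.2.1 :=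
      hG.continuous.comp (f := fun p : ℝ × (↥(X ∩ {x | ℓ x = c}) × Circle) =>
        ((p.1 : ℂ) * (b * p.2.2), (p.2.1 : E))) (by fun_prop)
    have h2 : Continuous fun p : ℝ × (↥(X ∩ {x | ℓ x = c}) × Circle) =>
        -((p.1 : ℂ) * (b * p.2.2)) := by fun_prop
    exact hG.continuous.comp (h2.prodMk h1)
  have hBF : ∀ s ∈ Set.Icc (0 : ℝ) 1, ∀ p, B s p ∈ X ∩ {x | ℓ x = c} := by
    intro s hs p
    have hn := norm_ofReal_mul_le hs ((hbu p.2).le.trans hbε)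
    refine ⟨hG.mem _ (hG.mem _ p.1.2.1 _) _, ?_⟩
    rw [Set.mem_ofPred_eq, hG.eq_add _ (hG.mem _ p.1.2.1 _), hpush _ _ s hs]
    · ring
    · rw [hpush _ _ s hs, add_sub_cancel_left]; exact hn
    · rwa [norm_neg]
  have hto : Continuous fun p : ↥(X ∩ {x | ℓ x = c}) × Circle => G (b * p.2) p.1 :=
    hG.continuous.comp (f := fun p : ↥(X ∩ {x | ℓ x = c}) × Circle => ((b : ℂ) * p.2, (p.1 : E)))
      (by fun_prop)
  have hval : ∀ p : ↥(X ∩ {x | ℓ x = c}) × Circle, ℓ (G (b * p.2) p.1) - c = b * p.2 := fun p => by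
    have := hpush p.1 p.2 1 (by simp)
    rw [Complex.ofReal_one, one_mul] at this
    rw [this]; ring
  have htoP : ∀ p : ↥(X ∩ {x | ℓ x = c}) × Circle, G (b * p.2) p.1 ∈ P := fun p => by
    refine ⟨⟨hG.mem _ p.1.2.1 _, fun h0 => ?_⟩, ?_⟩
    · have h1 := hbu p.2
      rw [← hval p, show ℓ (G (b * p.2) p.1) = c from h0, sub_self, norm_zero] at h1
      exact hb.ne h1
    · rw [Set.mem_ofPred_eq, hval p, hbu]
  have hinv : Continuous fun x : ↥P => G (-(ℓ x - c)) x :=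
    hG.continuous.comp (f := fun x : ↥P => (-(ℓ x - c), (x : E))) (by fun_prop)
  have hinvF : ∀ x : ↥P, G (-(ℓ x - c)) x ∈ X ∩ {x | ℓ x = c} := fun x => by
    have := hpull x 1 (by simp)
    rw [Complex.ofReal_one, one_mul] at this
    exact ⟨hG.mem _ x.2.1.1 _, by rw [Set.mem_ofPred_eq, this]; ring⟩
  refine ⟨⟨⟨fun p => ⟨_, htoP p⟩, hto.subtype_mk _⟩,
    ⟨fun x => (⟨_, hinvF x⟩, ph x), (hinv.subtype_mk _).prodMk hph⟩, ?_, ?_⟩⟩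
  · refine ⟨ContinuousMap.Homotopy.symm ⟨⟨fun p => (⟨B p.1 p.2, hBF _ p.1.2 _⟩, p.2.2), ?_⟩, ?_, ?_⟩⟩
    · exact ((hB.comp (f := fun p : unitInterval × (↥(X ∩ {x | ℓ x = c}) × Circle) =>
        ((p.1 : ℝ), p.2)) (by fun_prop)).subtype_mk _).prodMk (by fun_prop)
    · exact fun p => Prod.ext (Subtype.ext (by simp [B, hG.zero])) rfl
    · intro p
      refine Prod.ext (Subtype.ext ?_) (Circle.ext ?_)
      · change G (-(((1 : ℝ) : ℂ) * (b * p.2))) (G (((1 : ℝ) : ℂ) * (b * p.2)) p.1) =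
          G (-(ℓ (G (b * p.2) p.1) - c)) (G (b * p.2) p.1)
        rw [hval, Complex.ofReal_one, one_mul]
      · change (p.2 : ℂ) = (ℓ (G (b * p.2) p.1) - c) / (‖ℓ (G (b * p.2) p.1) - c‖ : ℂ)
        rw [hval, hbu, mul_div_cancel_left₀]
        exact_mod_cast hb.ne'
  · refine ⟨ContinuousMap.Homotopy.symm ⟨⟨fun p => ⟨A p.1 p.2, hAP _ p.1.2 _⟩, ?_⟩, ?_, ?_⟩⟩
    · exact (hA.comp (f := fun p : unitInterval × ↥P => ((p.1 : ℝ), p.2)) (by fun_prop)).subtype_mk _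
    · exact fun p => Subtype.ext (by simp [A, hG.zero])
    · intro x
      refine Subtype.ext ?_
      change G (((1 : ℝ) : ℂ) * (b * ph x)) (G (-(((1 : ℝ) : ℂ) * (ℓ x - c))) x) =
        G (b * ph x) (G (-(ℓ x - c)) x)
      rw [Complex.ofReal_one, one_mul, one_mul]

end IsTransport

/-- The linear form with coefficients `a`. -/
def linearForm {n : ℕ} (a : Fin n → ℂ) : (Fin n → ℂ) →L[ℂ] ℂ :=
  ∑ k, a k • ContinuousLinearMap.proj k

lemma linearForm_apply {n : ℕ} (a x : Fin n → ℂ) : linearForm a x = ∑ k, a k * x k := by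
  simp [linearForm]

lemma GoodPencil.isGoodPencil {n : ℕ} {X : Set (Fin n → ℂ)} {a : Fin n → ℂ} {c : ℂ}
    (h : GoodPencil X a c) : IsGoodPencil X (linearForm a) c := by
  refine ⟨?_, ?_, ?_⟩ <;> simp only [critSet, linearForm_apply]
  · exact fun x hx => h.noncritical x hx.1 hx.2
  · exact fun x hx => h.nondegenerate x hx.1 hx.2
  · exact h.atInfinity

lemma IsGoodPencil.exists_attachedCells {n r d : ℕ} {X : Set (Fin n → ℂ)}
    {ℓ : (Fin n → ℂ) →L[ℂ] ℂ} {c : ℂ} (hg : IsGoodPencil X ℓ c) (h : IsLCI X r)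
    (hrd : r + d = n) :
    (∃ Z : TopCat.{0}, AttachedCells (TopCat.of ↥(X ∩ {x | ℓ x = c})) Z
        (List.replicate (critSet X ℓ).ncard d) ∧
      Nonempty (ContinuousMap.HomotopyEquiv ↑Z ↥X)) ∧
    ∃ Z : TopCat.{0}, AttachedCells (TopCat.of (↥(X ∩ {x | ℓ x = c}) × Circle)) Z
        (List.replicate (critSet X ℓ).ncard d) ∧
      Nonempty (ContinuousMap.HomotopyEquiv ↑Z ↥(X \ {x | ℓ x = c})) := by
  have hfin := hg.finite_critSet h hrd
  have hft : Fintype (critSet X ℓ) := hfin.fintype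
  obtain ⟨a₀, ha₀, hflow⟩ := exists_morseFlow h hrd hg
  obtain ⟨ε, hε, G, hG⟩ := exists_isTransport h hrd hg
  obtain ⟨b, ⟨hbε, hba⟩, hb⟩ : ∃ b, (b < ε ∧ b ^ 2 < a₀) ∧ 0 < b := by
    have h1 : ∀ᶠ b in 𝓝[>] (0 : ℝ), b < ε ∧ b ^ 2 < a₀ := by
      refine eventually_nhdsWithin_of_eventually_nhds ((eventually_lt_nhds hε).and ?_)
      exact ((continuous_pow 2).tendsto (0 : ℝ)).eventually_lt_const (by simpa using ha₀)
    exact (h1.and self_mem_nhdsWithin).exists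
  have hlev : ∀ x, sqDist ℓ c x ≤ b ^ 2 ↔ ‖ℓ x - c‖ ≤ b := fun x =>
    pow_le_pow_iff_left₀ (norm_nonneg _) hb.le two_ne_zero
  have key : ∀ Y, (Y = X ∨ Y = X \ {x | ℓ x = c}) → ∀ (A : Type) [TopologicalSpace A],
      Nonempty (ContinuousMap.HomotopyEquiv A ↥(Y ∩ {x | ‖ℓ x - c‖ ≤ b})) →
      ∃ Z : TopCat.{0}, AttachedCells (TopCat.of A) Z (List.replicate (critSet X ℓ).ncard d) ∧
        Nonempty (ContinuousMap.HomotopyEquiv ↑Z ↥Y) := by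
    rintro Y hY A _ ⟨e⟩
    obtain ⟨Φ, f, j, q, b', ρ, hM, hf⟩ := hflow (b ^ 2) (by positivity) hba Y hY
    obtain ⟨Z, hZ, ⟨e1⟩⟩ := hM.attachedCells _ rfl
    have hset : Y ∩ {x | f x ≤ b ^ 2} = Y ∩ {x | ‖ℓ x - c‖ ≤ b} := by
      ext x
      refine and_congr_right fun hx => (hf x ?_).trans (hlev x)
      rcases hY with rfl | rfl
      · exact hx
      · exact hx.1
    rw [hset] at hZ
    obtain ⟨Z', hZ', ⟨e2⟩⟩ := attachedCells_homotopy_invariant _ (A' := TopCat.of A) hZ e.symm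
    exact ⟨Z', hZ', ⟨e2.symm.trans e1⟩⟩
  exact ⟨key X (Or.inl rfl) _ (hG.homotopyEquiv_fiber ℓ.continuous hb.le hbε.le),
    key _ (Or.inr rfl) _ (hG.homotopyEquiv_prod_circle ℓ.continuous hb hbε.le)⟩

lemma HasEulerChar.attachedCells {A Y : Type} [TopologicalSpace A] [TopologicalSpace Y] {m : ℤ}
    (h : HasEulerChar A m) {Z : TopCat.{0}} {L : List ℕ} (hZ : AttachedCells (TopCat.of A) Z L)
    (hY : Nonempty (ContinuousMap.HomotopyEquiv ↑Z Y)) :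
    HasEulerChar Y (m + (L.map fun d => (-1 : ℤ) ^ d).sum) := by
  obtain ⟨Z0, L0, h0, ⟨e0⟩, rfl⟩ := h
  obtain ⟨e1⟩ := hY
  obtain ⟨Z', hZ', ⟨e2⟩⟩ := attachedCells_homotopy_invariant L (A' := Z0) hZ e0
  exact ⟨Z', L0 ++ L, attachedCells_append _ _ h0 hZ', ⟨e1.symm.trans e2⟩, by simp⟩

lemma hasEulerChar_of_isEmpty (A : Type) [TopologicalSpace A] [IsEmpty A] : HasEulerChar A 0 :=
  ⟨TopCat.of Empty, [], ⟨Homeomorph.refl _⟩,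
    ⟨(Homeomorph.empty : A ≃ₜ Empty).toHomotopyEquiv⟩, by simp⟩

lemma GoodPencil.exists_hasEulerChar_fiber {n r d : ℕ} {X : Set (Fin n → ℂ)} {a : Fin n → ℂ}
    {c : ℂ} (hg : GoodPencil X a c) (h : IsLCI X r) (hrd : r + d = n)
    (ih : ∀ d', d' + 1 = d → ∀ (Y : Set (Fin n → ℂ)) (r' : ℕ), IsLCI Y r' → r' + d' = n →
      ∃ m, HasEulerChar ↥Y m) :
    ∃ m, HasEulerChar ↥(X ∩ {x | linearForm a x = c}) m := by
  cases d with
  | zero =>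
    have hemp : IsEmpty ↥(X ∩ {x | linearForm a x = c}) := by
      refine ⟨fun ⟨x, hx, hxc⟩ => hg.noncritical x hx (fun v hv => ?_)
        ((linearForm_apply a x).symm.trans hxc)⟩
      have := Submodule.finrank_eq_zero.1 (h.finrank_zTangent hrd hx)
      rw [this, Submodule.mem_bot] at hv
      simp [hv]
    exact ⟨0, hasEulerChar_of_isEmpty _⟩
  | succ d =>
    refine ih d rfl _ (r + 1) ?_ (by omega)
    simp only [linearForm_apply]
    exact h.inter_hyperplane a c hrd hg.noncritical

lemma IsLCI.exists_hasEulerChar {n : ℕ} (d : ℕ) : ∀ (X : Set (Fin n → ℂ)) (r : ℕ), IsLCI X r →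
    r + d = n → ∃ m, HasEulerChar ↥X m := by
  induction d using Nat.strong_induction_on with
  | _ d ih =>
    intro X r h hrd
    obtain ⟨q, hq0, hq⟩ := exists_goodPencil_poly X
    obtain ⟨w, hw⟩ : ∃ w, MvPolynomial.eval w q ≠ 0 := by
      by_contra! h0
      exact hq0 (MvPolynomial.funext fun w => by simpa using h0 w)
    obtain ⟨m, hm⟩ := (hq w hw).exists_hasEulerChar_fiber h hrd fun d' hd' => ih d' (by omega)
    obtain ⟨⟨Z, hZ, e⟩, -⟩ := (hq w hw).isGoodPencil.exists_attachedCells h hrd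
    exact ⟨_, hm.attachedCells hZ e⟩

/-- **Theorem 3.1.** Let `X ⊆ ℂⁿ` be a smooth closed subvariety of dimension `d`, let
`l` be a general linear function and `H_c = {l = c}` for general `c`. Then:
(1) `X` is homotopy equivalent to `X ∩ H_c` with finitely many `d`-cells attached;
(2) the number of `d`-cells equals the number of critical points of `l|_X`;
(3) the number of critical points of `l|_X` equals `(-1)^d χ(X \ H_c)`. -/
theorem smooth_affine_lefschetz_cells {n d : ℕ} (X : Set (Fin n → ℂ))
    (hX : IsSmoothClosedOfDim X d) :
    Generically (K := ℂ) (σ := Fin (n + 1)) fun w =>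
      let l : (Fin n → ℂ) → ℂ := fun z => ∑ i : Fin n, w i.castSucc * z i
      let c : ℂ := w (Fin.last n)
      let K : Set (Fin n → ℂ) :=
        {x | x ∈ X ∧ ∀ v ∈ zTangent X x, (∑ i : Fin n, w i.castSucc * v i) = 0}
      K.Finite ∧
      (∃ Z : TopCat.{0},
        AttachedCells (TopCat.of ↥(X ∩ {z | l z = c})) Z (List.replicate K.ncard d) ∧
        Nonempty (ContinuousMap.HomotopyEquiv ↑Z ↥X)) ∧
      (∃ e : ℤ, HasEulerChar ↥(X \ {z | l z = c}) e ∧ (K.ncard : ℤ) = (-1) ^ d * e) := by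
  obtain ⟨r, hrd, h⟩ := hX.isLCI
  obtain ⟨q, hq0, hq⟩ := exists_goodPencil_poly X
  refine ⟨q, hq0, fun w hw => ?_⟩
  beta_reduce
  intro l c K
  have hg := hq w hw
  have hfin := hg.isGoodPencil.finite_critSet h hrd
  obtain ⟨m, hm⟩ := hg.exists_hasEulerChar_fiber h hrd fun d' _ =>
    IsLCI.exists_hasEulerChar d'
  obtain ⟨hcells, Z, hZ, e⟩ := hg.isGoodPencil.exists_attachedCells h hrd
  have hK : critSet X (linearForm fun k => w k.castSucc) = K := by
    simp only [critSet, linearForm_apply, K]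
  have he := (hasEulerChar_prod_circle hm).attachedCells hZ e
  have hl : {x | linearForm (fun k => w k.castSucc) x = w (Fin.last n)} = {z | l z = c} := by
    simp only [linearForm_apply, l, c]
  rw [hl, hK] at hcells he
  rw [hK] at hfin
  refine ⟨hfin, hcells, _, he, ?_⟩
  have h1 : ((-1 : ℤ) ^ d) * (-1) ^ d = 1 := by rw [← mul_pow]; simp
  simp only [List.map_replicate, List.sum_replicate, nsmul_eq_mul]
  linear_combination -(K.ncard : ℤ) * h1

end PaperED
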